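/- Let n ∈ {3, 4}. For every M > 0 there exists a constant C > 0, depending only on n and M, such that the following holds: if u : B₁ → ℝ is a C^∞ function on the open unit ball B₁ ⊂ ℝⁿ with λ(D²u) ∈ Γ₂ and σ₂(λ(D²u))/σ₁(λ(D²u)) = 1 at every point of B₁, and if sup_{B₁} |u| + sup_{B₁} |Du| ≤ M, then the Hessian at the origin satisfies |D²u(0)| ≤ C. -/

import Mathlib

/-- The `k`-th elementary symmetric polynomial `σ_k` of `λ ∈ ℝⁿ`. -/
noncomputable def sigma (n k : ℕ) (lam : Fin n → ℝ) : ℝ :=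
  ∑ s ∈ Finset.univ.powersetCard k, ∏ i ∈ s, lam i

/-- Gårding's cone `Γ_k`: all `σ_l`, `1 ≤ l ≤ k`, are positive. -/
def InGamma (n k : ℕ) (lam : Fin n → ℝ) : Prop :=
  ∀ l : ℕ, 1 ≤ l → l ≤ k → 0 < sigma n l lam

/-- The Hessian matrix `D²u` of `u : ℝⁿ → ℝ` at `x`. -/
noncomputable def hess {n : ℕ} (u : EuclideanSpace ℝ (Fin n) → ℝ)
    (x : EuclideanSpace ℝ (Fin n)) : Matrix (Fin n) (Fin n) ℝ :=
  Matrix.of fun i j =>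
    fderiv ℝ (fun y => fderiv ℝ u y (EuclideanSpace.single j 1)) x (EuclideanSpace.single i 1)


namespace SY
open scoped ContDiff
open Filter Topology

/-- directional derivative -/
noncomputable def dd {n : ℕ} (v : EuclideanSpace ℝ (Fin n)) (f : EuclideanSpace ℝ (Fin n) → ℝ) :
    EuclideanSpace ℝ (Fin n) → ℝ := fun x => fderiv ℝ f x v

section dcalc
variable {n : ℕ} {f g : EuclideanSpace ℝ (Fin n) → ℝ} {v w x : EuclideanSpace ℝ (Fin n)}

lemma dd_smooth (hf : ContDiff ℝ ∞ f) : ContDiff ℝ ∞ (dd v f) := by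
  unfold dd
  exact (hf.fderiv_right (m := ∞) (by simp)).clm_apply contDiff_const

lemma dd_diff (hf : ContDiff ℝ ∞ f) : Differentiable ℝ f :=
  hf.differentiable (by simp)

lemma dd_dd (hf : ContDiff ℝ ∞ f) : dd v (dd w f) x = fderiv ℝ (fderiv ℝ f) x v w := by
  unfold dd
  have h : DifferentiableAt ℝ (fderiv ℝ f) x :=
    ((hf.fderiv_right (m := ∞) (by simp)).differentiable (by simp)) x
  rw [fderiv_clm_apply h (by fun_prop)]
  simp

lemma dd_comm (hf : ContDiff ℝ ∞ f) : dd v (dd w f) = dd w (dd v f) := by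
  funext x
  rw [dd_dd hf, dd_dd hf]
  have h : IsSymmSndFDerivAt ℝ f x := by
    apply ContDiffAt.isSymmSndFDerivAt hf.contDiffAt
    simp only [minSmoothness_of_isRCLikeNormedField]
    exact ENat.LEInfty.out
  exact h v w

lemma line_deriv (hf : ContDiff ℝ ∞ f) (t : ℝ) :
    HasDerivAt (fun t : ℝ => f (x + t • v)) (dd v f (x + t • v)) t := by
  have h1 : HasDerivAt (fun t : ℝ => x + t • v) v t := by
    simpa using ((hasDerivAt_id t).smul_const v).const_add x
  exact ((dd_diff hf) (x + t • v)).hasFDerivAt.comp_hasDerivAt t h1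

end dcalc

/-- second order jets at zero -/
def J (g : ℝ → ℝ) (a b c : ℝ) : Prop :=
  g 0 = a ∧ ∃ g' : ℝ → ℝ, (∀ᶠ t in 𝓝 (0:ℝ), HasDerivAt g (g' t) t) ∧ g' 0 = b ∧ HasDerivAt g' c 0

section jets
variable {g h : ℝ → ℝ} {a b c a' b' c' : ℝ}

lemma J.congr (hg : J g a b c) (e : a = a') (e' : b = b') (e'' : c = c') : J g a' b' c' := by
  subst e e' e''; exact hg

lemma J.const (k : ℝ) : J (fun _ => k) k 0 0 :=
  ⟨rfl, fun _ => 0, Eventually.of_forall fun t => hasDerivAt_const t k, rfl, hasDerivAt_const _ _⟩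

lemma J.add (hg : J g a b c) (hh : J h a' b' c') :
    J (fun t => g t + h t) (a + a') (b + b') (c + c') := by
  obtain ⟨h0, g', h1, h2, h3⟩ := hg
  obtain ⟨k0, k', k1, k2, k3⟩ := hh
  refine ⟨by simp [h0, k0], fun t => g' t + k' t, ?_, by simp [h2, k2], h3.add k3⟩
  filter_upwards [h1, k1] with t ht kt using ht.add kt

lemma J.mul (hg : J g a b c) (hh : J h a' b' c') :
    J (fun t => g t * h t) (a * a') (b * a' + a * b') (c * a' + 2 * b * b' + a * c') := by
  obtain ⟨h0, g', h1, h2, h3⟩ := hg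
  obtain ⟨k0, k', k1, k2, k3⟩ := hh
  refine ⟨by simp [h0, k0], fun t => g' t * h t + g t * k' t, ?_, by simp [h2, k2, h0, k0], ?_⟩
  · filter_upwards [h1, k1] with t ht kt using ht.mul kt
  · have := (h3.mul k1.self_of_nhds).add (h1.self_of_nhds.mul k3)
    have e : c * a' + 2 * b * b' + a * c' =
        c * h 0 + g' 0 * k' 0 + (g' 0 * k' 0 + g 0 * c') := by
      rw [h0, k0, h2, k2]; ring
    rw [e]; exact this

lemma J.smul (k : ℝ) (hg : J g a b c) : J (fun t => k * g t) (k * a) (k * b) (k * c) :=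
  ((J.const k).mul hg).congr rfl (by ring) (by ring)

lemma J.sum {ι : Type*} (S : Finset ι) {G : ι → ℝ → ℝ} {A B C : ι → ℝ}
    (H : ∀ i ∈ S, J (G i) (A i) (B i) (C i)) :
    J (fun t => ∑ i ∈ S, G i t) (∑ i ∈ S, A i) (∑ i ∈ S, B i) (∑ i ∈ S, C i) := by
  classical
  induction S using Finset.induction_on with
  | empty => simpa using J.const 0
  | insert i S hi ih =>
    simp only [Finset.sum_insert hi]
    exact (H i (Finset.mem_insert_self _ _)).add
      (ih fun j hj => H j (Finset.mem_insert_of_mem hj))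

lemma J.log (hg : J g a b c) (ha : 0 < a) :
    J (fun t => Real.log (g t)) (Real.log a) (b / a) (c / a - (b / a) ^ 2) := by
  obtain ⟨h0, g', h1, h2, h3⟩ := hg
  have hg0 : g 0 ≠ 0 := by rw [h0]; exact ha.ne'
  have hne : ∀ᶠ t in 𝓝 (0:ℝ), g t ≠ 0 :=
    h1.self_of_nhds.continuousAt.eventually_ne hg0
  refine ⟨by simp [h0], fun t => g' t / g t, ?_, by simp [h2, h0], ?_⟩
  · filter_upwards [h1, hne] with t ht kt using ht.log kt
  · have := h3.div h1.self_of_nhds hg0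
    have e : c / a - (b / a) ^ 2 = (c * g 0 - g' 0 * g' 0) / g 0 ^ 2 := by
      rw [h0, h2]; field_simp
    rw [e]; exact this

lemma J.unique (hg : J g a b c) (hh : J g a' b' c') : b = b' ∧ c = c' := by
  obtain ⟨h0, g', h1, h2, h3⟩ := hg
  obtain ⟨k0, k', k1, k2, k3⟩ := hh
  have e : g' =ᶠ[𝓝 0] k' := by
    filter_upwards [h1, k1] with t ht kt using ht.unique kt
  refine ⟨by rw [← h2, ← k2, e.self_of_nhds], ?_⟩
  exact h3.unique (k3.congr_of_eventuallyEq e)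

lemma J.congr_fun (hg : J g a b c) (e : g =ᶠ[𝓝 0] h) : J h a b c := by
  obtain ⟨h0, g', h1, h2, h3⟩ := hg
  refine ⟨by rw [← e.self_of_nhds, h0], g', ?_, h2, h3⟩
  filter_upwards [h1, e.eventually_nhds] with t ht et
  exact ht.congr_of_eventuallyEq (EventuallyEq.symm et)

lemma J.max (hg : J g a b c) (hm : IsLocalMax g 0) : b = 0 ∧ c ≤ 0 := by
  obtain ⟨h0, g', h1, h2, h3⟩ := hg
  have hb : b = 0 := by rw [← h2]; exact hm.hasDerivAt_eq_zero h1.self_of_nhds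
  refine ⟨hb, ?_⟩
  by_contra hc
  push Not at hc
  have hderiv : deriv g =ᶠ[𝓝 0] g' := by
    filter_upwards [h1] with t ht using ht.deriv
  have hd2 : deriv (deriv g) 0 = c := (h3.congr_of_eventuallyEq hderiv).deriv
  have hmin : IsLocalMin g 0 := by
    apply isLocalMin_of_deriv_deriv_pos (by rw [hd2]; exact hc)
    · rw [hderiv.self_of_nhds, h2, hb]
    · exact h1.self_of_nhds.continuousAt
  have hcst : g =ᶠ[𝓝 0] fun _ => g 0 := by
    filter_upwards [hm, hmin] with t h1 h2 using le_antisymm h1 h2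
  have hJ : J g (g 0) 0 0 := (J.const (g 0)).congr_fun hcst.symm
  have := (J.unique ⟨h0, g', h1, h2, h3⟩ hJ).2
  linarith

lemma J.of_smooth {n : ℕ} {f : EuclideanSpace ℝ (Fin n) → ℝ} (hf : ContDiff ℝ ∞ f)
    (x v : EuclideanSpace ℝ (Fin n)) :
    J (fun t => f (x + t • v)) (f x) (dd v f x) (dd v (dd v f) x) := by
  refine ⟨by simp, fun t => dd v f (x + t • v), Eventually.of_forall fun t => line_deriv hf t,
    by simp, ?_⟩
  simpa using line_deriv (x := x) (v := v) (dd_smooth (v := v) hf) 0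

lemma J_inner {n : ℕ} (p x v : EuclideanSpace ℝ (Fin n)) :
    J (fun t => inner ℝ (x + t • v) p) (inner ℝ x p) (inner ℝ v p) 0 := by
  have e : (fun t : ℝ => inner ℝ (x + t • v) p) = fun t : ℝ => inner ℝ x p + t * inner ℝ v p := by
    funext t; rw [inner_add_left, real_inner_smul_left]
  rw [e]
  refine ⟨by simp, fun _ => inner ℝ v p, Eventually.of_forall fun t => ?_, rfl, hasDerivAt_const _ _⟩
  simpa using ((hasDerivAt_id t).mul_const (inner ℝ v p)).const_add (inner ℝ x p)

lemma J_sq {n : ℕ} (x0 x v : EuclideanSpace ℝ (Fin n)) (hv : ‖v‖ = 1) :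
    J (fun t => ‖x + t • v - x0‖ ^ 2) (‖x - x0‖ ^ 2) (2 * inner ℝ (x - x0) v) 2 := by
  have e : (fun t : ℝ => ‖x + t • v - x0‖ ^ 2) =
      fun t : ℝ => ‖x - x0‖ ^ 2 + (2 * inner ℝ (x - x0) v) * t + t ^ 2 := by
    funext t
    rw [show x + t • v - x0 = (x - x0) + t • v by abel, norm_add_sq_real, real_inner_smul_right,
      norm_smul, hv]
    simp; ring
  rw [e]
  refine ⟨by simp, fun t => 2 * inner ℝ (x - x0) v + 2 * t, Eventually.of_forall fun t => ?_,
    by simp, ?_⟩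
  · have := (((hasDerivAt_id t).const_mul (2 * inner ℝ (x - x0) v)).const_add
      (‖x - x0‖ ^ 2)).add (hasDerivAt_pow 2 t)
    have e : 2 * inner ℝ (x - x0) v + 2 * t =
        2 * inner ℝ (x - x0) v * 1 + ((2 : ℕ) : ℝ) * t ^ (2 - 1) := by norm_num
    change HasDerivAt _ (2 * inner ℝ (x - x0) v + 2 * t) t
    rw [e]; exact this
  · have := ((hasDerivAt_id (0:ℝ)).const_mul (2:ℝ)).const_add (2 * inner ℝ (x - x0) v)
    simpa using this

end jets
end SY
namespace SY
open Finset

section alg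
variable {n : ℕ} {lam : Fin n → ℝ} {s c : ℝ}

lemma lam_sq_le (h2 : s ^ 2 - ∑ i, lam i ^ 2 = 2 * c) (i : Fin n) :
    lam i ^ 2 ≤ s ^ 2 - 2 * c := by
  have : lam i ^ 2 ≤ ∑ i, lam i ^ 2 :=
    single_le_sum (f := fun i => lam i ^ 2) (fun j _ => sq_nonneg _) (mem_univ i)
  linarith

lemma lam_lt (hs : 0 < s) (hc : 0 < c) (h2 : s ^ 2 - ∑ i, lam i ^ 2 = 2 * c) (i : Fin n) :
    lam i < s := by
  have := lam_sq_le h2 i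
  nlinarith

lemma lam_gt (hs : 0 < s) (hc : 0 < c) (h2 : s ^ 2 - ∑ i, lam i ^ 2 = 2 * c) (i : Fin n) :
    -s < lam i := by
  have := lam_sq_le h2 i
  nlinarith

lemma lam_ge (hn : n ≤ 4) (hs : 0 < s) (hc : 0 < c) (h1 : ∑ i, lam i = s)
    (h2 : s ^ 2 - ∑ i, lam i ^ 2 = 2 * c) (i : Fin n) : - s / 2 ≤ lam i := by
  have e1 : ∑ j ∈ univ.erase i, lam j = s - lam i := by
    rw [← h1, ← add_sum_erase univ lam (mem_univ i)]; ring
  have e2 : ∑ j ∈ univ.erase i, lam j ^ 2 = s ^ 2 - 2 * c - lam i ^ 2 := by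
    have := add_sum_erase univ (fun j => lam j ^ 2) (mem_univ i)
    linarith
  have h3 := sq_sum_le_card_mul_sum_sq (s := univ.erase i) (f := lam)
  rw [e1, e2] at h3
  have h4 : ((univ.erase i).card : ℝ) ≤ 3 := by
    rw [card_erase_of_mem (mem_univ i)]; simp; exact_mod_cast hn
  have h5 := lam_lt hs hc h2 i
  have h6 := lam_gt hs hc h2 i
  have h7 : 0 ≤ s ^ 2 - 2 * c - lam i ^ 2 := by linarith [lam_sq_le h2 i]
  have h8 : (s - lam i) ^ 2 ≤ 3 * (s ^ 2 - 2 * c - lam i ^ 2) :=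
    h3.trans (mul_le_mul_of_nonneg_right h4 h7)
  by_contra h
  push Not at h
  nlinarith [mul_pos (sub_pos.2 h5) (sub_pos.2 h)]

lemma poly4 {y : ℝ} (hy : 0 < y) (hy2 : y ≤ 3 / 2) :
    (9 + 8 * y ^ 2 - 12 * y) * (1 + y) ≤ 9 + 6 * y ^ 2 := by
  nlinarith [mul_nonneg hy.le (mul_nonneg (by linarith : (0:ℝ) ≤ 3 - 2 * y) (by linarith : (0:ℝ) ≤ 4 * y + 1))]

lemma poly3 {y : ℝ} (hy : 0 < y) (hy2 : y ≤ 3 / 2) :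
    (6 + 6 * y ^ 2 - 8 * y) * (1 + y) ≤ 6 + 6 * y ^ 2 := by
  nlinarith [mul_nonneg hy.le (mul_nonneg (by linarith : (0:ℝ) ≤ 3 - 2 * y) hy.le)]

lemma poly4' {y : ℝ} (hy : 0 < y) (hy2 : y ≤ 5 / 4) :
    (9 + 8 * y ^ 2 - 12 * y) * (1 + (1 + 1 / 18) * y) ≤ 9 + 6 * y ^ 2 := by
  nlinarith [mul_nonneg hy.le (mul_nonneg (by linarith : (0:ℝ) ≤ 5 - 4 * y) hy.le)]

lemma poly3' {y : ℝ} (hy : 0 < y) (hy2 : y ≤ 5 / 4) :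
    (6 + 6 * y ^ 2 - 8 * y) * (1 + (1 + 1 / 18) * y) ≤ 6 + 6 * y ^ 2 := by
  nlinarith [mul_nonneg hy.le (mul_nonneg (by linarith : (0:ℝ) ≤ 5 - 4 * y) hy.le)]

lemma jac_row (hn : 2 ≤ n) (hs : 0 < s) (hc : 0 < c) (h1 : ∑ i, lam i = s)
    (h2 : s ^ 2 - ∑ i, lam i ^ 2 = 2 * c) (i : Fin n) (t : Fin n → ℝ)
    (ht : ∑ j, (s - lam j) * t j = 0) (e m y : ℝ) (hm : m = n - 1) (hy : y = (s - lam i) / s)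
    (he : 0 ≤ e)
    (hp : (3 * m + 2 * y ^ 2 + 2 * m * y ^ 2 - 4 * m * y) * (1 + (1 + e) * y) ≤ 3 * (m + 2 * y ^ 2)) :
    (1 + (1 + e) * y) * (∑ j, t j) ^ 2 ≤ 3 * ∑ j, t j ^ 2 - 2 * t i ^ 2 := by
  have hm1 : 1 ≤ m := by
    rw [hm]; have : (2:ℝ) ≤ n := by exact_mod_cast hn
    linarith
  have hy0 : 0 < y := by rw [hy]; exact div_pos (sub_pos.2 (lam_lt hs hc h2 i)) hs
  set g : Fin n → ℝ := fun j => (s - lam j) / s with hg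
  have hgi : g i = y := by rw [hy]
  have hD : 0 < m + 2 * y ^ 2 := by positivity
  set mu : ℝ := (m + 2 * y) / (m + 2 * y ^ 2) with hmu
  have hmuD : mu * (m + 2 * y ^ 2) = m + 2 * y := by rw [hmu]; field_simp
  have hgt : ∑ j, g j * t j = 0 := by
    have : ∑ j, g j * t j = (∑ j, (s - lam j) * t j) / s := by
      rw [sum_div]; refine sum_congr rfl fun j _ => ?_
      simp only [hg]; ring
    rw [this, ht, zero_div]
  have hg1 : ∑ j, g j = m := by
    simp only [hg]; rw [← sum_div, sum_sub_distrib, h1]; simp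
    rw [hm]; field_simp
  have hg2 : ∑ j, g j ^ 2 ≤ m := by
    have : ∑ j, g j ^ 2 = (m * s ^ 2 - 2 * c) / s ^ 2 := by
      simp only [hg, div_pow]; rw [← sum_div]
      congr 1
      simp only [sub_sq]
      rw [sum_add_distrib, sum_sub_distrib, ← mul_sum, h1]
      simp
      rw [hm]; linarith
    rw [this, div_le_iff₀ (by positivity)]; linarith
  have hsum : ∑ j, t j = ∑ j, (1 - mu * g j) * t j := by
    have : ∑ j, (1 - mu * g j) * t j = ∑ j, t j - mu * ∑ j, g j * t j := by
      rw [mul_sum, ← sum_sub_distrib]; exact sum_congr rfl fun j _ => by ring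
    rw [this, hgt]; ring
  set W : Fin n → ℝ := fun j => if j = i then 1 else 3 with hW
  have hWpos : ∀ j, 0 < W j := fun j => by simp only [hW]; split_ifs <;> norm_num
  have hCS : (∑ j, (1 - mu * g j) * t j) ^ 2 ≤
      (∑ j, (1 - mu * g j) ^ 2 / W j) * ∑ j, W j * t j ^ 2 := by
    apply sum_sq_le_sum_mul_sum_of_sq_le_mul
    · intro j _; exact div_nonneg (sq_nonneg _) (hWpos j).le
    · intro j _; exact mul_nonneg (hWpos j).le (sq_nonneg _)
    · intro j _; have := (hWpos j).ne'; apply le_of_eq; field_simp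
  have hWt : ∑ j, W j * t j ^ 2 = 3 * ∑ j, t j ^ 2 - 2 * t i ^ 2 := by
    have : ∀ j, W j * t j ^ 2 = 3 * t j ^ 2 - (if j = i then 2 * t j ^ 2 else 0) := by
      intro j; simp only [hW]; split_ifs <;> ring
    simp only [this, sum_sub_distrib, ← mul_sum]
    simp
  have hWa : ∑ j, (1 - mu * g j) ^ 2 / W j =
      1 / 3 * ∑ j, (1 - mu * g j) ^ 2 + 2 / 3 * (1 - mu * y) ^ 2 := by
    have : ∀ j, (1 - mu * g j) ^ 2 / W j = 1 / 3 * (1 - mu * g j) ^ 2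
        + (if j = i then 2 / 3 * (1 - mu * g j) ^ 2 else 0) := by
      intro j; simp only [hW]; split_ifs <;> ring
    simp only [this, sum_add_distrib, ← mul_sum]
    simp [hgi]
  have hA : ∑ j, (1 - mu * g j) ^ 2 ≤ (m + 1) - 2 * mu * m + mu ^ 2 * m := by
    have : ∑ j, (1 - mu * g j) ^ 2 = n - 2 * mu * ∑ j, g j + mu ^ 2 * ∑ j, g j ^ 2 := by
      have e : ∀ j, (1 - mu * g j) ^ 2 = 1 - 2 * mu * g j + mu ^ 2 * g j ^ 2 := fun j => by ring
      simp only [e, sum_add_distrib, sum_sub_distrib, ← mul_sum]; simp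
    rw [this, hg1]
    have := mul_le_mul_of_nonneg_left hg2 (sq_nonneg mu)
    rw [hm] at *; linarith
  have hB : (∑ j, (1 - mu * g j) ^ 2 / W j) * (3 * (m + 2 * y ^ 2)) ≤
      3 * m + 2 * y ^ 2 + 2 * m * y ^ 2 - 4 * m * y := by
    rw [hWa]
    have : (1 / 3 * ((m + 1) - 2 * mu * m + mu ^ 2 * m) + 2 / 3 * (1 - mu * y) ^ 2) *
        (3 * (m + 2 * y ^ 2)) = 3 * m + 2 * y ^ 2 + 2 * m * y ^ 2 - 4 * m * y := by
      have e : (1 / 3 * ((m + 1) - 2 * mu * m + mu ^ 2 * m) + 2 / 3 * (1 - mu * y) ^ 2) *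
        (3 * (m + 2 * y ^ 2)) = (m + 3) * (m + 2 * y ^ 2)
          - 2 * (mu * (m + 2 * y ^ 2)) * (m + 2 * y) + (mu * (m + 2 * y ^ 2)) ^ 2 := by ring
      rw [e, hmuD]; ring
    rw [← this]
    apply mul_le_mul_of_nonneg_right _ (by positivity)
    linarith
  rw [hsum]
  set X := ∑ j, (1 - mu * g j) ^ 2 / W j
  set Z := ∑ j, W j * t j ^ 2 with hZ
  have hZ0 : 0 ≤ Z := sum_nonneg fun j _ => mul_nonneg (hWpos j).le (sq_nonneg _)
  rw [← hWt]
  have hk : 0 < 1 + (1 + e) * y := by positivity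
  have hX : (1 + (1 + e) * y) * X ≤ 1 := by
    have h5 : ((1 + (1 + e) * y) * X) * (3 * (m + 2 * y ^ 2)) ≤ 1 * (3 * (m + 2 * y ^ 2)) := by
      calc _ = (X * (3 * (m + 2 * y ^ 2))) * (1 + (1 + e) * y) := by ring
        _ ≤ _ := mul_le_mul_of_nonneg_right hB hk.le
        _ ≤ _ := by linarith
    exact le_of_mul_le_mul_right h5 (by positivity)
  calc _ ≤ (1 + (1 + e) * y) * (X * Z) := mul_le_mul_of_nonneg_left hCS hk.le
    _ = ((1 + (1 + e) * y) * X) * Z := by ring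
    _ ≤ 1 * Z := mul_le_mul_of_nonneg_right hX hZ0
    _ = Z := one_mul _

lemma sum_T (T : Fin n → Fin n → Fin n → ℝ) (h12 : ∀ i j k, T i j k = T j i k)
    (h23 : ∀ i j k, T i j k = T i k j) :
    ∑ i, (3 * ∑ j, T j j i ^ 2 - 2 * T i i i ^ 2) ≤ ∑ i, ∑ j, ∑ k, T i j k ^ 2 := by
  have key : ∀ i j k, (if i = j then T i j k ^ 2 else 0) + (if j = k then T i j k ^ 2 else 0)
      + (if i = k then T i j k ^ 2 else 0) - 2 * (if i = j then (if j = k then T i j k ^ 2 else 0) else 0)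
      ≤ T i j k ^ 2 := by
    intro i j k
    have := sq_nonneg (T i j k)
    by_cases h1 : i = j
    · subst h1; by_cases h2 : i = k
      · simp only [h2, if_true]; linarith
      · simp [h2]
    · by_cases h2 : j = k
      · subst h2; simp [h1]
      · by_cases h3 : i = k
        · subst h3; simp [h1, h2]
        · simp [h1, h2, h3]; exact this
  have h := sum_le_sum fun i (_ : i ∈ univ) => sum_le_sum fun j (_ : j ∈ univ) =>
    sum_le_sum fun k (_ : k ∈ univ) => key i j k
  refine le_trans (le_of_eq ?_) h
  simp only [sum_add_distrib, sum_sub_distrib, ← mul_sum]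
  have e1 : ∑ i, ∑ j, ∑ k, (if i = j then T i j k ^ 2 else 0) = ∑ i, ∑ j, T j j i ^ 2 := by
    rw [sum_comm' (t' := univ) (s' := fun _ => univ) (by simp)]
    rw [sum_comm (s := univ) (t := univ) (f := fun i j => T j j i ^ 2)]
    refine sum_congr rfl fun j _ => ?_
    rw [sum_comm]
    refine sum_congr rfl fun k _ => ?_
    simp
  have e2 : ∑ i, ∑ j, ∑ k, (if j = k then T i j k ^ 2 else 0) = ∑ i, ∑ j, T j j i ^ 2 := by
    refine sum_congr rfl fun i _ => sum_congr rfl fun j _ => ?_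
    simp only [sum_ite_eq, mem_univ, if_true]
    rw [h12 i j j, h23 j i j]
  have e3 : ∑ i, ∑ j, ∑ k, (if i = k then T i j k ^ 2 else 0) = ∑ i, ∑ j, T j j i ^ 2 := by
    rw [sum_comm (s := univ) (t := univ) (f := fun i j => T j j i ^ 2)]
    refine sum_congr rfl fun i _ => sum_congr rfl fun j _ => ?_
    simp only [sum_ite_eq, mem_univ, if_true]
    rw [h23 i j i]
  have e4 : ∑ i, ∑ j, ∑ k, (if i = j then (if j = k then T i j k ^ 2 else 0) else 0)
      = ∑ i, T i i i ^ 2 := by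
    refine sum_congr rfl fun i _ => ?_
    rw [sum_eq_single i]
    · simp
    · intro j _ hj; simp [Ne.symm hj]
    · simp
  rw [e1, e2, e3, e4]; ring

lemma jac (hn2 : n = 3 ∨ n = 4) (hs : 0 < s) (hc : 0 < c) (h1 : ∑ i, lam i = s)
    (h2 : s ^ 2 - ∑ i, lam i ^ 2 = 2 * c) (T : Fin n → Fin n → Fin n → ℝ)
    (h12 : ∀ i j k, T i j k = T j i k) (h23 : ∀ i j k, T i j k = T i k j)
    (hT : ∀ k, ∑ j, (s - lam j) * T j j k = 0) (s1 : Fin n → ℝ) (hs1 : ∀ k, s1 k = ∑ j, T j j k)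
    (X : ℝ) (hX : X = ∑ i, ∑ j, ∑ k, T i j k ^ 2 - ∑ k, s1 k ^ 2) :
    ∑ i, (s - lam i) * s1 i ^ 2 ≤ s * X ∧
    ((∀ i, - s / 4 ≤ lam i) → (1 + 1 / 18) * ∑ i, (s - lam i) * s1 i ^ 2 ≤ s * X) := by
  have hsum := sum_T T h12 h23
  have gen : ∀ e : ℝ, 0 ≤ e → (∀ i, (3 * ((n:ℝ) - 1) + 2 * ((s - lam i) / s) ^ 2 + 2 * ((n:ℝ) - 1) * ((s - lam i) / s) ^ 2
      - 4 * ((n:ℝ) - 1) * ((s - lam i) / s)) * (1 + (1 + e) * ((s - lam i) / s)) ≤ 3 * (((n:ℝ) - 1) + 2 * ((s - lam i) / s) ^ 2)) →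
      (1 + e) * ∑ i, (s - lam i) * s1 i ^ 2 ≤ s * X := by
    intro e he hp
    have hr : ∀ i, (1 + (1 + e) * ((s - lam i) / s)) * (s1 i) ^ 2 ≤ 3 * ∑ j, T j j i ^ 2 - 2 * T i i i ^ 2 := by
      intro i
      rw [hs1 i]
      exact jac_row (by omega) hs hc h1 h2 i (fun j => T j j i) (hT i) e _ _ rfl rfl he (hp i)
    have hr2 := sum_le_sum fun i (_ : i ∈ univ) => hr i
    have hX2 : ∑ i, (1 + (1 + e) * ((s - lam i) / s)) * (s1 i) ^ 2 - ∑ k, s1 k ^ 2 ≤ X := by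
      rw [hX]; linarith
    have e3 : ∑ i, (1 + (1 + e) * ((s - lam i) / s)) * (s1 i) ^ 2 - ∑ k, s1 k ^ 2
        = ((1 + e) * ∑ i, (s - lam i) * s1 i ^ 2) / s := by
      rw [← sum_sub_distrib, mul_sum, sum_div]
      refine sum_congr rfl fun i _ => ?_
      field_simp; ring
    rw [e3, div_le_iff₀ hs] at hX2
    linarith
  have hy0 : ∀ i, 0 < (s - lam i) / s := fun i => div_pos (sub_pos.2 (lam_lt hs hc h2 i)) hs
  constructor
  · have := gen 0 le_rfl ?_
    · simpa using this
    · intro i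
      have hy : (s - lam i) / s ≤ 3 / 2 := by
        rw [div_le_iff₀ hs]; linarith [lam_ge (by omega) hs hc h1 h2 i]
      rcases hn2 with h | h
      · subst h; have := poly3 (hy0 i) hy; push_cast; nlinarith
      · subst h; have := poly4 (hy0 i) hy; push_cast; nlinarith
  · intro hl
    refine gen (1 / 18) (by norm_num) fun i => ?_
    have hy : (s - lam i) / s ≤ 5 / 4 := by
      rw [div_le_iff₀ hs]; linarith [hl i]
    rcases hn2 with h | h
    · subst h; have := poly3' (hy0 i) hy; push_cast; nlinarith
    · subst h; have := poly4' (hy0 i) hy; push_cast; nlinarith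

end alg
end SY
namespace SY
open scoped ContDiff
open Finset

section frame
variable {n : ℕ}

/-- Laplacian -/
noncomputable def lap (u : EuclideanSpace ℝ (Fin n) → ℝ) (x : EuclideanSpace ℝ (Fin n)) : ℝ :=
  ∑ i, dd (EuclideanSpace.basisFun (Fin n) ℝ i) (dd (EuclideanSpace.basisFun (Fin n) ℝ i) u) x

/-- Frobenius norm squared of the Hessian -/
noncomputable def frob (u : EuclideanSpace ℝ (Fin n) → ℝ) (x : EuclideanSpace ℝ (Fin n)) : ℝ :=
  ∑ i, ∑ j, (dd (EuclideanSpace.basisFun (Fin n) ℝ i)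
    (dd (EuclideanSpace.basisFun (Fin n) ℝ j) u) x) ^ 2

/-- Hessian operator -/
noncomputable def hop (u : EuclideanSpace ℝ (Fin n) → ℝ) (x : EuclideanSpace ℝ (Fin n)) :
    EuclideanSpace ℝ (Fin n) →ₗ[ℝ] EuclideanSpace ℝ (Fin n) :=
  ((InnerProductSpace.toDual ℝ (EuclideanSpace ℝ (Fin n))).symm.toLinearEquiv.toLinearMap).comp
    (fderiv ℝ (fderiv ℝ u) x).toLinearMap

variable {u : EuclideanSpace ℝ (Fin n) → ℝ}

lemma hop_inner (hu : ContDiff ℝ ∞ u) (x v w : EuclideanSpace ℝ (Fin n)) :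
    inner ℝ (hop u x v) w = dd v (dd w u) x := by
  rw [dd_dd hu]; simp [hop]

lemma hop_symm (hu : ContDiff ℝ ∞ u) (x : EuclideanSpace ℝ (Fin n)) : (hop u x).IsSymmetric := by
  intro v w
  rw [hop_inner hu, real_inner_comm, hop_inner hu, dd_comm hu]

lemma lap_trace (hu : ContDiff ℝ ∞ u) (x : EuclideanSpace ℝ (Fin n))
    (b : OrthonormalBasis (Fin n) ℝ (EuclideanSpace ℝ (Fin n))) :
    ∑ i, dd (b i) (dd (b i) u) x = LinearMap.trace ℝ _ (hop u x) := by
  rw [LinearMap.trace_eq_sum_inner (hop u x) b]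
  refine sum_congr rfl fun i _ => ?_
  rw [real_inner_comm, hop_inner hu]

lemma lap_eq (hu : ContDiff ℝ ∞ u) (x : EuclideanSpace ℝ (Fin n))
    (b : OrthonormalBasis (Fin n) ℝ (EuclideanSpace ℝ (Fin n))) :
    lap u x = ∑ i, dd (b i) (dd (b i) u) x := by
  rw [lap_trace hu, lap, lap_trace hu]

lemma frob_trace (hu : ContDiff ℝ ∞ u) (x : EuclideanSpace ℝ (Fin n))
    (b : OrthonormalBasis (Fin n) ℝ (EuclideanSpace ℝ (Fin n))) :
    ∑ i, ∑ j, (dd (b i) (dd (b j) u) x) ^ 2 = LinearMap.trace ℝ _ (hop u x ∘ₗ hop u x) := by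
  rw [LinearMap.trace_eq_sum_inner (hop u x ∘ₗ hop u x) b]
  refine sum_congr rfl fun i _ => ?_
  rw [LinearMap.comp_apply, ← hop_symm hu, real_inner_self_eq_norm_sq, ← b.sum_sq_norm_inner_right]
  refine sum_congr rfl fun j _ => ?_
  rw [← hop_inner hu, real_inner_comm]; simp

lemma frob_eq (hu : ContDiff ℝ ∞ u) (x : EuclideanSpace ℝ (Fin n))
    (b : OrthonormalBasis (Fin n) ℝ (EuclideanSpace ℝ (Fin n))) :
    frob u x = ∑ i, ∑ j, (dd (b i) (dd (b j) u) x) ^ 2 := by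
  rw [frob_trace hu, frob, frob_trace hu]

lemma exists_eigen (hu : ContDiff ℝ ∞ u) (x : EuclideanSpace ℝ (Fin n)) :
    ∃ (b : OrthonormalBasis (Fin n) ℝ (EuclideanSpace ℝ (Fin n))) (lam : Fin n → ℝ),
      ∀ i j, dd (b i) (dd (b j) u) x = if i = j then lam i else 0 := by
  have hd : Module.finrank ℝ (EuclideanSpace ℝ (Fin n)) = n := by simp
  refine ⟨(hop_symm hu x).eigenvectorBasis hd, (hop_symm hu x).eigenvalues hd, fun i j => ?_⟩
  rw [← hop_inner hu, (hop_symm hu x).apply_eigenvectorBasis hd]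
  rw [real_inner_smul_left, OrthonormalBasis.inner_eq_ite]
  split_ifs <;> simp

lemma lap_smooth (hu : ContDiff ℝ ∞ u) : ContDiff ℝ ∞ (lap u) := by
  unfold lap
  exact ContDiff.sum fun i _ => dd_smooth (dd_smooth hu)

/-- solutions -/
structure Sol (c R M : ℝ) (u : EuclideanSpace ℝ (Fin n) → ℝ) : Prop where
  smooth : ContDiff ℝ ∞ u
  pos : ∀ x ∈ Metric.ball (0 : EuclideanSpace ℝ (Fin n)) R, 0 < lap u x
  eq : ∀ x ∈ Metric.ball (0 : EuclideanSpace ℝ (Fin n)) R, lap u x ^ 2 - frob u x = 2 * c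
  bd0 : ∀ x ∈ Metric.ball (0 : EuclideanSpace ℝ (Fin n)) R, |u x| ≤ M
  bd1 : ∀ x ∈ Metric.ball (0 : EuclideanSpace ℝ (Fin n)) R, ‖fderiv ℝ u x‖ ≤ M

/-- eigenframe data at a point -/
structure Frame (c : ℝ) (u : EuclideanSpace ℝ (Fin n) → ℝ) (x : EuclideanSpace ℝ (Fin n))
    (b : OrthonormalBasis (Fin n) ℝ (EuclideanSpace ℝ (Fin n))) (lam : Fin n → ℝ) : Prop where
  diag : ∀ i j, dd (b i) (dd (b j) u) x = if i = j then lam i else 0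
  pos : 0 < lap u x
  sum : ∑ i, lam i = lap u x
  sq : lap u x ^ 2 - ∑ i, lam i ^ 2 = 2 * c
  third : ∀ k, ∑ i, (lap u x - lam i) * dd (b i) (dd (b i) (dd (b k) u)) x = 0
  jac0 : ∑ i, (lap u x - lam i) * (dd (b i) (lap u) x) ^ 2 ≤
    lap u x * ∑ i, (lap u x - lam i) * dd (b i) (dd (b i) (lap u)) x
  jac1 : (∀ i, - lap u x / 4 ≤ lam i) →
    (1 + 1 / 18) * ∑ i, (lap u x - lam i) * (dd (b i) (lap u) x) ^ 2 ≤
    lap u x * ∑ i, (lap u x - lam i) * dd (b i) (dd (b i) (lap u)) x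

lemma eq_jets {c R M : ℝ} (S : Sol c R M u) {x : EuclideanSpace ℝ (Fin n)}
    (hx : x ∈ Metric.ball (0 : EuclideanSpace ℝ (Fin n)) R)
    (b : OrthonormalBasis (Fin n) ℝ (EuclideanSpace ℝ (Fin n))) (v : EuclideanSpace ℝ (Fin n)) :
    lap u x * dd v (lap u) x = ∑ i, ∑ j, dd (b i) (dd (b j) u) x * dd v (dd (b i) (dd (b j) u)) x ∧
    (dd v (lap u) x) ^ 2 + lap u x * dd v (dd v (lap u)) x =
      ∑ i, ∑ j, ((dd v (dd (b i) (dd (b j) u)) x) ^ 2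
        + dd (b i) (dd (b j) u) x * dd v (dd v (dd (b i) (dd (b j) u))) x) := by
  have hL := J.of_smooth (lap_smooth S.smooth) x v
  have hL2 := hL.mul hL
  have hF := J.sum univ fun i (_ : i ∈ univ) => J.sum univ fun j (_ : j ∈ univ) =>
    (J.of_smooth (dd_smooth (v := b i) (dd_smooth (v := b j) S.smooth)) x v).mul
    (J.of_smooth (dd_smooth (v := b i) (dd_smooth (v := b j) S.smooth)) x v)
  have hG := hL2.add (hF.smul (-1))
  have hev : (fun t : ℝ => lap u (x + t • v) * lap u (x + t • v) + -1 * ∑ i, ∑ j,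
      dd (b i) (dd (b j) u) (x + t • v) * dd (b i) (dd (b j) u) (x + t • v))
      =ᶠ[nhds 0] fun _ => 2 * c := by
    have hcont : ContinuousAt (fun t : ℝ => x + t • v) 0 := by fun_prop
    have : ∀ᶠ t in nhds (0:ℝ), x + t • v ∈ Metric.ball (0 : EuclideanSpace ℝ (Fin n)) R :=
      hcont.eventually_mem (Metric.isOpen_ball.mem_nhds (by simpa using hx))
    filter_upwards [this] with t ht
    have h := S.eq _ ht
    rw [frob_eq S.smooth _ b] at h
    simp only [← pow_two]
    linarith
  have hu := (hG.congr_fun hev).unique (J.const (2 * c))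
  obtain ⟨h1, h2⟩ := hu
  constructor
  · have e : ∑ i, ∑ j, (dd v (dd (b i) (dd (b j) u)) x * dd (b i) (dd (b j) u) x
      + dd (b i) (dd (b j) u) x * dd v (dd (b i) (dd (b j) u)) x) =
      2 * ∑ i, ∑ j, dd (b i) (dd (b j) u) x * dd v (dd (b i) (dd (b j) u)) x := by
      simp only [mul_sum]
      exact sum_congr rfl fun i _ => sum_congr rfl fun j _ => by ring
    rw [e] at h1; linarith
  · have e : ∑ i, ∑ j, (dd v (dd v (dd (b i) (dd (b j) u))) x * dd (b i) (dd (b j) u) x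
      + 2 * dd v (dd (b i) (dd (b j) u)) x * dd v (dd (b i) (dd (b j) u)) x
      + dd (b i) (dd (b j) u) x * dd v (dd v (dd (b i) (dd (b j) u))) x) =
      2 * ∑ i, ∑ j, ((dd v (dd (b i) (dd (b j) u)) x) ^ 2
        + dd (b i) (dd (b j) u) x * dd v (dd v (dd (b i) (dd (b j) u))) x) := by
      simp only [mul_sum]
      exact sum_congr rfl fun i _ => sum_congr rfl fun j _ => by ring
    rw [e] at h2; linarith

lemma dd_lap (hu : ContDiff ℝ ∞ u) (b : OrthonormalBasis (Fin n) ℝ (EuclideanSpace ℝ (Fin n)))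
    (v : EuclideanSpace ℝ (Fin n)) :
    (∀ x, dd v (lap u) x = ∑ i, dd (b i) (dd (b i) (dd v u)) x) ∧
    (∀ x, dd v (dd v (lap u)) x = ∑ i, dd (b i) (dd (b i) (dd v (dd v u))) x) := by
  have e : lap u = fun x => ∑ i, dd (b i) (dd (b i) u) x := funext fun x => lap_eq hu x b
  have c3 : ∀ w, dd v (dd w (dd w u)) = dd w (dd w (dd v u)) := fun w => by
    rw [dd_comm (dd_smooth hu), dd_comm hu]
  have c4 : ∀ w, dd v (dd v (dd w (dd w u))) = dd w (dd w (dd v (dd v u))) := fun w => by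
    rw [c3, dd_comm (dd_smooth (dd_smooth hu)), dd_comm (dd_smooth hu) (v := v)]
  constructor
  · intro x
    have h1 := J.of_smooth (lap_smooth hu) x v
    have h2 := J.sum univ fun i (_ : i ∈ univ) =>
      J.of_smooth (dd_smooth (v := b i) (dd_smooth (v := b i) hu)) x v
    rw [e] at h1
    rw [e, (h1.unique h2).1]
    exact sum_congr rfl fun i _ => by rw [c3]
  · intro x
    have h1 := J.of_smooth (lap_smooth hu) x v
    have h2 := J.sum univ fun i (_ : i ∈ univ) =>
      J.of_smooth (dd_smooth (v := b i) (dd_smooth (v := b i) hu)) x v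
    rw [e] at h1
    rw [e, (h1.unique h2).2]
    exact sum_congr rfl fun i _ => by rw [c4]

lemma exists_frame (hn : n = 3 ∨ n = 4) {c R M : ℝ} (hc : 0 < c) (S : Sol c R M u)
    {x : EuclideanSpace ℝ (Fin n)}
    (hx : x ∈ Metric.ball (0 : EuclideanSpace ℝ (Fin n)) R) :
    ∃ b lam, Frame c u x b lam := by
  obtain ⟨b, lam, hd⟩ := exists_eigen S.smooth x
  have hu := S.smooth
  have hsum : ∑ i, lam i = lap u x := by
    rw [lap_eq hu x b]; exact sum_congr rfl fun i _ => by rw [hd]; simp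
  have hsq : lap u x ^ 2 - ∑ i, lam i ^ 2 = 2 * c := by
    have := S.eq x hx
    rw [frob_eq hu x b] at this
    rw [← this]; congr 1
    refine sum_congr rfl fun i _ => ?_
    rw [sum_eq_single i]
    · rw [hd]; simp
    · intro j _ hj; rw [hd]; simp [Ne.symm hj]
    · simp
  have hdiag : ∀ G : Fin n → Fin n → ℝ, ∑ i, ∑ j, dd (b i) (dd (b j) u) x * G i j
      = ∑ i, lam i * G i i := by
    intro G
    refine sum_congr rfl fun i _ => ?_
    rw [sum_eq_single i]
    · rw [hd]; simp
    · intro j _ hj; rw [hd]; simp [Ne.symm hj]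
    · simp
  have third : ∀ k, ∑ i, (lap u x - lam i) * dd (b i) (dd (b i) (dd (b k) u)) x = 0 := by
    intro k
    have h1 := (eq_jets S hx b (b k)).1
    rw [hdiag (fun i j => dd (b k) (dd (b i) (dd (b j) u)) x), (dd_lap hu b (b k)).1] at h1
    simp only [sub_mul, sum_sub_distrib, ← mul_sum]
    rw [h1, sub_eq_zero]
    refine sum_congr rfl fun i _ => ?_
    rw [dd_comm (dd_smooth hu), dd_comm hu (v := b k)]
  set T : Fin n → Fin n → Fin n → ℝ := fun i j k => dd (b i) (dd (b j) (dd (b k) u)) x with hT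
  have hX : ∑ i, (lap u x - lam i) * dd (b i) (dd (b i) (lap u)) x =
      ∑ i, ∑ j, ∑ k, T i j k ^ 2 - ∑ k, (dd (b k) (lap u) x) ^ 2 := by
    have h2 : ∀ k, (dd (b k) (lap u) x) ^ 2 + lap u x * dd (b k) (dd (b k) (lap u)) x =
        ∑ i, ∑ j, T k i j ^ 2 + ∑ i, lam i * dd (b k) (dd (b k) (dd (b i) (dd (b i) u))) x := by
      intro k
      rw [(eq_jets S hx b (b k)).2]
      simp only [sum_add_distrib]
      rw [hdiag (fun i j => dd (b k) (dd (b k) (dd (b i) (dd (b j) u))) x)]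
    have h3 := sum_congr rfl fun k (_ : k ∈ univ) => h2 k
    simp only [sum_add_distrib] at h3
    rw [sum_comm (f := fun k i => lam i * dd (b k) (dd (b k) (dd (b i) (dd (b i) u))) x)] at h3
    have h4 : ∑ i, ∑ k, lam i * dd (b k) (dd (b k) (dd (b i) (dd (b i) u))) x
        = ∑ i, lam i * dd (b i) (dd (b i) (lap u)) x := by
      refine sum_congr rfl fun i _ => ?_
      rw [(dd_lap hu b (b i)).2, mul_sum]
    rw [h4] at h3
    simp only [sub_mul, sum_sub_distrib]
    linarith
  have hJ := jac hn (S.pos x hx) hc hsum hsq T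
    (fun i j k => by simp only [hT]; rw [dd_comm (dd_smooth hu)])
    (fun i j k => by simp only [hT]; rw [dd_comm hu (v := b j)])
    third (fun k => dd (b k) (lap u) x) (fun k => (dd_lap hu b (b k)).1 x) _ hX
  exact ⟨b, lam, hd, S.pos x hx, hsum, hsq, third, hJ.1, hJ.2⟩

end frame
end SY
namespace SY
open scoped ContDiff
open Finset

section frameFacts
variable {n : ℕ} {u : EuclideanSpace ℝ (Fin n) → ℝ}

/-- squared gradient -/
noncomputable def gsq (u : EuclideanSpace ℝ (Fin n) → ℝ) (x : EuclideanSpace ℝ (Fin n)) : ℝ :=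
  ‖fderiv ℝ u x‖ ^ 2

lemma clm_norm_sq (l : EuclideanSpace ℝ (Fin n) →L[ℝ] ℝ)
    (b : OrthonormalBasis (Fin n) ℝ (EuclideanSpace ℝ (Fin n))) :
    ‖l‖ ^ 2 = ∑ i, (l (b i)) ^ 2 := by
  set y := (InnerProductSpace.toDual ℝ (EuclideanSpace ℝ (Fin n))).symm l with hy
  have h1 : ‖l‖ = ‖y‖ := by rw [hy, LinearIsometryEquiv.norm_map]
  rw [h1, ← b.sum_sq_norm_inner_right]
  refine sum_congr rfl fun i _ => ?_
  rw [real_inner_comm, hy, InnerProductSpace.toDual_symm_apply]; simp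

lemma gsq_eq (x : EuclideanSpace ℝ (Fin n))
    (b : OrthonormalBasis (Fin n) ℝ (EuclideanSpace ℝ (Fin n))) :
    gsq u x = ∑ i, (dd (b i) u x) ^ 2 := clm_norm_sq _ b

lemma basis_expand (b : OrthonormalBasis (Fin n) ℝ (EuclideanSpace ℝ (Fin n)))
    (l : EuclideanSpace ℝ (Fin n) →L[ℝ] ℝ) (y : EuclideanSpace ℝ (Fin n)) :
    l y = ∑ k, inner ℝ y (b k) * l (b k) := by
  conv_lhs => rw [← b.sum_repr' y]
  rw [map_sum]
  refine sum_congr rfl fun i _ => ?_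
  rw [map_smul, real_inner_comm]; rfl

lemma norm_sq_expand (b : OrthonormalBasis (Fin n) ℝ (EuclideanSpace ℝ (Fin n)))
    (y : EuclideanSpace ℝ (Fin n)) : ‖y‖ ^ 2 = ∑ k, (inner ℝ y (b k)) ^ 2 := by
  rw [← b.sum_sq_norm_inner_left]; simp

variable {c : ℝ} {x : EuclideanSpace ℝ (Fin n)}
  {b : OrthonormalBasis (Fin n) ℝ (EuclideanSpace ℝ (Fin n))} {lam : Fin n → ℝ}

lemma J_gsq {f mu : Fin n → ℝ} {p : EuclideanSpace ℝ (Fin n) → ℝ} (hp : ContDiff ℝ ∞ p)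
    (hd : ∀ i j, dd (b i) (dd (b j) p) x = if i = j then mu i else 0)
    (h3 : ∀ k, ∑ i, f i * dd (b i) (dd (b i) (dd (b k) p)) x = 0) :
    ∃ C : Fin n → ℝ, (∀ i, J (fun t => gsq p (x + t • b i)) (gsq p x)
      (2 * dd (b i) p x * mu i) (C i)) ∧ ∑ i, f i * C i = 2 * ∑ i, f i * mu i ^ 2 := by
  refine ⟨fun i => 2 * mu i ^ 2 + 2 * ∑ k, dd (b k) p x * dd (b i) (dd (b i) (dd (b k) p)) x,
    fun i => ?_, ?_⟩
  · have h := J.sum univ fun k (_ : k ∈ univ) =>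
      (J.of_smooth (dd_smooth (v := b k) hp) x (b i)).mul
      (J.of_smooth (dd_smooth (v := b k) hp) x (b i))
    have e : (fun t : ℝ => gsq p (x + t • b i)) = fun t : ℝ => ∑ k,
        dd (b k) p (x + t • b i) * dd (b k) p (x + t • b i) := by
      funext t; rw [gsq_eq _ b]; simp only [pow_two]
    rw [e]
    refine h.congr ?_ ?_ ?_
    · rw [gsq_eq _ b]; simp only [pow_two]
    · rw [sum_eq_single i]
      · rw [hd]; simp; ring
      · intro k _ hk; rw [hd]; simp [Ne.symm hk]
      · simp
    · simp only [sum_add_distrib]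
      have e1 : ∑ k, 2 * dd (b i) (dd (b k) p) x * dd (b i) (dd (b k) p) x = 2 * mu i ^ 2 := by
        rw [sum_eq_single i]
        · rw [hd]; simp; ring
        · intro k _ hk; rw [hd]; simp [Ne.symm hk]
        · simp
      rw [e1, mul_sum]
      have e2 : ∀ k, 2 * (dd (b k) p x * dd (b i) (dd (b i) (dd (b k) p)) x) =
        dd (b i) (dd (b i) (dd (b k) p)) x * dd (b k) p x
          + dd (b k) p x * dd (b i) (dd (b i) (dd (b k) p)) x := fun k => by ring
      simp only [e2, sum_add_distrib]; ring
  · have : ∀ i, f i * (2 * mu i ^ 2 + 2 * ∑ k, dd (b k) p x * dd (b i) (dd (b i) (dd (b k) p)) x)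
      = 2 * (f i * mu i ^ 2) + ∑ k, 2 * dd (b k) p x *
        (f i * dd (b i) (dd (b i) (dd (b k) p)) x) := by
      intro i; rw [mul_add, mul_sum, mul_sum]; congr 1
      · ring
      · exact sum_congr rfl fun k _ => by ring
    simp only [this, sum_add_distrib]
    rw [sum_comm]
    simp only [← mul_sum, h3]; simp

lemma J_eul {f : Fin n → ℝ} (hu : ContDiff ℝ ∞ u) (x0 : EuclideanSpace ℝ (Fin n))
    (hd : ∀ i j, dd (b i) (dd (b j) u) x = if i = j then lam i else 0)
    (h3 : ∀ k, ∑ i, f i * dd (b i) (dd (b i) (dd (b k) u)) x = 0) :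
    ∃ C : Fin n → ℝ, (∀ i, J (fun t => fderiv ℝ u (x + t • b i) (x + t • b i - x0) - u (x + t • b i))
      (fderiv ℝ u x (x - x0) - u x) (inner ℝ (x - x0) (b i) * lam i) (C i)) ∧
      ∑ i, f i * C i = ∑ i, f i * lam i := by
  refine ⟨fun i => lam i + ∑ k, inner ℝ (x - x0) (b k) * dd (b i) (dd (b i) (dd (b k) u)) x,
    fun i => ?_, ?_⟩
  · have hin : ∀ k, J (fun t => inner ℝ (x + t • b i - x0) (b k)) (inner ℝ (x - x0) (b k))
        (if i = k then 1 else 0) 0 := fun k => by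
      have := J_inner (b k) (x - x0) (b i)
      rw [OrthonormalBasis.inner_eq_ite] at this
      have e : ∀ t : ℝ, x - x0 + t • b i = x + t • b i - x0 := fun t => by abel
      simpa only [e] using this
    have h := (J.sum univ fun k (_ : k ∈ univ) =>
      (hin k).mul (J.of_smooth (dd_smooth (v := b k) hu) x (b i))).add
      ((J.of_smooth hu x (b i)).smul (-1))
    have e : (fun t : ℝ => fderiv ℝ u (x + t • b i) (x + t • b i - x0) - u (x + t • b i)) =
        fun t : ℝ => (∑ k, inner ℝ (x + t • b i - x0) (b k) * dd (b k) u (x + t • b i))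
          + -1 * u (x + t • b i) := by
      funext t; rw [basis_expand b]; unfold dd; ring
    rw [e]
    refine h.congr ?_ ?_ ?_
    · rw [basis_expand b (fderiv ℝ u x)]; unfold dd; ring
    · simp only [sum_add_distrib, ite_mul, one_mul, zero_mul]
      simp [hd]
    · simp only [sum_add_distrib]
      have e1 : ∑ k, 2 * (if i = k then (1:ℝ) else 0) * dd (b i) (dd (b k) u) x = 2 * lam i := by
        rw [sum_eq_single i]
        · rw [hd]; simp
        · intro k _ hk; simp [Ne.symm hk]
        · simp
      rw [e1, hd]; simp; ring
  · have : ∀ i, f i * (lam i + ∑ k, inner ℝ (x - x0) (b k) * dd (b i) (dd (b i) (dd (b k) u)) x)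
      = f i * lam i + ∑ k, inner ℝ (x - x0) (b k) *
        (f i * dd (b i) (dd (b i) (dd (b k) u)) x) := by
      intro i; rw [mul_add, mul_sum]; congr 1
      exact sum_congr rfl fun k _ => by ring
    simp only [this, sum_add_distrib]
    rw [sum_comm]
    simp only [← mul_sum, h3]; simp

namespace Frame
variable (F : Frame c u x b lam) 
include F

lemma f_pos (hc : 0 < c) (i : Fin n) : 0 < lap u x - lam i :=
  sub_pos.2 (lam_lt F.pos hc F.sq i)

lemma f_le (hc : 0 < c) (i : Fin n) : lap u x - lam i ≤ 2 * lap u x := by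
  linarith [lam_gt F.pos hc F.sq i]

lemma lam_abs (hc : 0 < c) (i : Fin n) : |lam i| ≤ lap u x :=
  abs_le.2 ⟨(lam_gt F.pos hc F.sq i).le, (lam_lt F.pos hc F.sq i).le⟩

lemma f_ge (hc : 0 < c) (i : Fin n) : c / lap u x ≤ lap u x - lam i := by
  have h1 := lam_sq_le F.sq i
  have h2 := F.f_pos hc i
  have h3 := F.f_le hc i
  have h4 := lam_lt F.pos hc F.sq i
  rw [div_le_iff₀ F.pos]
  nlinarith [F.pos]

lemma sum_f : ∑ i, (lap u x - lam i) = (n - 1) * lap u x := by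
  rw [sum_sub_distrib, F.sum]; simp; ring

lemma sum_f_lam : ∑ i, (lap u x - lam i) * lam i = 2 * c := by
  simp only [sub_mul, sum_sub_distrib, ← mul_sum, F.sum, ← F.sq]
  simp only [pow_two]

lemma exists_top (hn : n ≤ 4) (hn0 : 0 < n) (hc : 0 < c) : ∃ i1, lap u x / 4 ≤ lam i1 ∧
    ∀ i, i ≠ i1 → lap u x / 4 ≤ lap u x - lam i := by
  haveI : Nonempty (Fin n) := ⟨⟨0, hn0⟩⟩
  obtain ⟨i1, -, h⟩ := exists_max_image (univ : Finset (Fin n)) lam univ_nonempty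
  refine ⟨i1, ?_, ?_⟩
  · have h1 : lap u x ≤ n * lam i1 := by
      rw [← F.sum]
      calc _ ≤ ∑ _i : Fin n, lam i1 := sum_le_sum fun i hi => h i hi
        _ = _ := by simp
    have h0 : 0 < lam i1 := by
      by_contra h'
      push Not at h'
      have : (n:ℝ) * lam i1 ≤ 0 := mul_nonpos_of_nonneg_of_nonpos (by positivity) h'
      linarith [F.pos]
    have : (n:ℝ) * lam i1 ≤ 4 * lam i1 :=
      mul_le_mul_of_nonneg_right (by exact_mod_cast hn) h0.le
    linarith
  · intro i hi
    have h2 : lam i ^ 2 + lam i1 ^ 2 ≤ ∑ j, lam j ^ 2 := by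
      rw [← sum_pair (f := fun j => lam j ^ 2) hi]
      exact sum_le_sum_of_subset_of_nonneg (subset_univ _) fun j _ _ => sq_nonneg _
    have h3 := F.sq
    have h4 := h i (mem_univ i)
    have hp := F.pos
    by_contra h'
    push Not at h'
    nlinarith

lemma N_ge (hn : n ≤ 4) (hn0 : 0 < n) (hc : 0 < c) :
    c * lap u x / 16 ≤ ∑ i, (lap u x - lam i) * lam i ^ 2 := by
  obtain ⟨i1, h1, -⟩ := F.exists_top hn hn0 hc
  have h2 := F.f_ge hc i1
  have hp := F.pos
  have h3 : (lap u x - lam i1) * lam i1 ^ 2 ≤ ∑ i, (lap u x - lam i) * lam i ^ 2 :=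
    single_le_sum (f := fun i => (lap u x - lam i) * lam i ^ 2)
      (fun j _ => mul_nonneg (F.f_pos hc j).le (sq_nonneg _)) (mem_univ i1)
  refine le_trans ?_ h3
  have h4 : (lap u x / 4) ^ 2 ≤ lam i1 ^ 2 := pow_le_pow_left₀ (by positivity) h1 2
  calc c * lap u x / 16 = (c / lap u x) * (lap u x / 4) ^ 2 := by field_simp; norm_num
    _ ≤ _ := mul_le_mul h2 h4 (by positivity) (F.f_pos hc i1).le

lemma N_ge_single (hc : 0 < c) (j : Fin n) :
    (lap u x - lam j) * lam j ^ 2 ≤ ∑ i, (lap u x - lam i) * lam i ^ 2 :=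
  single_le_sum (f := fun i => (lap u x - lam i) * lam i ^ 2)
      (fun j _ => mul_nonneg (F.f_pos hc j).le (sq_nonneg _)) (mem_univ j)

lemma N_ge' (hc : 0 < c) {j : Fin n} (hj : lam j < - lap u x / 4) :
    lap u x ^ 3 / 16 ≤ ∑ i, (lap u x - lam i) * lam i ^ 2 := by
  refine le_trans ?_ (F.N_ge_single hc j)
  have hp := F.pos
  have h4 : (lap u x / 4) ^ 2 ≤ lam j ^ 2 := by
    rw [← neg_sq (lam j)]; exact pow_le_pow_left₀ (by positivity) (by linarith) 2
  calc lap u x ^ 3 / 16 = lap u x * (lap u x / 4) ^ 2 := by ring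
    _ ≤ _ := mul_le_mul (by linarith) h4 (by positivity) (F.f_pos hc j).le

/-- Jacobi inequality in log form -/
lemma jlog (hu : ContDiff ℝ ∞ u) (hc : 0 < c) : ∃ B C : Fin n → ℝ,
    (∀ i, J (fun t => Real.log (lap u (x + t • b i))) (Real.log (lap u x)) (B i) (C i)) ∧
    0 ≤ ∑ i, (lap u x - lam i) * C i ∧
    ((∀ i, - lap u x / 4 ≤ lam i) →
      1 / 18 * ∑ i, (lap u x - lam i) * B i ^ 2 ≤ ∑ i, (lap u x - lam i) * C i) := by
  have hp := F.pos
  refine ⟨fun i => dd (b i) (lap u) x / lap u x, fun i => dd (b i) (dd (b i) (lap u)) x / lap u x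
    - (dd (b i) (lap u) x / lap u x) ^ 2, fun i => ?_, ?_, ?_⟩
  · exact (J.of_smooth (lap_smooth hu) x (b i)).log hp
  all_goals
    have e1 : ∑ i, (lap u x - lam i) * (dd (b i) (dd (b i) (lap u)) x / lap u x
      - (dd (b i) (lap u) x / lap u x) ^ 2) =
      (lap u x * ∑ i, (lap u x - lam i) * dd (b i) (dd (b i) (lap u)) x -
        ∑ i, (lap u x - lam i) * (dd (b i) (lap u) x) ^ 2) / lap u x ^ 2 := by
      rw [mul_sum, ← sum_sub_distrib, sum_div]
      refine sum_congr rfl fun i _ => ?_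
      field_simp
    rw [e1]
  · exact div_nonneg (sub_nonneg.2 F.jac0) (sq_nonneg _)
  · intro h
    have e2 : ∑ i, (lap u x - lam i) * (dd (b i) (lap u) x / lap u x) ^ 2 =
      (∑ i, (lap u x - lam i) * (dd (b i) (lap u) x) ^ 2) / lap u x ^ 2 := by
      rw [sum_div]; exact sum_congr rfl fun i _ => by ring
    rw [e2, ← mul_div_assoc]
    apply div_le_div_of_nonneg_right _ (by positivity)
    linarith [F.jac1 h]

end Frame

/-- sum with positive weights of second derivatives at an interior maximum -/
lemma max_jets {P : EuclideanSpace ℝ (Fin n) → ℝ} (hP : IsLocalMax P x) (v : EuclideanSpace ℝ (Fin n))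
    {a b' c' : ℝ} (hJ : J (fun t => P (x + t • v)) a b' c') : b' = 0 ∧ c' ≤ 0 := by
  apply hJ.max
  have hcont : ContinuousAt (fun t : ℝ => x + t • v) 0 := by fun_prop
  have h0 : Filter.Tendsto (fun t : ℝ => x + t • v) (nhds 0) (nhds x) := by
    have := hcont.tendsto; simpa using this
  have := h0.eventually hP
  filter_upwards [this] with t ht
  simpa using ht

lemma exists_loc_max {P : EuclideanSpace ℝ (Fin n) → ℝ} {x0 y : EuclideanSpace ℝ (Fin n)} {r : ℝ}
    (hP : ContinuousOn P (Metric.closedBall x0 r)) (hy : y ∈ Metric.ball x0 r)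
    (hb : ∀ z ∈ Metric.sphere x0 r, P z < P y) :
    ∃ z ∈ Metric.ball x0 r, (∀ w ∈ Metric.closedBall x0 r, P w ≤ P z) ∧ IsLocalMax P z := by
  obtain ⟨z, hz, hmax⟩ := (isCompact_closedBall x0 r).exists_isMaxOn
    ⟨y, Metric.ball_subset_closedBall hy⟩ hP
  have hyz : P y ≤ P z := hmax (Metric.ball_subset_closedBall hy)
  have hzb : z ∈ Metric.ball x0 r := by
    rcases (Metric.mem_closedBall.1 hz).lt_or_eq with h | h
    · exact h
    · exact absurd (hb z h) (not_lt.2 hyz)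
  refine ⟨z, hzb, fun w hw => hmax hw, ?_⟩
  filter_upwards [Metric.isOpen_ball.mem_nhds hzb] with w hw
  exact hmax (Metric.ball_subset_closedBall hw)

end frameFacts
end SY
namespace SY
open scoped ContDiff
open Finset

section pog
variable {n : ℕ} {u : EuclideanSpace ℝ (Fin n) → ℝ}
variable {c : ℝ} {x : EuclideanSpace ℝ (Fin n)}
  {b : OrthonormalBasis (Fin n) ℝ (EuclideanSpace ℝ (Fin n))} {lam : Fin n → ℝ}

lemma Frame.ellip (F : Frame c u x b lam) (hc : 0 < c) {q : EuclideanSpace ℝ (Fin n) → ℝ}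
    (hq : ContDiff ℝ ∞ q) (h1 : 0 ≤ lap q x) (h2 : frob q x ≤ lap q x ^ 2) :
    0 ≤ ∑ i, (lap u x - lam i) * dd (b i) (dd (b i) q) x := by
  rw [lap_eq hq x b] at h1 h2
  rw [frob_eq hq x b] at h2
  set a : Fin n → ℝ := fun i => dd (b i) (dd (b i) q) x with ha
  have h3 : ∑ i, a i ^ 2 ≤ (∑ i, a i) ^ 2 := by
    refine le_trans (sum_le_sum fun i _ => ?_) h2
    exact single_le_sum (f := fun j => (dd (b i) (dd (b j) q) x) ^ 2)
      (fun j _ => sq_nonneg _) (mem_univ i)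
  have h4 : (∑ i, lam i * a i) ^ 2 ≤ (∑ i, lam i ^ 2) * ∑ i, a i ^ 2 :=
    sum_mul_sq_le_sq_mul_sq _ _ _
  have h5 : ∑ i, lam i ^ 2 ≤ lap u x ^ 2 := by linarith [F.sq]
  have h6 : (∑ i, lam i * a i) ^ 2 ≤ (lap u x * ∑ i, a i) ^ 2 := by
    rw [mul_pow]
    exact h4.trans (mul_le_mul h5 h3 (sum_nonneg fun i _ => sq_nonneg _) (sq_nonneg _))
  have h7 := abs_le_of_sq_le_sq h6 (mul_nonneg F.pos.le h1)
  simp only [sub_mul, sum_sub_distrib, ← mul_sum]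
  linarith [(abs_le.1 h7).2]

set_option maxHeartbeats 1000000 in
lemma pog_pt (hn : n = 3 ∨ n = 4) (F : Frame c u x b lam) (hc : 0 < c)
    (hu : ContDiff ℝ ∞ u) {q : EuclideanSpace ℝ (Fin n) → ℝ} (hq : ContDiff ℝ ∞ q)
    (h1 : 0 ≤ lap q x) (h2 : frob q x ≤ lap q x ^ 2) {M G H be : ℝ}
    (hM : ‖fderiv ℝ u x‖ ≤ M) (hG : ‖fderiv ℝ q x‖ ≤ G) (hH : q x - u x ≤ H)
    (h0 : 0 < q x - u x) (hbe : be = 1 / (1 + M ^ 2))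
    (hmax : IsLocalMax (fun w => Real.log (lap u w) + 36 * Real.log (q w - u w)
      + be / 2 * gsq u w) x) :
    lap u x * (q x - u x) ≤ 1 + 2304 * (1 + c * H ^ 2 + (G + M) ^ 2) / be := by
  have hbe0 : 0 < be := by rw [hbe]; positivity
  have hbM : be * M ^ 2 ≤ 1 := by
    rw [hbe, one_div, inv_mul_le_iff₀ (by positivity)]; linarith
  have hs := F.pos
  have hf := F.f_pos hc
  obtain ⟨B, C, hJ, hC0, hC1⟩ := F.jlog hu hc
  obtain ⟨Cg, hJg, hCg⟩ := J_gsq hu F.diag F.third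
  set s := lap u x with hsd
  set eta := q x - u x with heta
  set e1 : Fin n → ℝ := fun i => dd (b i) q x - dd (b i) u x with he1
  have hJe : ∀ i, J (fun t => q (x + t • b i) - u (x + t • b i)) eta (e1 i)
      (dd (b i) (dd (b i) q) x - lam i) := fun i => by
    have h := (J.of_smooth hq x (b i)).add ((J.of_smooth hu x (b i)).smul (-1))
    have hd := F.diag i i
    simp only [if_true] at hd
    rw [hd] at h
    have e : (fun t : ℝ => q (x + t • b i) - u (x + t • b i)) =
      fun t : ℝ => q (x + t • b i) + -1 * u (x + t • b i) := by funext t; ring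
    rw [e]
    exact h.congr (by rw [heta]; ring) (by rw [he1]; ring) (by ring)
  have hm : ∀ i, B i + 36 * (e1 i / eta) + be / 2 * (2 * dd (b i) u x * lam i) = 0 ∧
      C i + 36 * ((dd (b i) (dd (b i) q) x - lam i) / eta - (e1 i / eta) ^ 2)
        + be / 2 * Cg i ≤ 0 := fun i =>
    max_jets hmax (b i) (((hJ i).add (((hJe i).log h0).smul 36)).add ((hJg i).smul (be / 2)))
  have hsum : ∑ i, (s - lam i) * (C i + 36 * ((dd (b i) (dd (b i) q) x - lam i) / eta
      - (e1 i / eta) ^ 2) + be / 2 * Cg i) ≤ 0 :=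
    sum_nonpos fun i _ => mul_nonpos_of_nonneg_of_nonpos (hf i).le (hm i).2
  set N := ∑ i, (s - lam i) * lam i ^ 2 with hN
  set D := ∑ i, (s - lam i) * (e1 i / eta) ^ 2 with hD
  have hq0 := F.ellip hc hq h1 h2
  have hexp : ∑ i, (s - lam i) * (C i + 36 * ((dd (b i) (dd (b i) q) x - lam i) / eta
      - (e1 i / eta) ^ 2) + be / 2 * Cg i) = ∑ i, (s - lam i) * C i
      + 36 / eta * (∑ i, (s - lam i) * dd (b i) (dd (b i) q) x) - 36 / eta * (2 * c)
      - 36 * D + be * N := by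
    have e : be * N = be / 2 * ∑ i, (s - lam i) * Cg i := by rw [hCg]; ring
    rw [e, ← F.sum_f_lam, hD]
    simp only [mul_sum, ← sum_add_distrib, ← sum_sub_distrib]
    exact sum_congr rfl fun i _ => by ring
  rw [hexp] at hsum
  have hq1 : 0 ≤ 36 / eta * (∑ i, (s - lam i) * dd (b i) (dd (b i) q) x) := by positivity
  have hmain : ∑ i, (s - lam i) * C i + be * N ≤ 72 * c / eta + 36 * D := by
    have : 36 / eta * (2 * c) = 72 * c / eta := by ring
    linarith
  have hcs := F.N_ge (by omega) (by omega) hc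
  have hrest : 0 ≤ 2304 * (c * H ^ 2 + (G + M) ^ 2) / be := by positivity
  have hsplit : 2304 * (1 + c * H ^ 2 + (G + M) ^ 2) / be =
    2304 / be + 2304 * (c * H ^ 2 + (G + M) ^ 2) / be := by ring
  by_cases hdeg : ∀ i, - s / 4 ≤ lam i
  · have h18 := hC1 hdeg
    have hDb : 36 * D ≤ 1 / 18 * ∑ i, (s - lam i) * B i ^ 2 + be / 18 * N := by
      rw [hD, hN, mul_sum, mul_sum, mul_sum, ← sum_add_distrib]
      refine sum_le_sum fun i _ => ?_
      have hp : (dd (b i) u x) ^ 2 ≤ M ^ 2 := by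
        have : (dd (b i) u x) ^ 2 ≤ gsq u x := by
          rw [gsq_eq x b]
          exact single_le_sum (f := fun j => (dd (b j) u x) ^ 2)
            (fun j _ => sq_nonneg _) (mem_univ i)
        exact this.trans (pow_le_pow_left₀ (norm_nonneg _) hM 2)
      have hB : 36 * (e1 i / eta) = - B i - be * dd (b i) u x * lam i := by
        linarith [(hm i).1]
      have h6 : 1296 * (e1 i / eta) ^ 2 ≤ 2 * B i ^ 2 + 2 * be * lam i ^ 2 := by
        have : 1296 * (e1 i / eta) ^ 2 = (36 * (e1 i / eta)) ^ 2 := by ring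
        rw [this, hB]
        have h7 : be ^ 2 * (dd (b i) u x) ^ 2 * lam i ^ 2 ≤ be * lam i ^ 2 := by
          have : be ^ 2 * (dd (b i) u x) ^ 2 ≤ be := by
            calc be ^ 2 * (dd (b i) u x) ^ 2 ≤ be ^ 2 * M ^ 2 := by gcongr
              _ = be * (be * M ^ 2) := by ring
              _ ≤ be * 1 := by gcongr
              _ = be := mul_one _
          exact mul_le_mul_of_nonneg_right this (sq_nonneg _)
        nlinarith [sq_nonneg (B i - be * dd (b i) u x * lam i)]
      have := mul_le_mul_of_nonneg_left h6 (hf i).le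
      linarith
    have hN2 : be * N * (17 / 18) ≤ 72 * c / eta := by linarith
    have h9 : be * (c * s / 16) * (17 / 18) ≤ 72 * c / eta :=
      le_trans (by gcongr) hN2
    rw [le_div_iff₀ h0] at h9
    have h10 : s * eta ≤ 2304 / be := by
      rw [le_div_iff₀ hbe0]
      by_contra hcon
      push Not at hcon
      have := mul_lt_mul_of_pos_left hcon hc
      nlinarith
    linarith
  · push Not at hdeg
    obtain ⟨j, hj⟩ := hdeg
    have hN3 := F.N_ge' hc hj
    have hDb : D * eta ^ 2 ≤ 2 * s * (G + M) ^ 2 := by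
      have e2 : D * eta ^ 2 = ∑ i, (s - lam i) * e1 i ^ 2 := by
        rw [hD, sum_mul]; refine sum_congr rfl fun i _ => ?_
        field_simp
      rw [e2]
      calc _ ≤ ∑ i, 2 * s * e1 i ^ 2 := sum_le_sum fun i _ =>
            mul_le_mul_of_nonneg_right (F.f_le hc i) (sq_nonneg _)
        _ = 2 * s * ‖fderiv ℝ q x - fderiv ℝ u x‖ ^ 2 := by
            rw [clm_norm_sq _ b, mul_sum]; rfl
        _ ≤ _ := by
            have := norm_sub_le (fderiv ℝ q x) (fderiv ℝ u x)
            have h3 : ‖fderiv ℝ q x - fderiv ℝ u x‖ ≤ G + M := by linarith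
            gcongr
    have hst : be * (s * eta) ^ 3 / 16 ≤ 72 * c * H ^ 2 + 72 * (s * eta) * (G + M) ^ 2 := by
      have h3 : be * (s ^ 3 / 16) ≤ 72 * c / eta + 36 * D :=
        le_trans (mul_le_mul_of_nonneg_left hN3 hbe0.le) (by linarith)
      have h4 := mul_le_mul_of_nonneg_right h3 (by positivity : 0 ≤ eta ^ 3)
      have e : (72 * c / eta + 36 * D) * eta ^ 3 = 72 * c * eta ^ 2 + 36 * (D * eta ^ 2) * eta := by
        field_simp
      rw [e] at h4
      have h5 : eta ^ 2 ≤ H ^ 2 := pow_le_pow_left₀ h0.le hH 2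
      have h6 := mul_le_mul_of_nonneg_right hDb h0.le
      have h7 := mul_le_mul_of_nonneg_left h5 hc.le
      have e3 : be * (s * eta) ^ 3 / 16 = be * (s ^ 3 / 16) * eta ^ 3 := by ring
      rw [e3]; linarith
    set t := s * eta with ht
    by_contra hcon
    push Not at hcon
    set Z := c * H ^ 2 + (G + M) ^ 2 with hZ
    have hZ0 : 0 ≤ Z := by positivity
    have hb2 : 0 < 2304 / be := by positivity
    have ht1 : 1 < t := by linarith
    have ht2 : 2304 * (1 + Z) < t * be := by
      rw [← div_lt_iff₀ hbe0]
      have : 2304 * (1 + Z) / be = 2304 / be + 2304 * Z / be := by ring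
      linarith
    have h8 : 72 * c * H ^ 2 + 72 * t * (G + M) ^ 2 ≤ 72 * t * Z := by
      have : c * H ^ 2 ≤ t * (c * H ^ 2) := le_mul_of_one_le_left (by positivity) ht1.le
      rw [hZ]; linarith
    have h9 : 2304 * (1 + Z) * t ^ 2 ≤ be * t ^ 3 := by nlinarith [sq_nonneg t]
    have h10 : t ≤ t ^ 2 := by nlinarith
    nlinarith [mul_le_mul_of_nonneg_left h10 (by linarith : 0 ≤ 1 + Z)]

lemma gsq_cont (hu : ContDiff ℝ ∞ u) : Continuous (gsq u) :=
  ((hu.continuous_fderiv (by simp)).norm).pow 2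

lemma pogorelov (hn : n = 3 ∨ n = 4) {c M G H e0 : ℝ} (hc : 0 < c) (he0 : 0 < e0) :
    ∃ C, ∀ (R : ℝ) (u : EuclideanSpace ℝ (Fin n) → ℝ), Sol c R M u →
      ∀ q : EuclideanSpace ℝ (Fin n) → ℝ, ContDiff ℝ ∞ q →
      ∀ (x0 : EuclideanSpace ℝ (Fin n)) (r : ℝ),
      Metric.closedBall x0 r ⊆ Metric.ball 0 R →
      (∀ z ∈ Metric.ball x0 r, 0 ≤ lap q z ∧ frob q z ≤ lap q z ^ 2 ∧ ‖fderiv ℝ q z‖ ≤ G ∧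
        q z - u z ≤ H) →
      (∀ z ∈ Metric.sphere x0 r, q z ≤ u z) →
      ∀ y ∈ Metric.ball x0 r, e0 ≤ q y - u y → lap u y ≤ C := by
  set be : ℝ := 1 / (1 + M ^ 2) with hbe
  have hbe0 : 0 < be := by rw [hbe]; positivity
  have hbM : be * M ^ 2 ≤ 1 := by
    rw [hbe, one_div, inv_mul_le_iff₀ (by positivity)]; linarith
  refine ⟨(1 + 2304 * (1 + c * H ^ 2 + (G + M) ^ 2) / be) * H ^ 35 * Real.exp 1 / e0 ^ 36, ?_⟩
  intro R u S q hq x0 r hsub hz hsph y hy hye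
  have hu := S.smooth
  set P : EuclideanSpace ℝ (Fin n) → ℝ := fun w =>
    lap u w * (max (q w - u w) 0) ^ 36 * Real.exp (be / 2 * gsq u w) with hP
  have hPc : Continuous P := by
    have h1 := (lap_smooth hu).continuous
    have h2 := hu.continuous
    have h3 := hq.continuous
    have h4 := gsq_cont hu
    rw [hP]; fun_prop
  have hsy : 0 < lap u y := S.pos y (hsub (Metric.ball_subset_closedBall hy))
  have hPy : lap u y * e0 ^ 36 ≤ P y := by
    have h1 : e0 ≤ max (q y - u y) 0 := hye.trans (le_max_left _ _)
    have h2 : 1 ≤ Real.exp (be / 2 * gsq u y) :=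
      Real.one_le_exp (mul_nonneg (by positivity) (sq_nonneg _))
    calc lap u y * e0 ^ 36 = lap u y * e0 ^ 36 * 1 := (mul_one _).symm
      _ ≤ lap u y * (max (q y - u y) 0) ^ 36 * Real.exp (be / 2 * gsq u y) := by gcongr
  have hPy0 : 0 < P y := lt_of_lt_of_le (by positivity) hPy
  obtain ⟨z, hzb, hzm, hloc⟩ := exists_loc_max hPc.continuousOn hy (fun z hz => by
    have : P z = 0 := by
      simp only [hP]; rw [max_eq_right (by linarith [hsph z hz])]; simp
    rw [this]; exact hPy0)
  have hzR : z ∈ Metric.ball (0 : EuclideanSpace ℝ (Fin n)) R :=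
    hsub (Metric.ball_subset_closedBall hzb)
  have hyz : P y ≤ P z := hzm y (Metric.ball_subset_closedBall hy)
  have heta : 0 < q z - u z := by
    by_contra h
    push Not at h
    have : P z = 0 := by
      simp only [hP]; rw [max_eq_right h]; simp
    linarith
  obtain ⟨g1, g2, g3, g4⟩ := hz z hzb
  obtain ⟨b, lam, F⟩ := exists_frame hn hc S hzR
  have hsz := F.pos
  have hlog : IsLocalMax (fun w => Real.log (lap u w) + 36 * Real.log (q w - u w)
      + be / 2 * gsq u w) z := by
    have ev1 : ∀ᶠ w in nhds z, 0 < lap u w :=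
      (lap_smooth hu).continuous.continuousAt.eventually (lt_mem_nhds hsz)
    have ev2 : ∀ᶠ w in nhds z, 0 < q w - u w :=
      (hq.continuous.sub hu.continuous).continuousAt.eventually (lt_mem_nhds heta)
    have key : ∀ w, 0 < lap u w → 0 < q w - u w → Real.log (P w) =
        Real.log (lap u w) + 36 * Real.log (q w - u w) + be / 2 * gsq u w := by
      intro w h1 h2
      simp only [hP]
      rw [max_eq_left h2.le, Real.log_mul (by positivity) (Real.exp_pos _).ne',
        Real.log_mul h1.ne' (by positivity), Real.log_exp, Real.log_pow]
      norm_num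
    filter_upwards [ev1, ev2, hloc] with w h1 h2 h3
    rw [← key w h1 h2, ← key z hsz heta]
    apply Real.log_le_log _ h3
    simp only [hP]; rw [max_eq_left h2.le]; positivity
  have hT := pog_pt hn F hc hu hq g1 g2 (S.bd1 z hzR) g3 g4 heta hbe hlog
  rw [le_div_iff₀ (by positivity)]
  refine hPy.trans (hyz.trans ?_)
  simp only [hP]
  rw [max_eq_left heta.le]
  have hex : Real.exp (be / 2 * gsq u z) ≤ Real.exp 1 := by
    apply Real.exp_le_exp.2
    have : gsq u z ≤ M ^ 2 := pow_le_pow_left₀ (norm_nonneg _) (S.bd1 z hzR) 2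
    have := mul_le_mul_of_nonneg_left this hbe0.le
    linarith
  have h35 : (q z - u z) ^ 35 ≤ H ^ 35 := pow_le_pow_left₀ heta.le g4 35
  have : lap u z * (q z - u z) ^ 36 = (lap u z * (q z - u z)) * (q z - u z) ^ 35 := by ring
  rw [this]
  have hT0 : 0 ≤ lap u z * (q z - u z) := by positivity
  have hH0 : 0 ≤ H := heta.le.trans g4
  have hT1 := hT0.trans hT
  exact mul_le_mul (mul_le_mul hT h35 (by positivity) hT1) hex (Real.exp_pos _).le
    (mul_nonneg hT1 (by positivity))

end pog
end SY
namespace SY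
open scoped ContDiff
open Finset

section dbl
variable {n : ℕ} {u : EuclideanSpace ℝ (Fin n) → ℝ}
variable {c : ℝ} {x : EuclideanSpace ℝ (Fin n)}
  {b : OrthonormalBasis (Fin n) ℝ (EuclideanSpace ℝ (Fin n))} {lam : Fin n → ℝ}

lemma exists_coord (hn : n ≤ 4) (b : OrthonormalBasis (Fin n) ℝ (EuclideanSpace ℝ (Fin n)))
    {y : EuclideanSpace ℝ (Fin n)} {r : ℝ} (hr : 0 < r) (hy : r ≤ ‖y‖) :
    ∃ i, r / 2 ≤ |inner ℝ y (b i)| := by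
  by_contra h
  push Not at h
  have h1 := norm_sq_expand b y
  have h2 : r ^ 2 ≤ ‖y‖ ^ 2 := pow_le_pow_left₀ hr.le hy 2
  have hne : (univ : Finset (Fin n)).Nonempty := by
    by_contra hne
    rw [not_nonempty_iff_eq_empty] at hne
    rw [hne] at h1; simp at h1
    rw [h1] at h2; simp at h2; exact absurd h2 (by positivity)
  have h3 : ∑ k, (inner ℝ y (b k)) ^ 2 < ∑ _k : Fin n, r ^ 2 / 4 := by
    apply sum_lt_sum_of_nonempty hne
    intro k _
    have := h k
    rw [← sq_abs]
    have h4 : |inner ℝ y (b k)| ^ 2 < (r / 2) ^ 2 :=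
      pow_lt_pow_left₀ this (abs_nonneg _) (by norm_num)
    linarith [h4]
  simp at h3
  have h5 : (n:ℝ) * (r ^ 2 / 4) ≤ 4 * (r ^ 2 / 4) :=
    mul_le_mul_of_nonneg_right (by exact_mod_cast hn) (by positivity)
  linarith

lemma J_rho (x0 : EuclideanSpace ℝ (Fin n)) (R : ℝ) (i : Fin n) :
    J (fun t => R ^ 2 - ‖x + t • b i - x0‖ ^ 2) (R ^ 2 - ‖x - x0‖ ^ 2)
      (-2 * inner ℝ (x - x0) (b i)) (-2) := by
  have h := (J.const (R ^ 2)).add ((J_sq x0 x (b i) (b.orthonormal.norm_eq_one i)).smul (-1))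
  have e : (fun t : ℝ => R ^ 2 - ‖x + t • b i - x0‖ ^ 2) =
      fun t : ℝ => R ^ 2 + -1 * ‖x + t • b i - x0‖ ^ 2 := by funext t; ring
  rw [e]
  exact h.congr (by ring) (by ring) (by ring)

lemma Frame.sum_f_le (hn : n ≤ 4) (F : Frame c u x b lam) :
    ∑ i, (lap u x - lam i) ≤ 3 * lap u x := by
  rw [F.sum_f]
  have : (n:ℝ) ≤ 4 := by exact_mod_cast hn
  nlinarith [F.pos]

lemma Frame.sum_f_sq (F : Frame c u x b lam) (hc : 0 < c) (a : Fin n → ℝ) :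
    ∑ i, (lap u x - lam i) * a i ^ 2 ≤ 2 * lap u x * ∑ i, a i ^ 2 := by
  rw [mul_sum]
  exact sum_le_sum fun i _ => mul_le_mul_of_nonneg_right (F.f_le hc i) (sq_nonneg _)

lemma Frame.p_le (_F : Frame c u x b lam) {M : ℝ} (hM : ‖fderiv ℝ u x‖ ≤ M) (i : Fin n) :
    |dd (b i) u x| ≤ M := by
  unfold dd
  have := (fderiv ℝ u x).le_opNorm (b i)
  rw [b.orthonormal.norm_eq_one, mul_one] at this
  exact this.trans hM

lemma two_sq (a b : ℝ) : (a - b) ^ 2 ≤ 2 * a ^ 2 + 2 * b ^ 2 := by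
  nlinarith [sq_nonneg (a + b)]

set_option maxHeartbeats 1000000 in
lemma dbl_pt (hn : n = 3 ∨ n = 4) (F : Frame c u x b lam) (hc : 0 < c)
    (hu : ContDiff ℝ ∞ u) {M r R al be La : ℝ} {x0 : EuclideanSpace ℝ (Fin n)}
    (hM1 : 1 ≤ M) (hM : ‖fderiv ℝ u x‖ ≤ M) (hr : 0 < r) (hr1 : r ≤ 1) (hR1 : R ≤ 1) (hR0 : 0 < R)
    (hal : al = r / (500 * M)) (hbe : be = r ^ 2 / (2000 * M ^ 2))
    (hL1 : 36 ≤ La) (hL2 : 2944 < be * La) (hL3 : 128 ≤ La * (al * r))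
    (hL4 : 28 * 36864 < La * (c * (al * r) ^ 2)) (hL5 : 4032 < La * r ^ 2)
    (hxr : r ≤ ‖x - x0‖) (hxR : ‖x - x0‖ < R) (hlog : 0 < Real.log (lap u x))
    (hmax : IsLocalMax (fun w => 2 * Real.log (R ^ 2 - ‖w - x0‖ ^ 2) + Real.log (Real.log (lap u w))
      + al * (fderiv ℝ u w (w - x0) - u w) + be / 2 * gsq u w) x) :
    (R ^ 2 - ‖x - x0‖ ^ 2) ^ 2 * Real.log (lap u x) ≤ La := by
  by_contra hcon
  push Not at hcon
  have hal0 : 0 < al := by rw [hal]; positivity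
  have hbe0 : 0 < be := by rw [hbe]; positivity
  have hbM : be * M = al * r / 4 := by rw [hbe, hal]; field_simp; norm_num
  have hab : 112 * al ^ 2 < be := by
    rw [hal, hbe]
    have : 112 * (r / (500 * M)) ^ 2 = r ^ 2 / (2000 * M ^ 2) * (896 / 1000) := by
      field_simp; norm_num
    rw [this]
    have : 0 < r ^ 2 / (2000 * M ^ 2) := by positivity
    linarith
  have hs := F.pos
  have hf := F.f_pos hc
  obtain ⟨B, C, hJ, hC0, hC1⟩ := F.jlog hu hc
  obtain ⟨Cg, hJg, hCg⟩ := J_gsq hu F.diag F.third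
  obtain ⟨Ce, hJe, hCe⟩ := J_eul hu x0 F.diag F.third
  rw [F.sum_f_lam] at hCe
  have hlt : Real.log (lap u x) ≤ lap u x := by
    have := Real.log_le_sub_one_of_pos hs; linarith
  have hplow := F.p_le hM
  set s := lap u x with hsd
  set L := Real.log s with hL
  set rho := R ^ 2 - ‖x - x0‖ ^ 2 with hrho
  set xi : Fin n → ℝ := fun i => inner ℝ (x - x0) (b i) with hxi
  set p : Fin n → ℝ := fun i => dd (b i) u x with hp
  have hrho0 : 0 < rho := by
    have := pow_lt_pow_left₀ hxR (norm_nonneg _) (by norm_num : (2:ℕ) ≠ 0)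
    rw [hrho]; linarith
  have hrho1 : rho ≤ 1 := by
    have : R ^ 2 ≤ 1 := by nlinarith
    rw [hrho]; linarith [sq_nonneg ‖x - x0‖]
  have hrr : rho ^ 2 ≤ rho := by nlinarith
  have hr21 : rho ^ 2 ≤ 1 := hrr.trans hrho1
  have hxs : ∑ i, xi i ^ 2 ≤ 1 := by
    rw [← norm_sq_expand b (x - x0)]
    have h1 : ‖x - x0‖ ≤ 1 := by linarith
    exact pow_le_one₀ (norm_nonneg _) h1
  have hxi1 : ∀ i, |xi i| ≤ 1 := fun i => by
    have : xi i ^ 2 ≤ ∑ i, xi i ^ 2 :=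
      single_le_sum (f := fun i => xi i ^ 2) (fun j _ => sq_nonneg _) (mem_univ i)
    rw [← sq_le_one_iff_abs_le_one]; linarith
  set psi : Fin n → ℝ := fun i => B i / L with hpsi
  have hm : ∀ i, 2 * (-2 * xi i / rho) + psi i + al * (xi i * lam i)
        + be / 2 * (2 * p i * lam i) = 0 ∧
      2 * (-2 / rho - (-2 * xi i / rho) ^ 2) + (C i / L - psi i ^ 2) + al * Ce i
        + be / 2 * Cg i ≤ 0 := fun i =>
    max_jets hmax (b i) ((((((J_rho x0 R i).log hrho0).smul 2).add ((hJ i).log hlog)).add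
      ((hJe i).smul al)).add ((hJg i).smul (be / 2)))
  have hpsie : ∀ i, psi i = 4 * xi i / rho - lam i * (al * xi i + be * p i) := fun i => by
    have e : 2 * (-2 * xi i / rho) = - (4 * xi i / rho) := by ring
    have := (hm i).1
    rw [e] at this; linarith
  have hsum := sum_nonpos fun i (_ : i ∈ (univ : Finset (Fin n))) =>
    mul_nonpos_of_nonneg_of_nonpos (hf i).le (hm i).2
  set N := ∑ i, (s - lam i) * lam i ^ 2 with hN
  set D := ∑ i, (s - lam i) * psi i ^ 2 with hD
  have hexp : ∑ i, (s - lam i) * (2 * (-2 / rho - (-2 * xi i / rho) ^ 2) + (C i / L - psi i ^ 2)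
      + al * Ce i + be / 2 * Cg i) =
      - (4 / rho) * ∑ i, (s - lam i) - 8 / rho ^ 2 * ∑ i, (s - lam i) * xi i ^ 2
      + (∑ i, (s - lam i) * C i) / L - D + al * (2 * c) + be * N := by
    have e : be * N = be / 2 * ∑ i, (s - lam i) * Cg i := by rw [hCg]; ring
    rw [e, ← hCe, hD]
    simp only [mul_sum, sum_div, ← sum_add_distrib, ← sum_sub_distrib]
    exact sum_congr rfl fun i _ => by ring
  rw [hexp] at hsum
  have hxi2 : ∑ i, (s - lam i) * xi i ^ 2 ≤ 2 * s := by
    have := F.sum_f_sq hc xi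
    have h2 := mul_le_mul_of_nonneg_left hxs (by positivity : 0 ≤ 2 * s)
    linarith
  have hmain : (∑ i, (s - lam i) * C i) / L - D + be * N ≤ 28 * s / rho ^ 2 := by
    have h1 : 4 / rho * ∑ i, (s - lam i) ≤ 12 * s / rho ^ 2 := by
      have h2 := F.sum_f_le (by omega)
      calc 4 / rho * ∑ i, (s - lam i) ≤ 4 / rho * (3 * s) := by gcongr
        _ = 12 * s / rho := by ring
        _ ≤ 12 * s / rho ^ 2 := by gcongr
    have h3 : 8 / rho ^ 2 * ∑ i, (s - lam i) * xi i ^ 2 ≤ 16 * s / rho ^ 2 := by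
      calc _ ≤ 8 / rho ^ 2 * (2 * s) := by gcongr
        _ = _ := by ring
    have h4 : 28 * s / rho ^ 2 = 12 * s / rho ^ 2 + 16 * s / rho ^ 2 := by ring
    have h5 : 0 < al * (2 * c) := by positivity
    linarith
  have hLr : La / rho ^ 2 ≤ L := by rw [div_le_iff₀ (by positivity)]; linarith
  have hLa0 : 0 < La := by linarith
  have hLaL : La ≤ L := by
    refine le_trans ?_ hLr
    rw [le_div_iff₀ (by positivity)]
    have := mul_le_mul_of_nonneg_left hr21 hLa0.le
    linarith
  have hN0 : 0 ≤ N := sum_nonneg fun i _ => mul_nonneg (hf i).le (sq_nonneg _)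
  have hD0 : 0 ≤ D := sum_nonneg fun i _ => mul_nonneg (hf i).le (sq_nonneg _)
  have hbp : ∀ i, |be * p i| ≤ al * r / 4 := fun i => by
    rw [abs_mul, abs_of_pos hbe0, ← hbM]
    exact mul_le_mul_of_nonneg_left (hplow i) hbe0.le
  by_cases hdeg : ∀ i, - s / 4 ≤ lam i
  · have h18 := hC1 hdeg
    have hkap : L / 36 * D + be * N ≤ 28 * s / rho ^ 2 := by
      have h1 : L / 18 * D ≤ (∑ i, (s - lam i) * C i) / L := by
        rw [le_div_iff₀ hlog]
        refine le_trans (le_of_eq ?_) h18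
        rw [hD, mul_sum, mul_sum, sum_mul]
        refine sum_congr rfl fun i _ => ?_
        simp only [hpsi]; field_simp
      have h2 : D ≤ L / 36 * D := le_mul_of_one_le_left hD0 (by linarith)
      linarith
    obtain ⟨i, hi⟩ := exists_coord (by omega) b hr hxr
    change r / 2 ≤ |xi i| at hi
    have hDi : (s - lam i) * psi i ^ 2 ≤ D :=
      single_le_sum (f := fun i => (s - lam i) * psi i ^ 2)
        (fun j _ => mul_nonneg (hf j).le (sq_nonneg _)) (mem_univ i)
    have hai := mul_le_mul_of_nonneg_left hi hal0.le
    have har : 0 < al * r := by positivity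
    have hz1 : |al * xi i + be * p i| ≤ 2 * al * |xi i| := by
      have h1 := abs_add_le (al * xi i) (be * p i)
      rw [abs_mul, abs_of_pos hal0] at h1
      have := hbp i
      linarith
    have hz2 : al * r / 4 ≤ |al * xi i + be * p i| := by
      have h1 := abs_sub_abs_le_abs_sub (al * xi i) (-(be * p i))
      rw [abs_mul, abs_of_pos hal0, abs_neg, sub_neg_eq_add] at h1
      have := hbp i
      linarith
    have hbeN : 0 ≤ be * N := by positivity
    have hLD : L / 36 * ((s - lam i) * psi i ^ 2) ≤ 28 * s / rho ^ 2 :=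
      le_trans (mul_le_mul_of_nonneg_left hDi (by positivity)) (by linarith)
    have hLD2 : La / rho ^ 2 / 36 * ((s - lam i) * psi i ^ 2) ≤ 28 * s / rho ^ 2 := by
      refine le_trans ?_ hLD
      have := mul_nonneg (hf i).le (sq_nonneg (psi i))
      gcongr
    have hLD3 : La * ((s - lam i) * psi i ^ 2) ≤ 1008 * s := by
      have e1 : La / rho ^ 2 / 36 * ((s - lam i) * psi i ^ 2) =
        (La * ((s - lam i) * psi i ^ 2)) / 36 / rho ^ 2 := by ring
      rw [e1] at hLD2
      have := (div_le_div_iff_of_pos_right (by positivity : 0 < rho ^ 2)).1 hLD2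
      linarith
    have hpabs : |4 * xi i / rho - lam i * (al * xi i + be * p i)| = |psi i| := by rw [hpsie]
    have hrx : |4 * xi i / rho| = 4 * |xi i| / rho := by
      rw [abs_div, abs_mul, abs_of_pos hrho0]; norm_num
    obtain ⟨i1, ht1, ht2⟩ := F.exists_top (by omega) (by omega) hc
    by_cases hii : i = i1
    · subst hii
      have h1 : s * (al * r) / 16 ≤ |lam i * (al * xi i + be * p i)| := by
        rw [abs_mul]
        have : s / 4 ≤ |lam i| := ht1.trans (le_abs_self _)
        calc s * (al * r) / 16 = (s / 4) * (al * r / 4) := by ring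
          _ ≤ _ := mul_le_mul this hz2 (by positivity) (abs_nonneg _)
      have h2 : 4 * |xi i| / rho ≤ s * (al * r) / 32 := by
        have h3 : La / rho ≤ s := by
          refine le_trans ?_ (hLr.trans hlt)
          gcongr
        have h4 : 4 * |xi i| / rho ≤ 4 / rho := by
          gcongr; linarith [hxi1 i]
        have h5 : 4 / rho ≤ La / rho * (al * r) / 32 := by
          have : La / rho * (al * r) / 32 = (La * (al * r) / 32) / rho := by ring
          rw [this]; gcongr; linarith
        refine h4.trans (h5.trans ?_)
        have : 0 < al * r := by positivity
        gcongr
      have h3 : s * (al * r) / 32 ≤ |psi i| := by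
        rw [← hpabs]
        have := abs_sub_abs_le_abs_sub (lam i * (al * xi i + be * p i)) (4 * xi i / rho)
        rw [abs_sub_comm, hrx] at this
        linarith
      have h4 : (s * (al * r) / 32) ^ 2 ≤ psi i ^ 2 := by
        rw [← sq_abs (psi i)]; exact pow_le_pow_left₀ (by positivity) h3 2
      have h5 : c / s * (s * (al * r) / 32) ^ 2 ≤ (s - lam i) * psi i ^ 2 :=
        mul_le_mul (F.f_ge hc i) h4 (by positivity) (hf i).le
      have e5 : c / s * (s * (al * r) / 32) ^ 2 = s * (c * (al * r) ^ 2) / 1024 := by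
        field_simp; norm_num
      rw [e5] at h5
      have h6 := mul_le_mul_of_nonneg_left h5 hLa0.le
      have h7 := mul_lt_mul_of_pos_right hL4 hs
      linarith
    · have hfi := ht2 i hii
      by_cases hsm : |lam i * (al * xi i + be * p i)| ≤ 2 * |xi i| / rho
      · have h3 : r ≤ |psi i| := by
          rw [← hpabs]
          have := abs_sub_abs_le_abs_sub (4 * xi i / rho) (lam i * (al * xi i + be * p i))
          rw [hrx] at this
          have h6 : 4 * |xi i| / rho = 2 * |xi i| / rho + 2 * |xi i| / rho := by ring
          have h7 : r ≤ 2 * |xi i| / rho := by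
            rw [le_div_iff₀ hrho0]
            have := mul_le_mul_of_nonneg_left hrho1 hr.le
            linarith
          linarith
        have h4 : r ^ 2 ≤ psi i ^ 2 := by
          rw [← sq_abs (psi i)]; exact pow_le_pow_left₀ (by positivity) h3 2
        have h5 : s / 4 * r ^ 2 ≤ (s - lam i) * psi i ^ 2 :=
          mul_le_mul hfi h4 (by positivity) (hf i).le
        have h6 := mul_le_mul_of_nonneg_left h5 hLa0.le
        have h7 := mul_lt_mul_of_pos_right hL5 hs
        linarith
      · push Not at hsm
        rw [abs_mul] at hsm
        have hxp : 0 < |xi i| := by linarith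
        have h1 : 1 < |lam i| * (al * rho) := by
          have h2 : 2 * |xi i| / rho < |lam i| * (2 * al * |xi i|) :=
            lt_of_lt_of_le hsm (mul_le_mul_of_nonneg_left hz1 (abs_nonneg _))
          rw [div_lt_iff₀ hrho0] at h2
          by_contra h3
          push Not at h3
          have := mul_le_mul_of_nonneg_left h3 (by positivity : 0 ≤ 2 * |xi i|)
          linarith
        have h2 : 1 < lam i ^ 2 * (al ^ 2 * rho ^ 2) := by
          have : lam i ^ 2 * (al ^ 2 * rho ^ 2) = (|lam i| * (al * rho)) ^ 2 := by
            rw [mul_pow, sq_abs, mul_pow]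
          rw [this]; exact one_lt_pow₀ h1 (by norm_num)
        have h3 := F.N_ge_single hc i
        have h4 : s / 4 * lam i ^ 2 ≤ N :=
          le_trans (mul_le_mul_of_nonneg_right hfi (sq_nonneg _)) h3
        have h5 : be * (s / 4 * lam i ^ 2) ≤ 28 * s / rho ^ 2 := by
          have : 0 ≤ L / 36 * D := by positivity
          have := mul_le_mul_of_nonneg_left h4 hbe0.le
          linarith
        rw [le_div_iff₀ (by positivity)] at h5
        have h6 : be * lam i ^ 2 * rho ^ 2 ≤ 112 := by
          by_contra h7
          push Not at h7
          have := mul_lt_mul_of_pos_right h7 hs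
          linarith
        have h8 : 112 * (lam i ^ 2 * (al ^ 2 * rho ^ 2)) ≤ be * lam i ^ 2 * rho ^ 2 := by
          have := mul_le_mul_of_nonneg_right hab.le (by positivity : 0 ≤ lam i ^ 2 * rho ^ 2)
          linarith
        linarith
  · push Not at hdeg
    obtain ⟨j, hj⟩ := hdeg
    have hN3 := F.N_ge' hc hj
    have hCL : 0 ≤ (∑ i, (s - lam i) * C i) / L := div_nonneg hC0 hlog.le
    have hDb : D ≤ 64 * s / rho ^ 2 + be / 2 * N := by
      have h1 : ∀ i, psi i ^ 2 ≤ 32 / rho ^ 2 * xi i ^ 2 + be / 2 * lam i ^ 2 := fun i => by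
        rw [hpsie i]
        have hz : (al * xi i + be * p i) ^ 2 ≤ 4 * al ^ 2 := by
          have h2 : |al * xi i + be * p i| ≤ 2 * al := by
            have h1 := abs_add_le (al * xi i) (be * p i)
            rw [abs_mul, abs_of_pos hal0] at h1
            have := hbp i
            have h8 := mul_le_mul_of_nonneg_left (hxi1 i) hal0.le
            have h9 := mul_le_mul_of_nonneg_left hr1 hal0.le
            linarith
          rw [← sq_abs]
          calc _ ≤ (2 * al) ^ 2 := pow_le_pow_left₀ (abs_nonneg _) h2 2
            _ = _ := by ring
        have h3 : (lam i * (al * xi i + be * p i)) ^ 2 ≤ be / 4 * lam i ^ 2 := by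
          rw [mul_pow, mul_comm]
          apply mul_le_mul_of_nonneg_right _ (sq_nonneg _)
          have : 0 ≤ al ^ 2 := sq_nonneg _
          linarith
        have h4 : (4 * xi i / rho) ^ 2 = 16 / rho ^ 2 * xi i ^ 2 := by ring
        have h5 : 32 / rho ^ 2 * xi i ^ 2 = 2 * (16 / rho ^ 2 * xi i ^ 2) := by ring
        have h6 := two_sq (4 * xi i / rho) (lam i * (al * xi i + be * p i))
        rw [h4] at h6
        linarith
      calc D ≤ ∑ i, (s - lam i) * (32 / rho ^ 2 * xi i ^ 2 + be / 2 * lam i ^ 2) :=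
            sum_le_sum fun i _ => mul_le_mul_of_nonneg_left (h1 i) (hf i).le
        _ = 32 / rho ^ 2 * ∑ i, (s - lam i) * xi i ^ 2 + be / 2 * N := by
            rw [hN]; simp only [mul_sum, ← sum_add_distrib]
            exact sum_congr rfl fun i _ => by ring
        _ ≤ 32 / rho ^ 2 * (2 * s) + be / 2 * N := by gcongr
        _ = _ := by ring
    have h1 : be / 2 * (s ^ 3 / 16) ≤ 92 * s / rho ^ 2 := by
      have h2 := mul_le_mul_of_nonneg_left hN3 (by positivity : 0 ≤ be / 2)
      have h3 : 92 * s / rho ^ 2 = 28 * s / rho ^ 2 + 64 * s / rho ^ 2 := by ring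
      linarith
    rw [le_div_iff₀ (by positivity)] at h1
    have h2 : be * (s ^ 2 * rho ^ 2) ≤ 2944 := by
      by_contra h7
      push Not at h7
      have := mul_lt_mul_of_pos_right h7 hs
      linarith
    have h3 : La ≤ s * rho ^ 2 := by
      have := mul_le_mul_of_nonneg_left hlt (sq_nonneg rho)
      linarith
    have h3' : 1 ≤ s := by linarith
    have h4 : La ≤ s ^ 2 * rho ^ 2 := by
      have := mul_le_mul_of_nonneg_right h3' (by positivity : 0 ≤ s * rho ^ 2)
      linarith
    have := mul_le_mul_of_nonneg_left h4 hbe0.le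
    linarith

end dbl
end SY
namespace SY
open scoped ContDiff
open Finset

section dbl2
variable {n : ℕ}

lemma doubling (hn : n = 3 ∨ n = 4) {c M r R S0 : ℝ} (hc : 0 < c) (hM1 : 1 ≤ M) (hr : 0 < r)
    (hrR : r ≤ R) (hR1 : R ≤ 1) :
    ∃ C, ∀ (R1 : ℝ) (u : EuclideanSpace ℝ (Fin n) → ℝ), Sol c R1 M u →
      ∀ (x0 : EuclideanSpace ℝ (Fin n)), Metric.closedBall x0 R ⊆ Metric.ball 0 R1 →
      (∀ y ∈ Metric.ball x0 r, lap u y ≤ S0) →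
      ∀ y ∈ Metric.closedBall x0 (R / 2), lap u y ≤ C := by
  have hR0 : 0 < R := by linarith
  have hr1 : r ≤ 1 := by linarith
  obtain ⟨al, hal⟩ : ∃ al, al = r / (500 * M) := ⟨_, rfl⟩
  obtain ⟨be, hbe⟩ : ∃ be, be = r ^ 2 / (2000 * M ^ 2) := ⟨_, rfl⟩
  have hal0 : 0 < al := by rw [hal]; positivity
  have hbe0 : 0 < be := by rw [hbe]; positivity
  obtain ⟨La, hLa⟩ : ∃ La, La = 36 + 2945 / be + 128 / (al * r) + 1032193 / (c * (al * r) ^ 2)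
    + 4033 / r ^ 2 := ⟨_, rfl⟩
  have p1 : 0 < 2945 / be := by positivity
  have p2 : 0 < 128 / (al * r) := by positivity
  have p3 : 0 < 1032193 / (c * (al * r) ^ 2) := by positivity
  have p4 : 0 < 4033 / r ^ 2 := by positivity
  have hL1 : 36 ≤ La := by linarith
  have hL2 : 2944 < be * La := by
    have : 2945 / be ≤ La := by linarith
    rw [div_le_iff₀ hbe0] at this; linarith
  have hL3 : 128 ≤ La * (al * r) := by
    have : 128 / (al * r) ≤ La := by linarith
    rwa [div_le_iff₀ (by positivity)] at this
  have hL4 : 28 * 36864 < La * (c * (al * r) ^ 2) := by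
    have : 1032193 / (c * (al * r) ^ 2) ≤ La := by linarith
    rw [div_le_iff₀ (by positivity)] at this; linarith
  have hL5 : 4032 < La * r ^ 2 := by
    have : 4033 / r ^ 2 ≤ La := by linarith
    rw [div_le_iff₀ (by positivity)] at this; linarith
  set K := (La + |Real.log S0|) * Real.exp (al * (2 * M) + be / 2 * M ^ 2) with hK
  have hK0 : 0 < K := by
    have := abs_nonneg (Real.log S0)
    have : 0 < La + |Real.log S0| := by linarith
    positivity
  refine ⟨Real.exp (K * Real.exp (al * (2 * M)) / (9 * R ^ 4 / 16)), ?_⟩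
  intro R1 u S x0 hsub hS0 y hy
  have hu := S.smooth
  have hyR : y ∈ Metric.ball x0 R :=
    Metric.closedBall_subset_ball (by linarith) hy
  have hyR1 := hsub (Metric.ball_subset_closedBall hyR)
  have hsy := S.pos y hyR1
  rw [← Real.log_le_iff_le_exp hsy]
  have hRHS : 0 ≤ K * Real.exp (al * (2 * M)) / (9 * R ^ 4 / 16) := by positivity
  by_cases hLy : Real.log (lap u y) ≤ 0
  · exact hLy.trans hRHS
  push Not at hLy
  set E : EuclideanSpace ℝ (Fin n) → ℝ := fun w => fderiv ℝ u w (w - x0) - u w with hE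
  have hEb : ∀ w ∈ Metric.closedBall x0 R, |E w| ≤ 2 * M := by
    intro w hw
    have hwR := hsub hw
    have h1 := (fderiv ℝ u w).le_opNorm (w - x0)
    have h2 : ‖w - x0‖ ≤ 1 := by rw [mem_closedBall_iff_norm] at hw; linarith
    have h3 := S.bd1 w hwR
    have h4 := S.bd0 w hwR
    have h5 : ‖fderiv ℝ u w‖ * ‖w - x0‖ ≤ M * 1 :=
      mul_le_mul h3 h2 (norm_nonneg _) (by linarith)
    rw [Real.norm_eq_abs] at h1
    calc |E w| ≤ |fderiv ℝ u w (w - x0)| + |u w| := abs_sub _ _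
      _ ≤ 2 * M := by linarith
  set P : EuclideanSpace ℝ (Fin n) → ℝ := fun w => (R ^ 2 - ‖w - x0‖ ^ 2) ^ 2 *
    max (Real.log (lap u w)) 0 * Real.exp (al * E w + be / 2 * gsq u w) with hP
  have hPc : ContinuousOn P (Metric.closedBall x0 R) := by
    have h1 : ContinuousOn (fun w => Real.log (lap u w)) (Metric.closedBall x0 R) :=
      ContinuousOn.log (lap_smooth hu).continuous.continuousOn
        fun w hw => (S.pos w (hsub hw)).ne'
    have h2 := hu.continuous
    have h4 := gsq_cont hu
    have h5 := hu.continuous_fderiv (by simp)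
    have h6 : Continuous E := by rw [hE]; fun_prop
    rw [hP]; fun_prop
  have hrhoy : 3 / 4 * R ^ 2 ≤ R ^ 2 - ‖y - x0‖ ^ 2 := by
    rw [mem_closedBall_iff_norm] at hy
    have := pow_le_pow_left₀ (norm_nonneg _) hy 2
    linarith
  have hPy : 9 * R ^ 4 / 16 * Real.log (lap u y) * Real.exp (- (al * (2 * M))) ≤ P y := by
    simp only [hP]
    rw [max_eq_left hLy.le]
    have h1 : (3 / 4 * R ^ 2) ^ 2 ≤ (R ^ 2 - ‖y - x0‖ ^ 2) ^ 2 :=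
      pow_le_pow_left₀ (by positivity) hrhoy 2
    have h2 : 9 * R ^ 4 / 16 = (3 / 4 * R ^ 2) ^ 2 := by ring
    rw [h2]
    have h3 : - (al * (2 * M)) ≤ al * E y + be / 2 * gsq u y := by
      have h4 := (abs_le.1 (hEb y (Metric.ball_subset_closedBall hyR))).1
      have h5 : 0 ≤ be / 2 * gsq u y := mul_nonneg (by positivity) (sq_nonneg _)
      have h6 := mul_le_mul_of_nonneg_left h4 hal0.le
      linarith
    gcongr
  have hPy0 : 0 < P y := lt_of_lt_of_le (by positivity) hPy
  obtain ⟨z, hzb, hzm, hloc⟩ := exists_loc_max hPc hyR (fun z hz => by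
    have : P z = 0 := by
      simp only [hP]
      rw [mem_sphere_iff_norm] at hz; rw [hz]; simp
    rw [this]; exact hPy0)
  have hzR : z ∈ Metric.ball (0 : EuclideanSpace ℝ (Fin n)) R1 :=
    hsub (Metric.ball_subset_closedBall hzb)
  have hyz : P y ≤ P z := hzm y (Metric.ball_subset_closedBall hyR)
  have hLz : 0 < Real.log (lap u z) := by
    by_contra h
    push Not at h
    have : P z = 0 := by
      simp only [hP]; rw [max_eq_right h]; simp
    linarith
  have hzn : ‖z - x0‖ < R := by rwa [mem_ball_iff_norm] at hzb
  have hrz : ∀ w, ‖w - x0‖ < R → 0 < R ^ 2 - ‖w - x0‖ ^ 2 := fun w hw => by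
    have := pow_lt_pow_left₀ hw (norm_nonneg _) (by norm_num : (2:ℕ) ≠ 0)
    linarith
  have hrz1 : (R ^ 2 - ‖z - x0‖ ^ 2) ^ 2 ≤ 1 := by
    apply pow_le_one₀ (hrz z hzn).le
    have : R ^ 2 ≤ 1 := pow_le_one₀ hR0.le hR1
    linarith [sq_nonneg ‖z - x0‖]
  obtain ⟨b, lam, F⟩ := exists_frame hn hc S hzR
  have hsz := F.pos
  have hmain : (R ^ 2 - ‖z - x0‖ ^ 2) ^ 2 * Real.log (lap u z) ≤ La + |Real.log S0| := by
    by_cases hzr : ‖z - x0‖ < r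
    · have h1 : lap u z ≤ S0 := hS0 z (by rwa [mem_ball_iff_norm])
      have h2 : Real.log (lap u z) ≤ |Real.log S0| :=
        (Real.log_le_log hsz h1).trans (le_abs_self _)
      have h3 := mul_le_mul_of_nonneg_right hrz1 hLz.le
      linarith
    · push Not at hzr
      have hlog : IsLocalMax (fun w => 2 * Real.log (R ^ 2 - ‖w - x0‖ ^ 2)
          + Real.log (Real.log (lap u w))
          + al * (fderiv ℝ u w (w - x0) - u w) + be / 2 * gsq u w) z := by
        have ev1 : ∀ᶠ w in nhds z, 0 < Real.log (lap u w) :=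
          ((lap_smooth hu).continuous.continuousAt.log hsz.ne').eventually (lt_mem_nhds hLz)
        have ev2 : ∀ᶠ w in nhds z, w ∈ Metric.ball x0 R := Metric.isOpen_ball.mem_nhds hzb
        have key : ∀ w, 0 < Real.log (lap u w) → ‖w - x0‖ < R → Real.log (P w) =
            2 * Real.log (R ^ 2 - ‖w - x0‖ ^ 2) + Real.log (Real.log (lap u w))
            + al * (fderiv ℝ u w (w - x0) - u w) + be / 2 * gsq u w := by
          intro w h1 h2
          have h3 := hrz w h2
          simp only [hP, hE]
          rw [max_eq_left h1.le, Real.log_mul (by positivity) (Real.exp_pos _).ne',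
            Real.log_mul (by positivity) h1.ne', Real.log_exp, Real.log_pow]
          norm_num; ring
        filter_upwards [ev1, ev2, hloc] with w h1 h2 h3
        rw [mem_ball_iff_norm] at h2
        rw [← key w h1 h2, ← key z hLz hzn]
        apply Real.log_le_log _ h3
        have h4 := hrz w h2
        simp only [hP]; rw [max_eq_left h1.le]; positivity
      have := dbl_pt hn F hc hu hM1 (S.bd1 z hzR) hr hr1 hR1 hR0 hal hbe hL1 hL2 hL3 hL4 hL5
        hzr hzn hLz hlog
      linarith [abs_nonneg (Real.log S0)]
  have hPz : P z ≤ K := by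
    simp only [hP, hK]
    rw [max_eq_left hLz.le]
    have h1 : al * E z + be / 2 * gsq u z ≤ al * (2 * M) + be / 2 * M ^ 2 := by
      have h2 : gsq u z ≤ M ^ 2 := pow_le_pow_left₀ (norm_nonneg _) (S.bd1 z hzR) 2
      have h4 := (abs_le.1 (hEb z (Metric.ball_subset_closedBall hzb))).2
      have h6 := mul_le_mul_of_nonneg_left h4 hal0.le
      have h7 := mul_le_mul_of_nonneg_left h2 (by positivity : 0 ≤ be / 2)
      linarith
    apply mul_le_mul hmain (Real.exp_le_exp.2 h1) (Real.exp_pos _).le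
    linarith [abs_nonneg (Real.log S0)]
  rw [le_div_iff₀ (by positivity)]
  have h1 := hPy.trans (hyz.trans hPz)
  rw [Real.exp_neg, ← div_eq_mul_inv, div_le_iff₀ (Real.exp_pos _)] at h1
  linarith

end dbl2
end SY
namespace SY
open scoped ContDiff
open Finset

section grad
variable {n : ℕ}

/-- quadratic polynomial -/
noncomputable def qd (k : ℝ) (l : EuclideanSpace ℝ (Fin n) →L[ℝ] ℝ)
    (B : EuclideanSpace ℝ (Fin n) →L[ℝ] EuclideanSpace ℝ (Fin n) →L[ℝ] ℝ)
    (x0 : EuclideanSpace ℝ (Fin n)) (x : EuclideanSpace ℝ (Fin n)) : ℝ :=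
  k + l (x - x0) + 1 / 2 * B (x - x0) (x - x0)

variable {k : ℝ} {l : EuclideanSpace ℝ (Fin n) →L[ℝ] ℝ}
    {B : EuclideanSpace ℝ (Fin n) →L[ℝ] EuclideanSpace ℝ (Fin n) →L[ℝ] ℝ}
    {x0 : EuclideanSpace ℝ (Fin n)}

lemma qd_smooth : ContDiff ℝ ∞ (qd k l B x0) := by
  unfold qd
  have h1 : ContDiff ℝ ∞ fun x : EuclideanSpace ℝ (Fin n) => B (x - x0) (x - x0) :=
    (B.contDiff.comp (contDiff_id.sub contDiff_const)).clm_apply (contDiff_id.sub contDiff_const)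
  have h2 : ContDiff ℝ ∞ fun x : EuclideanSpace ℝ (Fin n) => l (x - x0) :=
    l.contDiff.comp (contDiff_id.sub contDiff_const)
  exact (contDiff_const.add h2).add (contDiff_const.mul h1)

lemma qd_deriv (hB : ∀ v w, B v w = B w v) (x : EuclideanSpace ℝ (Fin n)) :
    HasFDerivAt (qd k l B x0) (l + B (x - x0)) x := by
  unfold qd
  have h0 : HasFDerivAt (fun x : EuclideanSpace ℝ (Fin n) => x - x0)
      (ContinuousLinearMap.id ℝ _) x := (hasFDerivAt_id x).sub_const x0
  have h1 := (B.hasFDerivAt.comp x h0).clm_apply h0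
  have h2 := l.hasFDerivAt.comp x h0
  have h3 := (h2.const_add k).add (h1.const_mul (1 / 2))
  refine h3.congr_fderiv ?_
  ext v
  simp
  rw [hB v x, hB v x0]; ring

lemma qd_dd (hB : ∀ v w, B v w = B w v) (w : EuclideanSpace ℝ (Fin n)) :
    dd w (qd k l B x0) = fun x => l w + B (x - x0) w := by
  funext x
  rw [dd, (qd_deriv hB x).fderiv]; rfl

lemma qd_dd2 (hB : ∀ v w, B v w = B w v) (v w : EuclideanSpace ℝ (Fin n)) :
    dd v (dd w (qd k l B x0)) = fun _ => B v w := by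
  rw [qd_dd hB]
  funext x
  have h0 : HasFDerivAt (fun x : EuclideanSpace ℝ (Fin n) => x - x0)
      (ContinuousLinearMap.id ℝ _) x := (hasFDerivAt_id x).sub_const x0
  have h1 := ((B.hasFDerivAt.comp x h0).clm_apply (hasFDerivAt_const w x)).const_add (l w)
  rw [dd]
  have := h1.fderiv
  simp only [Function.comp_def] at this
  rw [this]; simp

lemma dd_sub {f g : EuclideanSpace ℝ (Fin n) → ℝ} (hf : ContDiff ℝ ∞ f) (hg : ContDiff ℝ ∞ g)
    (v : EuclideanSpace ℝ (Fin n)) : dd v (fun x => f x - g x) = fun x => dd v f x - dd v g x := by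
  funext x
  unfold dd
  rw [fderiv_fun_sub (dd_diff hf x) (dd_diff hg x)]; rfl

lemma dd_const (k : ℝ) (v : EuclideanSpace ℝ (Fin n)) : dd v (fun _ => k) = fun _ => 0 := by
  funext x; simp [dd]

lemma qsub_dd2 {u : EuclideanSpace ℝ (Fin n) → ℝ} (hu : ContDiff ℝ ∞ u)
    (hB : ∀ v w, B v w = B w v) (v w : EuclideanSpace ℝ (Fin n)) :
    dd v (dd w (fun x => qd k l B x0 x - u x)) = fun x => B v w - dd v (dd w u) x := by
  rw [dd_sub qd_smooth hu, dd_sub (dd_smooth qd_smooth) (dd_smooth hu), qd_dd2 hB]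

lemma qsub_dd3 {u : EuclideanSpace ℝ (Fin n) → ℝ} (hu : ContDiff ℝ ∞ u)
    (hB : ∀ v w, B v w = B w v) (v w z : EuclideanSpace ℝ (Fin n)) :
    dd z (dd v (dd w (fun x => qd k l B x0 x - u x))) = fun x => - dd z (dd v (dd w u)) x := by
  rw [qsub_dd2 hu hB, dd_sub contDiff_const (dd_smooth (dd_smooth hu)), dd_const]
  funext x; simp

variable {u : EuclideanSpace ℝ (Fin n) → ℝ}
variable {c : ℝ} {x : EuclideanSpace ℝ (Fin n)}
  {b : OrthonormalBasis (Fin n) ℝ (EuclideanSpace ℝ (Fin n))} {lam : Fin n → ℝ}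

set_option maxHeartbeats 1000000 in
lemma grad_pt (hn : n = 3 ∨ n = 4) (F : Frame c u x b lam) (hc : 0 < c)
    {ph : EuclideanSpace ℝ (Fin n) → ℝ} (hph : ContDiff ℝ ∞ ph) {K R : ℝ} (hK : 0 ≤ K)
    (hd : ∀ i j, dd (b i) (dd (b j) ph) x = if i = j then 2 * K - lam i else 0)
    (h3 : ∀ k, ∑ i, (lap u x - lam i) * dd (b i) (dd (b i) (dd (b k) ph)) x = 0)
    (hR1 : R ≤ 1) (hxR : ‖x - x0‖ < R) (hpos : 0 < ph x) (hw0 : 0 < gsq ph x)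
    (hmax : IsLocalMax (fun w => Real.log (gsq ph w) + (-1) * Real.log (ph w)
      + 2 * Real.log (R ^ 2 - ‖w - x0‖ ^ 2)) x) :
    (R ^ 2 - ‖x - x0‖ ^ 2) ^ 2 * gsq ph x ≤ ph x * (24 * K + 304 * ph x) := by
  have hs := F.pos
  have hf := F.f_pos hc
  obtain ⟨C, hJg, hC⟩ := J_gsq hph hd h3
  set s := lap u x with hsd
  set f := ph x with hfd
  set w := gsq ph x with hwd
  set rho := R ^ 2 - ‖x - x0‖ ^ 2 with hrho
  set xi : Fin n → ℝ := fun i => inner ℝ (x - x0) (b i) with hxi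
  set p : Fin n → ℝ := fun i => dd (b i) ph x with hp
  have hR0 : 0 ≤ R := (norm_nonneg _).trans hxR.le
  have hrho0 : 0 < rho := by
    have := pow_lt_pow_left₀ hxR (norm_nonneg _) (by norm_num : (2:ℕ) ≠ 0)
    rw [hrho]; linarith
  have hrho1 : rho ≤ 1 := by
    have : R ^ 2 ≤ 1 := pow_le_one₀ hR0 hR1
    rw [hrho]; linarith [sq_nonneg ‖x - x0‖]
  have hrr : rho ^ 2 ≤ rho := by nlinarith
  have hr21 : rho ^ 2 ≤ 1 := hrr.trans hrho1
  have hxs : ∑ i, xi i ^ 2 ≤ 1 := by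
    rw [← norm_sq_expand b (x - x0)]
    exact pow_le_one₀ (norm_nonneg _) (by linarith)
  have hwp : ∑ i, p i ^ 2 = w := (gsq_eq x b).symm
  have hm : ∀ i, 2 * p i * (2 * K - lam i) / w + (-1) * (p i / f) + 2 * (-2 * xi i / rho) = 0 ∧
      (C i / w - (2 * p i * (2 * K - lam i) / w) ^ 2)
        + (-1) * ((2 * K - lam i) / f - (p i / f) ^ 2)
        + 2 * (-2 / rho - (-2 * xi i / rho) ^ 2) ≤ 0 := fun i =>
    max_jets hmax (b i) ((((hJg i).log hw0).add
      ((((J.of_smooth hph x (b i)).congr rfl rfl (by rw [hd]; simp)).log hpos).smul (-1))).add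
        (((J_rho x0 R i).log hrho0).smul 2))
  have hfirst : ∀ i, 2 * p i * (2 * K - lam i) / w = p i / f + 4 * xi i / rho := fun i => by
    have := (hm i).1
    have e : 2 * (-2 * xi i / rho) = - (4 * xi i / rho) := by ring
    rw [e] at this; linarith
  have hxi2 : ∑ i, (s - lam i) * xi i ^ 2 ≤ 2 * s := by
    have := F.sum_f_sq hc xi
    have h2 := mul_le_mul_of_nonneg_left hxs (by positivity : 0 ≤ 2 * s)
    linarith
  have hsf := F.sum_f_le (by omega)
  set T := ∑ i, (s - lam i) * p i ^ 2 with hT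
  have hmu : ∑ i, (s - lam i) * (2 * K - lam i) ≤ 6 * K * s := by
    have h1 := F.sum_f_lam
    have : ∑ i, (s - lam i) * (2 * K - lam i) = 2 * K * ∑ i, (s - lam i) -
        ∑ i, (s - lam i) * lam i := by
      rw [mul_sum, ← sum_sub_distrib]; exact sum_congr rfl fun i _ => by ring
    rw [this, h1]
    have := mul_le_mul_of_nonneg_left hsf (by positivity : 0 ≤ 2 * K)
    linarith
  have hsecond : 1 / 4 * (T / f ^ 2) ≤ 6 * K * s / f + 76 * s / rho ^ 2 := by
    have hsum := sum_nonpos fun i (_ : i ∈ (univ : Finset (Fin n))) =>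
      mul_nonpos_of_nonneg_of_nonpos (hf i).le (hm i).2
    have hmm : 1 / 2 * ∑ i, (s - lam i) * (2 * p i * (2 * K - lam i) / w) ^ 2 ≤
        (∑ i, (s - lam i) * C i) / w := by
      rw [hC, mul_sum, mul_sum, sum_div]
      refine sum_le_sum fun i _ => ?_
      have h1 : p i ^ 2 ≤ w := by
        rw [← hwp]
        exact single_le_sum (f := fun i => p i ^ 2) (fun j _ => sq_nonneg _) (mem_univ i)
      have e1 : 1 / 2 * ((s - lam i) * (2 * p i * (2 * K - lam i) / w) ^ 2) =
        2 * ((s - lam i) * (2 * K - lam i) ^ 2) * p i ^ 2 / w ^ 2 := by ring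
      rw [e1, div_le_div_iff₀ (by positivity) hw0]
      have h2 : 0 ≤ 2 * ((s - lam i) * (2 * K - lam i) ^ 2) * w :=
        mul_nonneg (mul_nonneg (by norm_num) (mul_nonneg (hf i).le (sq_nonneg _))) hw0.le
      have := mul_le_mul_of_nonneg_left h1 h2
      linarith
    have h5 : ∑ i, (s - lam i) * (2 * p i * (2 * K - lam i) / w) ^ 2 ≤
        3 / 2 * (T / f ^ 2) + 48 / rho ^ 2 * ∑ i, (s - lam i) * xi i ^ 2 := by
      rw [hT, sum_div, mul_sum, mul_sum, ← sum_add_distrib]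
      refine sum_le_sum fun i _ => ?_
      rw [hfirst]
      have : (p i / f + 4 * xi i / rho) ^ 2 ≤ 3 / 2 * (p i / f) ^ 2 + 3 * (4 * xi i / rho) ^ 2 := by
        nlinarith [sq_nonneg (p i / f - 2 * (4 * xi i / rho))]
      have := mul_le_mul_of_nonneg_left this (hf i).le
      refine this.trans (le_of_eq ?_)
      ring
    have hexp : ∑ i, (s - lam i) * ((C i / w - (2 * p i * (2 * K - lam i) / w) ^ 2)
        + (-1) * ((2 * K - lam i) / f - (p i / f) ^ 2)
        + 2 * (-2 / rho - (-2 * xi i / rho) ^ 2)) =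
        (∑ i, (s - lam i) * C i) / w - ∑ i, (s - lam i) * (2 * p i * (2 * K - lam i) / w) ^ 2
        - (∑ i, (s - lam i) * (2 * K - lam i)) / f + T / f ^ 2
        - 4 / rho * ∑ i, (s - lam i) - 8 / rho ^ 2 * ∑ i, (s - lam i) * xi i ^ 2 := by
      rw [hT]
      simp only [mul_sum, sum_div, ← sum_add_distrib, ← sum_sub_distrib]
      exact sum_congr rfl fun i _ => by ring
    rw [hexp] at hsum
    have h6 : 4 / rho * ∑ i, (s - lam i) ≤ 12 * s / rho ^ 2 := by
      calc 4 / rho * ∑ i, (s - lam i) ≤ 4 / rho * (3 * s) := by gcongr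
        _ = 12 * s / rho := by ring
        _ ≤ 12 * s / rho ^ 2 := by gcongr
    have h7 : 32 / rho ^ 2 * ∑ i, (s - lam i) * xi i ^ 2 ≤ 64 * s / rho ^ 2 := by
      calc _ ≤ 32 / rho ^ 2 * (2 * s) := by gcongr
        _ = _ := by ring
    have h8 : (∑ i, (s - lam i) * (2 * K - lam i)) / f ≤ 6 * K * s / f := by gcongr
    have e1 : 48 / rho ^ 2 * ∑ i, (s - lam i) * xi i ^ 2 =
      48 * (1 / rho ^ 2 * ∑ i, (s - lam i) * xi i ^ 2) := by ring
    have e2 : 32 / rho ^ 2 * ∑ i, (s - lam i) * xi i ^ 2 =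
      32 * (1 / rho ^ 2 * ∑ i, (s - lam i) * xi i ^ 2) := by ring
    have e3 : 8 / rho ^ 2 * ∑ i, (s - lam i) * xi i ^ 2 =
      8 * (1 / rho ^ 2 * ∑ i, (s - lam i) * xi i ^ 2) := by ring
    have e4 : 76 * s / rho ^ 2 = 12 * s / rho ^ 2 + 64 * s / rho ^ 2 := by ring
    rw [e1] at h5; rw [e2] at h7; rw [e3] at hsum
    linarith
  have hsw : s * w - ∑ i, lam i * p i ^ 2 = T := by
    rw [hT, ← hwp, mul_sum, ← sum_sub_distrib]; exact sum_congr rfl fun i _ => by ring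
  have hX : |∑ i, xi i * p i| ≤ Real.sqrt w := by
    apply Real.abs_le_sqrt
    have := sum_mul_sq_le_sq_mul_sq univ xi p
    rw [hwp] at this
    have := mul_le_mul_of_nonneg_right hxs hw0.le
    linarith
  have hdir : 4 * K * w - 2 * ∑ i, lam i * p i ^ 2 = w * (w / f + 4 * (∑ i, xi i * p i) / rho) := by
    have h1 : ∑ i, p i * (2 * p i * (2 * K - lam i) / w) =
        ∑ i, p i * (p i / f + 4 * xi i / rho) := sum_congr rfl fun i _ => by rw [hfirst]
    have e1 : ∑ i, p i * (2 * p i * (2 * K - lam i) / w) =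
        (4 * K * ∑ i, p i ^ 2 - 2 * ∑ i, lam i * p i ^ 2) / w := by
      rw [mul_sum, mul_sum, ← sum_sub_distrib, sum_div]
      exact sum_congr rfl fun i _ => by ring
    have e2 : ∑ i, p i * (p i / f + 4 * xi i / rho) =
        (∑ i, p i ^ 2) / f + 4 * (∑ i, xi i * p i) / rho := by
      rw [mul_sum, sum_div, sum_div, ← sum_add_distrib]
      exact sum_congr rfl fun i _ => by ring
    rw [e1, e2, hwp, div_eq_iff hw0.ne'] at h1
    rw [h1]; ring
  have hXlow : -(4 * Real.sqrt w / rho) ≤ 4 * (∑ i, xi i * p i) / rho := by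
    rw [← neg_div]
    apply div_le_div_of_nonneg_right _ hrho0.le
    linarith [(abs_le.1 hX).1]
  have hsq : Real.sqrt w ^ 2 = w := Real.sq_sqrt hw0.le
  by_cases hcase : 4 * K + 4 * Real.sqrt w / rho ≤ w / f
  · have hlp : ∑ i, lam i * p i ^ 2 ≤ 0 := by
      have h1 : 4 * K ≤ w / f + 4 * (∑ i, xi i * p i) / rho := by linarith
      have := mul_le_mul_of_nonneg_left h1 hw0.le
      linarith
    have hT2 : s * w ≤ T := by linarith
    have h1 : 1 / 4 * (s * w / f ^ 2) ≤ 6 * K * s / f + 76 * s / rho ^ 2 := by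
      refine le_trans ?_ hsecond
      gcongr
    have h2 : rho ^ 2 * f ^ 2 * (1 / 4 * (s * w / f ^ 2)) ≤
      rho ^ 2 * f ^ 2 * (6 * K * s / f + 76 * s / rho ^ 2) := by gcongr
    have e1 : rho ^ 2 * f ^ 2 * (1 / 4 * (s * w / f ^ 2)) = s * (rho ^ 2 * w) / 4 := by field_simp
    have e2 : rho ^ 2 * f ^ 2 * (6 * K * s / f + 76 * s / rho ^ 2) =
      s * (6 * K * f * rho ^ 2 + 76 * f ^ 2) := by field_simp
    rw [e1, e2] at h2
    have h3 : rho ^ 2 * w / 4 ≤ 6 * K * f * rho ^ 2 + 76 * f ^ 2 := by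
      have : s * (rho ^ 2 * w / 4) ≤ s * (6 * K * f * rho ^ 2 + 76 * f ^ 2) := by linarith
      exact le_of_mul_le_mul_left this hs
    have h4 := mul_le_mul_of_nonneg_left hr21 (by positivity : 0 ≤ K * f)
    linarith
  · push Not at hcase
    rw [div_lt_iff₀ hpos] at hcase
    have h1 : rho ^ 2 * w ≤ rho ^ 2 * ((4 * K + 4 * Real.sqrt w / rho) * f) := by gcongr
    have e1 : rho ^ 2 * ((4 * K + 4 * Real.sqrt w / rho) * f) =
      4 * K * f * rho ^ 2 + 4 * f * (Real.sqrt w * rho) := by field_simp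
    rw [e1] at h1
    have h2 : 4 * f * (Real.sqrt w * rho) ≤ 1 / 2 * (rho ^ 2 * w) + 8 * f ^ 2 := by
      have := sq_nonneg (Real.sqrt w * rho - 4 * f)
      have e : (Real.sqrt w * rho) ^ 2 = rho ^ 2 * w := by rw [mul_pow, hsq]; ring
      nlinarith
    have h4 := mul_le_mul_of_nonneg_left hr21 (by positivity : 0 ≤ K * f)
    have h5 : 0 ≤ K * f := by positivity
    have h6 : 0 ≤ f ^ 2 := by positivity
    linarith

end grad
end SY
namespace SY
open scoped ContDiff
open Finset

section grad2
variable {n : ℕ}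

/-- scaled inner product form -/
noncomputable def ipB (n : ℕ) (t : ℝ) :
    EuclideanSpace ℝ (Fin n) →L[ℝ] EuclideanSpace ℝ (Fin n) →L[ℝ] ℝ :=
  t • innerSL ℝ

lemma ipB_apply (t : ℝ) (v w : EuclideanSpace ℝ (Fin n)) : ipB n t v w = t * inner ℝ v w := rfl

lemma ipB_symm (t : ℝ) (v w : EuclideanSpace ℝ (Fin n)) : ipB n t v w = ipB n t w v := by
  rw [ipB_apply, ipB_apply, real_inner_comm]

lemma qd_ip (k K : ℝ) (l : EuclideanSpace ℝ (Fin n) →L[ℝ] ℝ) (x0 x : EuclideanSpace ℝ (Fin n)) :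
    qd k l (ipB n (2 * K)) x0 x = k + l (x - x0) + K * ‖x - x0‖ ^ 2 := by
  unfold qd; rw [ipB_apply, real_inner_self_eq_norm_sq]; ring

lemma grad_pos (hn : n = 3 ∨ n = 4) {c M R R0 K H k : ℝ} (hc : 0 < c) (hK : 0 ≤ K)
    (hR1 : R0 ≤ 1) {u : EuclideanSpace ℝ (Fin n) → ℝ} (S : Sol c R M u)
    {l : EuclideanSpace ℝ (Fin n) →L[ℝ] ℝ} {x0 : EuclideanSpace ℝ (Fin n)}
    (hsub : Metric.closedBall x0 R0 ⊆ Metric.ball 0 R)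
    (hp : ∀ z ∈ Metric.closedBall x0 R0, 0 < qd k l (ipB n (2 * K)) x0 z - u z ∧
      qd k l (ipB n (2 * K)) x0 z - u z ≤ H) {y : EuclideanSpace ℝ (Fin n)}
    (hy : y ∈ Metric.ball x0 R0) :
    (R0 ^ 2 - ‖y - x0‖ ^ 2) ^ 2 * gsq (fun z => qd k l (ipB n (2 * K)) x0 z - u z) y ≤
      (qd k l (ipB n (2 * K)) x0 y - u y) * (24 * K + 304 * H) := by
  have hu := S.smooth
  set ph : EuclideanSpace ℝ (Fin n) → ℝ := fun z => qd k l (ipB n (2 * K)) x0 z - u z with hph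
  change (R0 ^ 2 - ‖y - x0‖ ^ 2) ^ 2 * gsq ph y ≤ ph y * (24 * K + 304 * H)
  have hphs : ContDiff ℝ ∞ ph := qd_smooth.sub hu
  have hyc := Metric.ball_subset_closedBall hy
  have hH : 0 ≤ H := (hp y hyc).1.le.trans (hp y hyc).2
  have hpy : 0 < ph y := (hp y hyc).1
  have hRHS : 0 ≤ ph y * (24 * K + 304 * H) := by positivity
  rcases (sq_nonneg ‖fderiv ℝ ph y‖).eq_or_lt with h0 | h0
  · have : gsq ph y = 0 := h0.symm
    rw [this, mul_zero]; exact hRHS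
  change 0 < gsq ph y at h0
  have hrz : ∀ w, ‖w - x0‖ < R0 → 0 < R0 ^ 2 - ‖w - x0‖ ^ 2 := fun w hw => by
    have := pow_lt_pow_left₀ hw (norm_nonneg _) (by norm_num : (2:ℕ) ≠ 0)
    linarith
  set P : EuclideanSpace ℝ (Fin n) → ℝ := fun w => (R0 ^ 2 - ‖w - x0‖ ^ 2) ^ 2 * gsq ph w / ph w
    with hP
  have hPc : ContinuousOn P (Metric.closedBall x0 R0) := by
    have h1 := gsq_cont hphs
    have h2 := hphs.continuous
    apply ContinuousOn.div
    · fun_prop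
    · fun_prop
    · exact fun w hw => (hp w hw).1.ne'
  have hyR : ‖y - x0‖ < R0 := by rwa [mem_ball_iff_norm] at hy
  have hPy : 0 < P y := by
    have := hrz y hyR
    simp only [hP]; positivity
  obtain ⟨z, hzb, hzm, hloc⟩ := exists_loc_max hPc hy (fun z hz => by
    have : P z = 0 := by
      simp only [hP]
      rw [mem_sphere_iff_norm] at hz; rw [hz]; simp
    rw [this]; exact hPy)
  have hyz : P y ≤ P z := hzm y hyc
  have hzc := Metric.ball_subset_closedBall hzb
  have hpz : 0 < ph z := (hp z hzc).1
  have hzn : ‖z - x0‖ < R0 := by rwa [mem_ball_iff_norm] at hzb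
  have hgz : 0 < gsq ph z := by
    rcases (sq_nonneg ‖fderiv ℝ ph z‖).eq_or_lt with h | h
    · exfalso
      have : gsq ph z = 0 := h.symm
      have : P z = 0 := by simp only [hP]; rw [this]; simp
      linarith
    · exact h
  obtain ⟨b, lam, F⟩ := exists_frame hn hc S (hsub hzc)
  have hlog : IsLocalMax (fun w => Real.log (gsq ph w) + (-1) * Real.log (ph w)
      + 2 * Real.log (R0 ^ 2 - ‖w - x0‖ ^ 2)) z := by
    have ev1 : ∀ᶠ w in nhds z, 0 < gsq ph w :=
      (gsq_cont hphs).continuousAt.eventually (lt_mem_nhds hgz)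
    have ev2 : ∀ᶠ w in nhds z, w ∈ Metric.ball x0 R0 := Metric.isOpen_ball.mem_nhds hzb
    have key : ∀ w, 0 < gsq ph w → 0 < ph w → ‖w - x0‖ < R0 → Real.log (P w) =
        Real.log (gsq ph w) + (-1) * Real.log (ph w)
      + 2 * Real.log (R0 ^ 2 - ‖w - x0‖ ^ 2) := by
      intro w h1 h2 h3
      have h4 := hrz w h3
      simp only [hP]
      rw [Real.log_div (by positivity) h2.ne', Real.log_mul (by positivity) h1.ne', Real.log_pow]
      push_cast; ring
    filter_upwards [ev1, ev2, hloc] with w h1 h2 h3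
    have hpw : 0 < ph w := (hp w (Metric.ball_subset_closedBall h2)).1
    rw [mem_ball_iff_norm] at h2
    rw [← key w h1 hpw h2, ← key z hgz hpz hzn]
    apply Real.log_le_log _ h3
    have h4 := hrz w h2
    simp only [hP]; positivity
  have hmain := grad_pt (ph := ph) hn F hc hphs hK (fun i j => by
      rw [hph, qsub_dd2 hu (ipB_symm _)]
      simp only []
      rw [F.diag, ipB_apply, orthonormal_iff_ite.1 b.orthonormal]
      split_ifs <;> simp) (fun k' => by
      rw [hph]
      simp only [qsub_dd3 hu (ipB_symm _), mul_neg, sum_neg_distrib]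
      rw [F.third, neg_zero]) hR1 hzn hpz hgz hlog
  have h1 : P z ≤ 24 * K + 304 * H := by
    simp only [hP]
    rw [div_le_iff₀ hpz]
    have h2 : ph z ≤ H := (hp z hzc).2
    have := mul_le_mul_of_nonneg_left h2 hpz.le
    linarith
  have h2 : P y ≤ 24 * K + 304 * H := hyz.trans h1
  simp only [hP] at h2
  rw [div_le_iff₀ hpy] at h2
  linarith

lemma gsq_qd_const (k k' : ℝ) (l : EuclideanSpace ℝ (Fin n) →L[ℝ] ℝ)
    (B : EuclideanSpace ℝ (Fin n) →L[ℝ] EuclideanSpace ℝ (Fin n) →L[ℝ] ℝ)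
    (x0 y : EuclideanSpace ℝ (Fin n)) (u : EuclideanSpace ℝ (Fin n) → ℝ) :
    fderiv ℝ (fun z => qd k l B x0 z - u z) y = fderiv ℝ (fun z => qd k' l B x0 z - u z) y := by
  have : (fun z => qd k l B x0 z - u z) = fun z => (k - k') + (qd k' l B x0 z - u z) := by
    funext z; unfold qd; ring
  rw [this, fderiv_const_add]

lemma grad_est (hn : n = 3 ∨ n = 4) {c M R0 K : ℝ} (hc : 0 < c) (hM : 0 ≤ M) (hK : 0 ≤ K)
    (hR0 : 0 < R0) (hR1 : R0 ≤ 1) : ∃ C, 0 ≤ C ∧ ∀ (R : ℝ) (u : EuclideanSpace ℝ (Fin n) → ℝ),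
    Sol c R M u → ∀ (x0 : EuclideanSpace ℝ (Fin n)), Metric.closedBall x0 R0 ⊆ Metric.ball 0 R →
    (∀ z ∈ Metric.closedBall x0 R0, u z ≤ u x0 + fderiv ℝ u x0 (z - x0) + K * ‖z - x0‖ ^ 2) →
    ∀ y ∈ Metric.ball x0 (R0 / 2), |u y - u x0 - fderiv ℝ u x0 (y - x0)| ≤ C * ‖y - x0‖ ^ 2 := by
  obtain ⟨La, hLa⟩ : ∃ La, La = (24 * K + 304 * (3 * M + K)) / (9 * R0 ^ 4 / 16) := ⟨_, rfl⟩
  have hLa0 : 0 ≤ La := by rw [hLa]; positivity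
  refine ⟨K + La / 4, by positivity, ?_⟩
  intro R u S x0 hsub ht y hy
  have hu := S.smooth
  set l := fderiv ℝ u x0 with hl
  set ph : EuclideanSpace ℝ (Fin n) → ℝ := fun z => qd (u x0) l (ipB n (2 * K)) x0 z - u z with hph
  have hphs : ContDiff ℝ ∞ ph := qd_smooth.sub hu
  have hphe : ∀ z, ph z = u x0 + l (z - x0) + K * ‖z - x0‖ ^ 2 - u z := fun z => by
    simp only [hph]; rw [qd_ip]
  have hx0c : x0 ∈ Metric.closedBall x0 R0 := Metric.mem_closedBall_self hR0.le
  have hph0 : ∀ z ∈ Metric.closedBall x0 R0, 0 ≤ ph z := fun z hz => by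
    rw [hphe]; linarith [ht z hz]
  have hphH : ∀ z ∈ Metric.closedBall x0 R0, ph z ≤ 3 * M + K := fun z hz => by
    rw [hphe]
    have h1 := S.bd0 x0 (hsub hx0c)
    have h2 := S.bd0 z (hsub hz)
    have h3 := S.bd1 x0 (hsub hx0c)
    have h4 := l.le_opNorm (z - x0)
    rw [Real.norm_eq_abs] at h4
    rw [mem_closedBall_iff_norm] at hz
    have h5 : ‖z - x0‖ ≤ 1 := hz.trans hR1
    have h6 : ‖z - x0‖ ^ 2 ≤ 1 := pow_le_one₀ (norm_nonneg _) h5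
    have h7 : ‖l‖ * ‖z - x0‖ ≤ M * 1 := mul_le_mul h3 h5 (norm_nonneg _) hM
    have h8 := mul_le_mul_of_nonneg_left h6 hK
    linarith [(abs_le.1 h1).2, (abs_le.1 h2).1, le_abs_self (l (z - x0))]
  have hg : ∀ z ∈ Metric.ball x0 (R0 / 2), gsq ph z ≤ La * ph z := by
    intro z hz
    have hzb : z ∈ Metric.ball x0 R0 := Metric.ball_subset_ball (by linarith) hz
    have hzc := Metric.ball_subset_closedBall hzb
    have hz0 := hph0 z hzc
    have h1 : ∀ t > 0, (R0 ^ 2 - ‖z - x0‖ ^ 2) ^ 2 * gsq ph z ≤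
        (ph z + t) * (24 * K + 304 * (3 * M + K + t)) := by
      intro t ht0
      have h2 := grad_pos (k := u x0 + t) (l := l) (H := 3 * M + K + t) hn hc hK hR1 S hsub
        (fun w hw => by
          have e : qd (u x0 + t) l (ipB n (2 * K)) x0 w - u w = ph w + t := by
            simp only [hph]; unfold qd; ring
          rw [e]
          exact ⟨by linarith [hph0 w hw], by linarith [hphH w hw]⟩) hzb
      have e : qd (u x0 + t) l (ipB n (2 * K)) x0 z - u z = ph z + t := by
        simp only [hph]; unfold qd; ring
      rw [e] at h2
      unfold gsq at h2 ⊢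
      rw [gsq_qd_const (u x0 + t) (u x0)] at h2
      exact h2
    have h2 : (R0 ^ 2 - ‖z - x0‖ ^ 2) ^ 2 * gsq ph z ≤ ph z * (24 * K + 304 * (3 * M + K)) := by
      have hc1 : Filter.Tendsto (fun t : ℝ => (ph z + t) * (24 * K + 304 * (3 * M + K + t)))
          (nhdsWithin 0 (Set.Ioi 0)) (nhds ((ph z + 0) * (24 * K + 304 * (3 * M + K + 0)))) :=
        (Continuous.tendsto (by fun_prop) 0).mono_left nhdsWithin_le_nhds
      have := ge_of_tendsto hc1 (by filter_upwards [self_mem_nhdsWithin] with t ht using h1 t ht)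
      simpa using this
    have h3 : 3 / 4 * R0 ^ 2 ≤ R0 ^ 2 - ‖z - x0‖ ^ 2 := by
      rw [mem_ball_iff_norm] at hz
      have := pow_le_pow_left₀ (norm_nonneg _) hz.le 2
      linarith
    have h4 : (3 / 4 * R0 ^ 2) ^ 2 ≤ (R0 ^ 2 - ‖z - x0‖ ^ 2) ^ 2 :=
      pow_le_pow_left₀ (by positivity) h3 2
    have h5 := mul_le_mul_of_nonneg_right h4 (sq_nonneg ‖fderiv ℝ ph z‖)
    change _ * gsq ph z ≤ _ * gsq ph z at h5
    have e : La * ph z = (ph z * (24 * K + 304 * (3 * M + K))) / (9 * R0 ^ 4 / 16) := by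
      rw [hLa]; ring
    rw [e, le_div_iff₀ (by positivity)]
    linarith
  have hys : ph y ≤ La / 4 * ‖y - x0‖ ^ 2 := by
    have hx0b : x0 ∈ Metric.ball x0 (R0 / 2) := Metric.mem_ball_self (by linarith)
    have hkey : ∀ t > 0, Real.sqrt (ph y) ≤ Real.sqrt La / 2 * ‖y - x0‖ + t := by
      intro t ht0
      have hpp : ∀ z ∈ Metric.ball x0 (R0 / 2), 0 < ph z + t ^ 2 := fun z hz => by
        have := hph0 z (Metric.ball_subset_closedBall (Metric.ball_subset_ball (by linarith) hz))
        positivity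
      have hder : ∀ z ∈ Metric.ball x0 (R0 / 2),
          HasFDerivWithinAt (fun w => Real.sqrt (ph w + t ^ 2))
            ((1 / (2 * Real.sqrt (ph z + t ^ 2))) • fderiv ℝ ph z) (Metric.ball x0 (R0 / 2)) z :=
        fun z hz => (((dd_diff hphs z).hasFDerivAt.add_const (t ^ 2)).sqrt
          (hpp z hz).ne').hasFDerivWithinAt
      have hbd : ∀ z ∈ Metric.ball x0 (R0 / 2),
          ‖(1 / (2 * Real.sqrt (ph z + t ^ 2))) • fderiv ℝ ph z‖ ≤ Real.sqrt La / 2 := by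
        intro z hz
        have hq : 0 < Real.sqrt (ph z + t ^ 2) := Real.sqrt_pos.2 (hpp z hz)
        rw [norm_smul, Real.norm_eq_abs, abs_of_pos (by positivity)]
        have h1 : ‖fderiv ℝ ph z‖ ≤ Real.sqrt La * Real.sqrt (ph z + t ^ 2) := by
          rw [← Real.sqrt_mul hLa0]
          apply Real.le_sqrt_of_sq_le
          have := hg z hz
          have h2 : 0 ≤ La * t ^ 2 := by positivity
          change gsq ph z ≤ _
          linarith
        rw [div_mul_eq_mul_div, one_mul, div_le_div_iff₀ (by positivity) (by norm_num)]
        linarith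
      have := (convex_ball x0 (R0 / 2)).norm_image_sub_le_of_norm_hasFDerivWithin_le hder hbd hx0b hy
      have e0 : ph x0 = 0 := by rw [hphe]; simp
      rw [e0, zero_add, Real.sqrt_sq ht0.le, Real.norm_eq_abs] at this
      have h3 : Real.sqrt (ph y) ≤ Real.sqrt (ph y + t ^ 2) :=
        Real.sqrt_le_sqrt (by linarith [sq_nonneg t])
      linarith [le_abs_self (Real.sqrt (ph y + t ^ 2) - t)]
    have h1 := le_of_forall_pos_le_add hkey
    have hy0 := hph0 y (Metric.ball_subset_closedBall (Metric.ball_subset_ball (by linarith) hy))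
    have h2 := pow_le_pow_left₀ (Real.sqrt_nonneg _) h1 2
    rw [Real.sq_sqrt hy0, mul_pow, div_pow, Real.sq_sqrt hLa0] at h2
    linarith
  rw [hphe] at hys
  have h1 := ht y (Metric.ball_subset_closedBall (Metric.ball_subset_ball (by linarith) hy))
  have h2 : 0 ≤ K * ‖y - x0‖ ^ 2 := by positivity
  have h3 : 0 ≤ La / 4 * ‖y - x0‖ ^ 2 := by positivity
  rw [abs_le]
  constructor <;> linarith

end grad2
end SY
namespace SY
open scoped ContDiff
open Finset MeasureTheory

section contact
variable {n : ℕ}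

/-- points where `u` is touched from above by a paraboloid -/
def contact (u : EuclideanSpace ℝ (Fin n) → ℝ) (K R ep : ℝ) : Set (EuclideanSpace ℝ (Fin n)) :=
  {x | x ∈ Metric.closedBall 0 ep ∧ ∀ z ∈ Metric.closedBall (0 : EuclideanSpace ℝ (Fin n)) R,
    u z ≤ u x + fderiv ℝ u x (z - x) + K * ‖z - x‖ ^ 2}

variable {u : EuclideanSpace ℝ (Fin n) → ℝ} {K R ep : ℝ}

lemma contact_closed (hu : ContDiff ℝ ∞ u) : IsClosed (contact u K R ep) := by
  have h1 := hu.continuous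
  have h2 := hu.continuous_fderiv (by simp)
  have : contact u K R ep = Metric.closedBall 0 ep ∩
      ⋂ z ∈ Metric.closedBall (0 : EuclideanSpace ℝ (Fin n)) R,
        {x | u z ≤ u x + fderiv ℝ u x (z - x) + K * ‖z - x‖ ^ 2} := by
    ext x; simp [contact]
  rw [this]
  refine Metric.isClosed_closedBall.inter (isClosed_biInter fun z _ => ?_)
  exact isClosed_le continuous_const (by fun_prop)

/-- the gradient map -/
noncomputable def gmap (u : EuclideanSpace ℝ (Fin n) → ℝ) (K : ℝ) (x : EuclideanSpace ℝ (Fin n)) :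
    EuclideanSpace ℝ (Fin n) :=
  x - (1 / (2 * K)) • (InnerProductSpace.toDual ℝ (EuclideanSpace ℝ (Fin n))).symm (fderiv ℝ u x)

lemma gmap_deriv (hu : ContDiff ℝ ∞ u) (x : EuclideanSpace ℝ (Fin n)) :
    HasFDerivAt (gmap u K) (ContinuousLinearMap.id ℝ _ - (1 / (2 * K)) •
      (hop u x).toContinuousLinearMap) x := by
  have h1 : HasFDerivAt (fderiv ℝ u) (fderiv ℝ (fderiv ℝ u) x) x :=
    ((hu.fderiv_right (m := ∞) (by simp)).differentiable (by simp) x).hasFDerivAt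
  have h2 := ((InnerProductSpace.toDual ℝ
    (EuclideanSpace ℝ (Fin n))).symm.toContinuousLinearEquiv.toContinuousLinearMap).hasFDerivAt.comp x h1
  have h3 := (hasFDerivAt_id x).sub (h2.const_smul (1 / (2 * K)))
  exact h3

lemma hop_det (hu : ContDiff ℝ ∞ u) {x : EuclideanSpace ℝ (Fin n)} (hK : 0 < K)
    (hpos : 0 < lap u x) (hle : ∀ v : EuclideanSpace ℝ (Fin n), ‖v‖ = 1 → dd v (dd v u) x ≤ 2 * K) :
    |(ContinuousLinearMap.id ℝ _ - (1 / (2 * K)) • (hop u x).toContinuousLinearMap).det| ≤ 1 := by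
  obtain ⟨b, lam, hb⟩ := exists_eigen hu x
  have hd : (ContinuousLinearMap.id ℝ _ - (1 / (2 * K)) • (hop u x).toContinuousLinearMap).det =
      ∏ i, (1 - lam i / (2 * K)) := by
    rw [ContinuousLinearMap.det, ← LinearMap.det_toMatrix b.toBasis, ← Matrix.det_diagonal]
    congr 1
    ext i j
    rw [LinearMap.toMatrix_apply, b.coe_toBasis, b.coe_toBasis_repr_apply, b.repr_apply_apply]
    simp only [ContinuousLinearMap.coe_coe, ContinuousLinearMap.sub_apply,
      ContinuousLinearMap.smul_apply, ContinuousLinearMap.id_apply,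
      LinearMap.coe_toContinuousLinearMap']
    rw [inner_sub_right, real_inner_smul_right, real_inner_comm, real_inner_comm _ (b i),
      hop_inner hu, hb, orthonormal_iff_ite.1 b.orthonormal]
    by_cases h : i = j
    · subst h; simp; ring
    · simp [h, Ne.symm h]
  rw [hd]
  have h0 : ∀ i, 0 ≤ 1 - lam i / (2 * K) := fun i => by
    have := hle (b i) (b.orthonormal.norm_eq_one i)
    rw [hb] at this
    simp only [if_true] at this
    rw [sub_nonneg, div_le_one (by positivity)]; exact this
  rw [abs_of_nonneg (prod_nonneg fun i _ => h0 i)]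
  calc ∏ i, (1 - lam i / (2 * K)) ≤ ∏ i, Real.exp (- (lam i / (2 * K))) :=
        prod_le_prod (fun i _ => h0 i) fun i _ => by
          linarith [Real.add_one_le_exp (- (lam i / (2 * K)))]
    _ = Real.exp (- (lap u x / (2 * K))) := by
        rw [← Real.exp_sum, lap_eq hu x b]
        congr 1
        rw [sum_neg_distrib, sum_div]
        simp [hb]
    _ ≤ 1 := by
        rw [Real.exp_le_one_iff, neg_nonpos]; positivity

lemma contact_meas {c R1 M : ℝ} (S : Sol c R1 M u) (hK : 0 < K) (hR : R < R1) (hep : ep < R)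
    (hep0 : 0 < ep) (hKe : 2 * M ≤ K * (ep / 2) ^ 2) :
    volume (Metric.ball (0 : EuclideanSpace ℝ (Fin n)) (ep / 2)) ≤ volume (contact u K R ep) := by
  have hu := S.smooth
  have hsub : Metric.closedBall (0 : EuclideanSpace ℝ (Fin n)) R ⊆ Metric.ball 0 R1 :=
    Metric.closedBall_subset_ball hR
  have himg : Metric.ball (0 : EuclideanSpace ℝ (Fin n)) (ep / 2) ⊆ gmap u K '' contact u K R ep := by
    intro y hy
    rw [mem_ball_zero_iff] at hy
    have hyR : y ∈ Metric.closedBall (0 : EuclideanSpace ℝ (Fin n)) R := by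
      rw [mem_closedBall_zero_iff]; linarith
    have hcont := hu.continuous
    obtain ⟨x, hx, hmax⟩ := (isCompact_closedBall (0 : EuclideanSpace ℝ (Fin n)) R).exists_isMaxOn
      ⟨y, hyR⟩ (f := fun z => u z - K * ‖z - y‖ ^ 2) (by fun_prop)
    have h1 : u y - K * ‖y - y‖ ^ 2 ≤ u x - K * ‖x - y‖ ^ 2 := hmax hyR
    have h2 := S.bd0 x (hsub hx)
    have h3 := S.bd0 y (hsub hyR)
    simp only [sub_self, norm_zero] at h1
    have h4 : K * ‖x - y‖ ^ 2 ≤ K * (ep / 2) ^ 2 := by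
      linarith [(abs_le.1 h2).2, (abs_le.1 h3).1]
    have h5 : ‖x - y‖ ≤ ep / 2 :=
      le_of_sq_le_sq (le_of_mul_le_mul_left h4 hK) (by positivity)
    have h6 : ‖x‖ < ep := by
      have := norm_add_le (x - y) y
      rw [sub_add_cancel] at this; linarith
    have hxin : x ∈ Metric.ball (0 : EuclideanSpace ℝ (Fin n)) R := by
      rw [mem_ball_zero_iff]; linarith
    have hloc : IsLocalMax (fun z => u z - K * ‖z - y‖ ^ 2) x := by
      filter_upwards [Metric.isOpen_ball.mem_nhds hxin] with w hw
      exact hmax (Metric.ball_subset_closedBall hw)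
    have hfd : fderiv ℝ u x = (2 * K) • innerSL ℝ (x - y) := by
      have hd1 : HasFDerivAt (fun z => u z - K * ‖z - y‖ ^ 2)
          (fderiv ℝ u x - K • (2 • (innerSL ℝ (x - y)).comp (ContinuousLinearMap.id ℝ _))) x := by
        have := ((hasFDerivAt_id x).sub_const y).norm_sq.const_mul K
        exact (dd_diff hu x).hasFDerivAt.sub this
      have := hloc.hasFDerivAt_eq_zero hd1
      rw [sub_eq_zero] at this
      rw [this]
      ext v; simp; ring
    refine ⟨x, ⟨by rw [mem_closedBall_zero_iff]; exact h6.le, fun z hz => ?_⟩, ?_⟩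
    · have h7 : u z - K * ‖z - y‖ ^ 2 ≤ u x - K * ‖x - y‖ ^ 2 := hmax hz
      rw [hfd]
      have e : z - y = (x - y) + (z - x) := by abel
      rw [e, norm_add_sq_real] at h7
      simp only [ContinuousLinearMap.smul_apply, innerSL_apply_apply, smul_eq_mul]
      linarith
    · unfold gmap
      rw [hfd]
      have : (InnerProductSpace.toDual ℝ (EuclideanSpace ℝ (Fin n))).symm
          ((2 * K) • innerSL ℝ (x - y)) = (2 * K) • (x - y) := by
        rw [LinearIsometryEquiv.symm_apply_eq]
        ext v; simp
      rw [this, smul_smul, one_div, inv_mul_cancel₀ (by positivity), one_smul]; abel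
  have hdet : ∀ x ∈ contact u K R ep, |(ContinuousLinearMap.id ℝ _ - (1 / (2 * K)) •
      (hop u x).toContinuousLinearMap).det| ≤ 1 := by
    rintro x ⟨hx, ht⟩
    rw [mem_closedBall_zero_iff] at hx
    have hxin : x ∈ Metric.ball (0 : EuclideanSpace ℝ (Fin n)) R := by
      rw [mem_ball_zero_iff]; linarith
    refine hop_det hu hK (S.pos x (hsub (Metric.ball_subset_closedBall hxin))) fun v hv => ?_
    have hloc : IsLocalMax (fun z => u z + (-1) * qd (u x) (fderiv ℝ u x) (ipB n (2 * K)) x z) x := by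
      filter_upwards [Metric.isOpen_ball.mem_nhds hxin] with w hw
      have := ht w (Metric.ball_subset_closedBall hw)
      rw [qd_ip, qd_ip]
      simp only [sub_self, map_zero, norm_zero]
      linarith
    have := (max_jets hloc v ((J.of_smooth hu x v).add
      ((J.of_smooth qd_smooth x v).smul (-1)))).2
    rw [qd_dd2 (ipB_symm _)] at this
    simp only [ipB_apply, real_inner_self_eq_norm_sq, hv] at this
    linarith
  calc volume (Metric.ball (0 : EuclideanSpace ℝ (Fin n)) (ep / 2))
      ≤ volume (gmap u K '' contact u K R ep) := measure_mono himg
    _ ≤ ∫⁻ x in contact u K R ep, ENNReal.ofReal |(ContinuousLinearMap.id ℝ _ - (1 / (2 * K)) •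
        (hop u x).toContinuousLinearMap).det| :=
        addHaar_image_le_lintegral_abs_det_fderiv volume (contact_closed hu).measurableSet
          fun x _ => (gmap_deriv hu x).hasFDerivWithinAt
    _ ≤ ∫⁻ x in contact u K R ep, 1 := by
        apply setLIntegral_mono' (contact_closed hu).measurableSet
        intro x hx
        rw [← ENNReal.ofReal_one]
        exact ENNReal.ofReal_le_ofReal (hdet x hx)
    _ = volume (contact u K R ep) := by simp

end contact
end SY
namespace SY
open Finset MeasureTheory Filter Topology

section alex
variable {n : ℕ}

lemma p_lip {w : EuclideanSpace ℝ (Fin n) → ℝ} {A : Set (EuclideanSpace ℝ (Fin n))} {C r0 ep : ℝ}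
    (hC : 0 ≤ C) (hA : A ⊆ Metric.closedBall 0 ep) (hep : 8 * ep ≤ r0) (hr0 : 0 < r0)
    {p : EuclideanSpace ℝ (Fin n) → EuclideanSpace ℝ (Fin n) →L[ℝ] ℝ}
    (hp : ∀ x ∈ A, ∀ y ∈ Metric.ball x r0, |w y - w x - p x (y - x)| ≤ C * ‖y - x‖ ^ 2) :
    ∀ x ∈ A, ∀ y ∈ A, ‖p x - p y‖ ≤ 6 * C * ‖x - y‖ := by
  intro x hx y hy
  have hx1 := hA hx
  have hy1 := hA hy
  rw [mem_closedBall_zero_iff] at hx1 hy1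
  have hd : ‖x - y‖ ≤ 2 * ep := by
    have := norm_sub_le x y; linarith
  rcases (norm_nonneg (x - y)).eq_or_lt with h0 | h0
  · have : x = y := by rw [← sub_eq_zero, ← norm_eq_zero]; exact h0.symm
    subst this; simp
  set d := ‖x - y‖ with hdd
  have hdx : ‖y - x‖ = d := norm_sub_rev y x
  apply ContinuousLinearMap.opNorm_le_of_unit_norm (by positivity)
  intro v hv
  have hdv : ‖d • v‖ = d := by rw [norm_smul, hv, Real.norm_eq_abs, abs_of_pos h0, mul_one]
  have hzx : ‖y + d • v - x‖ ≤ 2 * d := by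
    have : y + d • v - x = (y - x) + d • v := by abel
    rw [this]
    have := norm_add_le (y - x) (d • v)
    linarith
  have hzy : ‖y + d • v - y‖ = d := by rw [add_sub_cancel_left, hdv]
  have h1 := hp x hx (y + d • v) (by rw [mem_ball_iff_norm]; linarith)
  have h2 := hp y hy (y + d • v) (by rw [mem_ball_iff_norm]; linarith)
  have h3 := hp x hx y (by rw [mem_ball_iff_norm]; linarith)
  rw [hzy] at h2
  rw [hdx] at h3
  have h4 : ‖y + d • v - x‖ ^ 2 ≤ (2 * d) ^ 2 := pow_le_pow_left₀ (norm_nonneg _) hzx 2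
  have h5 := mul_le_mul_of_nonneg_left h4 hC
  have e1 : p x (y + d • v - x) = p x (y - x) + d * p x v := by
    have : y + d • v - x = (y - x) + d • v := by abel
    rw [this, map_add, map_smul, smul_eq_mul]
  have e2 : p y (y + d • v - y) = d * p y v := by
    rw [add_sub_cancel_left, map_smul, smul_eq_mul]
  rw [e1] at h1
  rw [e2] at h2
  rw [abs_le] at h1 h2 h3
  have h6 : |d * (p x v - p y v)| ≤ d * (6 * C * d) := by
    rw [abs_le]; constructor <;> nlinarith
  rw [abs_mul, abs_of_pos h0] at h6
  exact le_of_mul_le_mul_left h6 h0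

lemma chain_step {w : EuclideanSpace ℝ (Fin n) → ℝ} {C h t eta rho : ℝ}
    {x0 y e : EuclideanSpace ℝ (Fin n)} {p g : EuclideanSpace ℝ (Fin n) →L[ℝ] ℝ}
    {D : EuclideanSpace ℝ (Fin n) →L[ℝ] EuclideanSpace ℝ (Fin n) →L[ℝ] ℝ}
    (hC : 0 ≤ C) (hh : 0 < h) (hh1 : h ≤ 1) (ht : 0 ≤ t) (ht1 : t ≤ 1)
    (heta : 0 ≤ eta) (hy : ‖y‖ = rho)
    (he : ‖e - (x0 + t • y)‖ ≤ rho * h)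
    (hg : ‖g - p - D (e - x0)‖ ≤ eta * ‖e - x0‖)
    (h1 : |w (x0 + (t + h) • y) - w e - g (x0 + (t + h) • y - e)| ≤ C * ‖x0 + (t + h) • y - e‖ ^ 2)
    (h2 : |w (x0 + t • y) - w e - g (x0 + t • y - e)| ≤ C * ‖x0 + t • y - e‖ ^ 2) :
    |(w (x0 + (t + h) • y) - w x0 - (t + h) * p y - 1 / 2 * (t + h) ^ 2 * D y y) -
      (w (x0 + t • y) - w x0 - t * p y - 1 / 2 * t ^ 2 * D y y)| ≤
      rho ^ 2 * h ^ 2 * (5 * C + 2 * ‖D‖) + 2 * eta * rho ^ 2 * h := by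
  have hrho : 0 ≤ rho := hy ▸ norm_nonneg y
  have he' : ‖x0 + t • y - e‖ ≤ rho * h := by rw [norm_sub_rev]; exact he
  have ez : x0 + (t + h) • y - e = (x0 + t • y - e) + h • y := by rw [add_smul]; abel
  have hhy : ‖h • y‖ = rho * h := by
    rw [norm_smul, hy, Real.norm_eq_abs, abs_of_pos hh, mul_comm]
  have hz' : ‖x0 + (t + h) • y - e‖ ≤ 2 * (rho * h) := by
    rw [ez]; have := norm_add_le (x0 + t • y - e) (h • y); linarith
  have hex : ‖e - x0‖ ≤ 2 * rho := by
    have e1 : e - x0 = (e - (x0 + t • y)) + t • y := by abel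
    rw [e1]
    have := norm_add_le (e - (x0 + t • y)) (t • y)
    rw [norm_smul, hy, Real.norm_eq_abs, abs_of_nonneg ht] at this
    nlinarith
  have q1 : C * ‖x0 + (t + h) • y - e‖ ^ 2 ≤ C * (2 * (rho * h)) ^ 2 := by gcongr
  have q2 : C * ‖x0 + t • y - e‖ ^ 2 ≤ C * (rho * h) ^ 2 := by gcongr
  have eg : g (x0 + (t + h) • y - e) = g (x0 + t • y - e) + h * g y := by
    rw [ez, map_add, map_smul, smul_eq_mul]
  rw [eg] at h1
  have h3 : |g y - p y - D (e - x0) y| ≤ 2 * eta * rho ^ 2 := by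
    have := (g - p - D (e - x0)).le_opNorm y
    rw [hy] at this
    simp only [ContinuousLinearMap.sub_apply, Real.norm_eq_abs] at this
    refine this.trans ?_
    have h4 : eta * ‖e - x0‖ ≤ eta * (2 * rho) := by gcongr
    calc _ ≤ (eta * (2 * rho)) * rho := by gcongr; exact hg.trans h4
      _ = _ := by ring
  have h5 : D (e - x0) y = t * D y y + D (e - (x0 + t • y)) y := by
    have e1 : e - x0 = (e - (x0 + t • y)) + t • y := by abel
    rw [e1, map_add, map_smul]; simp; ring
  have h6 : |D (e - (x0 + t • y)) y| ≤ ‖D‖ * rho ^ 2 * h := by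
    have := D.le_opNorm₂ (e - (x0 + t • y)) y
    rw [hy, Real.norm_eq_abs] at this
    refine this.trans ?_
    calc ‖D‖ * ‖e - (x0 + t • y)‖ * rho ≤ ‖D‖ * (rho * h) * rho := by gcongr
      _ = _ := by ring
  have h7 : |D y y| ≤ ‖D‖ * rho ^ 2 := by
    have := D.le_opNorm₂ y y
    rw [hy, Real.norm_eq_abs] at this
    linarith
  have h8 : |1 / 2 * h ^ 2 * D y y| ≤ 1 / 2 * h ^ 2 * (‖D‖ * rho ^ 2) := by
    rw [abs_mul, abs_of_pos (by positivity)]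
    gcongr
  have h9 : |h * (g y - p y - t * D y y)| ≤ h * (2 * eta * rho ^ 2 + ‖D‖ * rho ^ 2 * h) := by
    rw [abs_mul, abs_of_pos hh]
    gcongr
    rw [h5] at h3
    have e1 : g y - p y - t * D y y = (g y - p y - (t * D y y + D (e - (x0 + t • y)) y))
      + D (e - (x0 + t • y)) y := by ring
    rw [e1]
    refine (abs_add_le _ _).trans ?_
    linarith
  have etot : (w (x0 + (t + h) • y) - w x0 - (t + h) * p y - 1 / 2 * (t + h) ^ 2 * D y y) -
      (w (x0 + t • y) - w x0 - t * p y - 1 / 2 * t ^ 2 * D y y) =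
      (w (x0 + (t + h) • y) - w e - (g (x0 + t • y - e) + h * g y)) -
      (w (x0 + t • y) - w e - g (x0 + t • y - e)) + h * (g y - p y - t * D y y)
      - 1 / 2 * h ^ 2 * D y y := by ring
  rw [etot]
  have h10 : 0 ≤ ‖D‖ * rho ^ 2 * h ^ 2 := by positivity
  rw [abs_le] at h1 h2 h8 h9 ⊢
  constructor <;> linarith

lemma alex {w : EuclideanSpace ℝ (Fin n) → ℝ} {A : Set (EuclideanSpace ℝ (Fin n))} {C r0 ep : ℝ}
    (hC : 0 ≤ C) (hA : A ⊆ Metric.closedBall 0 ep) (hep : 8 * ep ≤ r0) (hr0 : 0 < r0)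
    (hAm : MeasurableSet A) (hAp : 0 < volume A)
    {p : EuclideanSpace ℝ (Fin n) → EuclideanSpace ℝ (Fin n) →L[ℝ] ℝ}
    (hp : ∀ x ∈ A, ∀ y ∈ Metric.ball x r0, |w y - w x - p x (y - x)| ≤ C * ‖y - x‖ ^ 2) :
    ∃ x0 ∈ A, ∃ B : EuclideanSpace ℝ (Fin n) →L[ℝ] EuclideanSpace ℝ (Fin n) →L[ℝ] ℝ,
      (∀ v z, B v z = B z v) ∧ ∀ δ > 0, ∃ r > 0, ∀ y ∈ Metric.ball x0 r,
        |w y - qd (w x0) (p x0) B x0 y| ≤ δ * ‖y - x0‖ ^ 2 := by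
  have hlip := p_lip hC hA hep hr0 hp
  have hL : LipschitzOnWith (Real.toNNReal (6 * C)) p A := by
    apply LipschitzOnWith.of_dist_le_mul
    intro x hx y hy
    rw [dist_eq_norm, dist_eq_norm, Real.coe_toNNReal _ (by positivity)]
    exact hlip x hx y hy
  obtain ⟨G, hG, hGe⟩ := hL.extend_finite_dimension
  have ae1 : ∀ᵐ x ∂(volume.restrict A), DifferentiableAt ℝ G x :=
    ae_restrict_of_ae hG.ae_differentiableAt
  have ae2 : ∀ᵐ x ∂(volume.restrict A), ∀ N : ℕ, ∀ᶠ y in 𝓝[≠] x,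
      (A ∩ Metric.closedBall y (‖y - x‖ / (N + 1))).Nonempty := by
    rw [ae_all_iff]
    intro N
    filter_upwards [IsUnifLocDoublingMeasure.ae_tendsto_measure_inter_div
      (volume : Measure (EuclideanSpace ℝ (Fin n))) A ((N:ℝ) + 1)] with x hx
    have hN : (0:ℝ) < N + 1 := by positivity
    have ht : Tendsto (fun y => ‖y - x‖ / ((N:ℝ) + 1)) (𝓝[≠] x) (𝓝[>] 0) := by
      apply tendsto_nhdsWithin_of_tendsto_nhds_of_eventually_within
      · have : Continuous fun y => ‖y - x‖ / ((N:ℝ) + 1) := by fun_prop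
        have := this.tendsto x
        simp only [sub_self, norm_zero, zero_div] at this
        exact this.mono_left nhdsWithin_le_nhds
      · filter_upwards [self_mem_nhdsWithin] with y hy
        have : 0 < ‖y - x‖ := norm_pos_iff.2 (sub_ne_zero.2 hy)
        exact div_pos this hN
    have h1 := hx (fun y => y) (fun y => ‖y - x‖ / ((N:ℝ) + 1)) ht (Eventually.of_forall fun y => by
      rw [mul_div_cancel₀ _ hN.ne', mem_closedBall_iff_norm, norm_sub_rev])
    have h2 := h1.eventually (lt_mem_nhds (by norm_num : (0:ENNReal) < 1))
    filter_upwards [h2] with y hy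
    by_contra hne
    rw [Set.not_nonempty_iff_eq_empty] at hne
    rw [hne] at hy; simp at hy
  have ae3 : ∀ᵐ x ∂(volume.restrict A), x ∈ A := ae_restrict_mem hAm
  have hne : (ae (volume.restrict A)).NeBot := by
    rw [ae_neBot, Ne, Measure.restrict_eq_zero]; exact hAp.ne'
  obtain ⟨x0, hd, hden, hx0⟩ := (ae1.and (ae2.and ae3)).exists
  set D := fderiv ℝ G x0 with hD
  have hDd : HasFDerivAt G D x0 := hd.hasFDerivAt
  have hGx0 : p x0 = G x0 := hGe hx0
  refine ⟨x0, hx0, (1 / 2 : ℝ) • (D + D.flip), fun v z => by simp [add_comm], ?_⟩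
  intro δ hδ
  obtain ⟨N, hN⟩ := exists_nat_gt (2 * (5 * C + 2 * ‖D‖) / δ)
  have hN1 : (0:ℝ) < N + 1 := by positivity
  set h : ℝ := 1 / (N + 1) with hh
  have hh0 : 0 < h := by positivity
  have hh1 : h ≤ 1 := by rw [hh, div_le_one hN1]; linarith [Nat.cast_nonneg (α := ℝ) N]
  have hNh : ((N:ℝ) + 1) * h = 1 := by rw [hh]; field_simp
  have ev1 : ∀ᶠ e in 𝓝 x0, ‖G e - G x0 - D (e - x0)‖ ≤ δ / 4 * ‖e - x0‖ :=
    (hDd.isLittleO).def (by positivity)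
  obtain ⟨r1, hr1, H1⟩ := Metric.eventually_nhds_iff_ball.1 ev1
  have ev2 := hden N
  rw [eventually_nhdsWithin_iff] at ev2
  obtain ⟨r2, hr2, H2⟩ := Metric.eventually_nhds_iff_ball.1 ev2
  refine ⟨min (r0 / 2) (min (r1 / 2) r2), by positivity, ?_⟩
  intro y' hy'
  obtain ⟨y, rfl⟩ : ∃ y, y' = x0 + y := ⟨y' - x0, by abel⟩
  rw [mem_ball_iff_norm, add_sub_cancel_left, lt_min_iff, lt_min_iff] at hy'
  obtain ⟨hy0, hy1, hy2⟩ := hy'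
  set rho := ‖y‖ with hrho
  have hrho0 : 0 ≤ rho := norm_nonneg y
  have hstep : ∀ t : ℝ, 0 ≤ t → t ≤ 1 →
      |(w (x0 + (t + h) • y) - w x0 - (t + h) * p x0 y - 1 / 2 * (t + h) ^ 2 * D y y) -
      (w (x0 + t • y) - w x0 - t * p x0 y - 1 / 2 * t ^ 2 * D y y)| ≤
      rho ^ 2 * h ^ 2 * (5 * C + 2 * ‖D‖) + 2 * (δ / 4) * rho ^ 2 * h := by
    intro t ht ht1
    have hty : ‖t • y‖ ≤ rho := by
      rw [norm_smul, Real.norm_eq_abs, abs_of_nonneg ht]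
      exact mul_le_of_le_one_left hrho0 ht1
    obtain ⟨e, heA, he⟩ : ∃ e ∈ A, ‖e - (x0 + t • y)‖ ≤ rho * h := by
      by_cases hz : t • y = 0
      · exact ⟨x0, hx0, by rw [hz]; simp; positivity⟩
      · obtain ⟨e, he1, he2⟩ := H2 (x0 + t • y)
          (by rw [mem_ball_iff_norm, add_sub_cancel_left]; linarith) (by simpa using hz)
        refine ⟨e, he1, ?_⟩
        rw [mem_closedBall_iff_norm, add_sub_cancel_left] at he2
        refine he2.trans ?_
        rw [div_eq_mul_one_div]
        gcongr
    have hrh : rho * h ≤ rho := mul_le_of_le_one_right hrho0 hh1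
    have he' : ‖x0 + t • y - e‖ ≤ rho * h := by rw [norm_sub_rev]; exact he
    have hzb : ‖x0 + (t + h) • y - e‖ ≤ rho * h + rho * h := by
      have ez : x0 + (t + h) • y - e = (x0 + t • y - e) + h • y := by rw [add_smul]; abel
      rw [ez]
      have h1 := norm_add_le (x0 + t • y - e) (h • y)
      rw [norm_smul, Real.norm_eq_abs, abs_of_pos hh0, mul_comm h] at h1
      linarith
    refine chain_step (g := p e) (e := e) hC hh0 hh1 ht ht1 (by positivity) rfl he ?_
      (hp e heA _ (by rw [mem_ball_iff_norm]; linarith))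
      (hp e heA _ (by rw [mem_ball_iff_norm]; linarith))
    rw [hGe heA, hGx0]
    apply H1
    rw [mem_ball_iff_norm]
    have e1 : e - x0 = (e - (x0 + t • y)) + t • y := by abel
    rw [e1]
    have := norm_add_le (e - (x0 + t • y)) (t • y)
    linarith
  set kap := rho ^ 2 * h ^ 2 * (5 * C + 2 * ‖D‖) + 2 * (δ / 4) * rho ^ 2 * h with hkap
  have hchain : ∀ i : ℕ, i ≤ N + 1 →
      |w (x0 + (i * h) • y) - w x0 - (i * h) * p x0 y - 1 / 2 * (i * h) ^ 2 * D y y| ≤ i * kap := by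
    intro i
    induction i with
    | zero => intro _; simp
    | succ i ih =>
      intro hi
      have h1 := ih (by omega)
      have hi1 : (i:ℝ) * h ≤ 1 := by
        rw [← hNh]
        have : (i:ℝ) ≤ N + 1 := by exact_mod_cast (by omega : i ≤ N + 1)
        gcongr
      have h2 := hstep (i * h) (by positivity) hi1
      have e1 : ((i + 1 : ℕ) : ℝ) * h = i * h + h := by push_cast; ring
      rw [e1]
      push_cast
      have := abs_sub_abs_le_abs_sub
        (w (x0 + (i * h + h) • y) - w x0 - (i * h + h) * p x0 y - 1 / 2 * (i * h + h) ^ 2 * D y y)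
        (w (x0 + (i * h : ℝ) • y) - w x0 - i * h * p x0 y - 1 / 2 * (i * h) ^ 2 * D y y)
      linarith
  have hfin := hchain (N + 1) le_rfl
  have e1 : ((N + 1 : ℕ) : ℝ) * h = 1 := by push_cast; exact hNh
  rw [e1, one_smul] at hfin
  have eq : qd (w x0) (p x0) ((1 / 2 : ℝ) • (D + D.flip)) x0 (x0 + y) =
      w x0 + p x0 y + 1 / 2 * D y y := by
    unfold qd; simp; ring
  rw [eq, add_sub_cancel_left]
  have hk : ((N + 1 : ℕ) : ℝ) * kap ≤ δ * rho ^ 2 := by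
    have e2 : ((N + 1 : ℕ) : ℝ) * kap =
        (((N + 1 : ℕ) : ℝ) * h) * (rho ^ 2 * (h * (5 * C + 2 * ‖D‖)) + δ / 2 * rho ^ 2) := by
      rw [hkap]; ring
    rw [e2, e1, one_mul]
    have h3 : h * (5 * C + 2 * ‖D‖) ≤ δ / 2 := by
      rw [hh, div_mul_eq_mul_div, one_mul, div_le_iff₀ hN1]
      rw [div_lt_iff₀ hδ] at hN
      linarith
    have := mul_le_mul_of_nonneg_left h3 (sq_nonneg rho)
    linarith
  have e3 : w (x0 + y) - (w x0 + p x0 y + 1 / 2 * D y y) =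
    w (x0 + y) - w x0 - 1 * p x0 y - 1 / 2 * 1 ^ 2 * D y y := by ring
  rw [e3]
  exact hfin.trans hk

end alex
end SY
namespace SY
open scoped ContDiff
open Finset Filter Topology

section visc
variable {n : ℕ}

/-- trace of a form -/
noncomputable def tB (B : EuclideanSpace ℝ (Fin n) →L[ℝ] EuclideanSpace ℝ (Fin n) →L[ℝ] ℝ) : ℝ :=
  ∑ i, B (EuclideanSpace.basisFun (Fin n) ℝ i) (EuclideanSpace.basisFun (Fin n) ℝ i)

/-- squared Frobenius norm of a form -/
noncomputable def fB (B : EuclideanSpace ℝ (Fin n) →L[ℝ] EuclideanSpace ℝ (Fin n) →L[ℝ] ℝ) : ℝ :=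
  ∑ i, ∑ j, (B (EuclideanSpace.basisFun (Fin n) ℝ i) (EuclideanSpace.basisFun (Fin n) ℝ j)) ^ 2

variable {B : EuclideanSpace ℝ (Fin n) →L[ℝ] EuclideanSpace ℝ (Fin n) →L[ℝ] ℝ}

lemma lap_qd (hB : ∀ v w, B v w = B w v) {k : ℝ} {l : EuclideanSpace ℝ (Fin n) →L[ℝ] ℝ}
    {x0 x : EuclideanSpace ℝ (Fin n)} : lap (qd k l B x0) x = tB B := by
  unfold lap tB; simp only [qd_dd2 hB]

lemma frob_qd (hB : ∀ v w, B v w = B w v) {k : ℝ} {l : EuclideanSpace ℝ (Fin n) →L[ℝ] ℝ}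
    {x0 x : EuclideanSpace ℝ (Fin n)} : frob (qd k l B x0) x = fB B := by
  unfold frob fB; simp only [qd_dd2 hB]

lemma tB_eq (hB : ∀ v w, B v w = B w v)
    (b : OrthonormalBasis (Fin n) ℝ (EuclideanSpace ℝ (Fin n))) : tB B = ∑ i, B (b i) (b i) := by
  rw [← lap_qd hB (k := 0) (l := 0) (x0 := 0) (x := 0), lap_eq qd_smooth 0 b]
  simp only [qd_dd2 hB]

lemma fB_eq (hB : ∀ v w, B v w = B w v)
    (b : OrthonormalBasis (Fin n) ℝ (EuclideanSpace ℝ (Fin n))) :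
    fB B = ∑ i, ∑ j, (B (b i) (b j)) ^ 2 := by
  rw [← frob_qd hB (k := 0) (l := 0) (x0 := 0) (x := 0), frob_eq qd_smooth 0 b]
  simp only [qd_dd2 hB]

lemma tB_add (t : ℝ) : tB (B + ipB n t) = tB B + n * t := by
  unfold tB
  simp [ipB_apply, sum_add_distrib, -EuclideanSpace.basisFun_apply]

lemma fB_add (t : ℝ) : fB (B + ipB n t) = fB B + 2 * t * tB B + n * t ^ 2 := by
  unfold fB tB
  have h : ∀ i j, ((B + ipB n t) (EuclideanSpace.basisFun (Fin n) ℝ i)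
      (EuclideanSpace.basisFun (Fin n) ℝ j)) ^ 2 =
      (B (EuclideanSpace.basisFun (Fin n) ℝ i) (EuclideanSpace.basisFun (Fin n) ℝ j)) ^ 2
      + if i = j then 2 * t * B (EuclideanSpace.basisFun (Fin n) ℝ i)
        (EuclideanSpace.basisFun (Fin n) ℝ i) + t ^ 2 else 0 := by
    intro i j
    rw [ContinuousLinearMap.add_apply, ContinuousLinearMap.add_apply, ipB_apply,
      OrthonormalBasis.inner_eq_ite]
    by_cases hij : i = j
    · subst hij; simp only [if_true]; ring
    · simp [hij]
  simp only [h, sum_add_distrib, sum_ite_eq, mem_univ, if_true, mul_sum]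
  simp; ring

lemma psd_minor {P : EuclideanSpace ℝ (Fin n) →  EuclideanSpace ℝ (Fin n) → ℝ}
    {v w : EuclideanSpace ℝ (Fin n)}
    (h : ∀ t : ℝ, 0 ≤ P w w * (t * t) + 2 * P v w * t + P v v) : P v w ^ 2 ≤ P v v * P w w := by
  have := discrim_le_zero h
  unfold discrim at this
  linarith

lemma mono {c R M : ℝ} {u : EuclideanSpace ℝ (Fin n) → ℝ} (S : Sol c R M u) (hc : 0 < c)
    {x : EuclideanSpace ℝ (Fin n)} (hn : n = 3 ∨ n = 4)
    (hx : x ∈ Metric.ball (0 : EuclideanSpace ℝ (Fin n)) R) (hB : ∀ v w, B v w = B w v)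
    (hle : ∀ v, dd v (dd v u) x ≤ B v v) : 0 < tB B ∧ 2 * c ≤ tB B ^ 2 - fB B := by
  have hu := S.smooth
  obtain ⟨b, lam, F⟩ := exists_frame hn hc S hx
  set P : EuclideanSpace ℝ (Fin n) → EuclideanSpace ℝ (Fin n) → ℝ :=
    fun v w => B v w - fderiv ℝ (fderiv ℝ u) x v w with hP
  have hle' : ∀ v, 0 ≤ P v v := fun v => by
    have := hle v
    rw [dd_dd hu] at this
    simp only [hP]; linarith
  have hPb : ∀ i j, B (b i) (b j) = (if i = j then lam i else 0) + P (b i) (b j) := fun i j => by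
    have := F.diag i j
    rw [dd_dd hu] at this
    simp only [hP]; rw [← this]; ring
  have hsymm : ∀ v w, P v w = P w v := fun v w => by
    simp only [hP]
    rw [hB v w, ← dd_dd hu, ← dd_dd hu, dd_comm hu]
  have hmin : ∀ v w, P v w ^ 2 ≤ P v v * P w w := fun v w => by
    apply psd_minor
    intro t
    have h1 := hle' (v + t • w)
    have e : P (v + t • w) (v + t • w) = P v v + t * P v w + t * P w v + t * t * P w w := by
      simp only [hP, map_add, map_smul, ContinuousLinearMap.add_apply,
        ContinuousLinearMap.smul_apply, smul_eq_mul]; ring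
    rw [e, hsymm w v] at h1
    linarith
  have htr : tB B = lap u x + ∑ i, P (b i) (b i) := by
    rw [tB_eq hB b, ← F.sum, ← sum_add_distrib]
    exact sum_congr rfl fun i _ => by rw [hPb]; simp
  have hfr : fB B = ∑ i, lam i ^ 2 + 2 * ∑ i, lam i * P (b i) (b i)
      + ∑ i, ∑ j, P (b i) (b j) ^ 2 := by
    rw [fB_eq hB b, mul_sum, ← sum_add_distrib, ← sum_add_distrib]
    refine sum_congr rfl fun i _ => ?_
    have h : ∀ j, B (b i) (b j) ^ 2 = (if i = j then lam i ^ 2 + 2 * (lam i * P (b i) (b i)) else 0)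
        + P (b i) (b j) ^ 2 := fun j => by
      rw [hPb]
      by_cases hij : i = j
      · subst hij; simp only [if_true]; ring
      · simp [hij]
    simp only [h, sum_add_distrib, sum_ite_eq, mem_univ, if_true]
  have htP : 0 ≤ ∑ i, P (b i) (b i) := sum_nonneg fun i _ => hle' _
  refine ⟨by rw [htr]; linarith [F.pos], ?_⟩
  have h1 : ∑ i, ∑ j, P (b i) (b j) ^ 2 ≤ (∑ i, P (b i) (b i)) ^ 2 := by
    rw [pow_two, sum_mul_sum]
    exact sum_le_sum fun i _ => sum_le_sum fun j _ => hmin _ _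
  have h2 : 0 ≤ ∑ i, (lap u x - lam i) * P (b i) (b i) :=
    sum_nonneg fun i _ => mul_nonneg (F.f_pos hc i).le (hle' _)
  have h3 : ∑ i, (lap u x - lam i) * P (b i) (b i) =
      lap u x * ∑ i, P (b i) (b i) - ∑ i, lam i * P (b i) (b i) := by
    rw [mul_sum, ← sum_sub_distrib]; exact sum_congr rfl fun i _ => by ring
  have h4 := F.sq
  rw [htr, hfr]
  nlinarith

lemma add_symm (hB : ∀ v w, B v w = B w v) (t : ℝ) (v w : EuclideanSpace ℝ (Fin n)) :
    (B + ipB n t) v w = (B + ipB n t) w v := by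
  rw [ContinuousLinearMap.add_apply, ContinuousLinearMap.add_apply, ContinuousLinearMap.add_apply,
    ContinuousLinearMap.add_apply, hB, ipB_symm]

lemma qd_add (k t : ℝ) (l : EuclideanSpace ℝ (Fin n) →L[ℝ] ℝ) (x0 x : EuclideanSpace ℝ (Fin n)) :
    qd k l (B + ipB n (2 * t)) x0 x = qd k l B x0 x + t * ‖x - x0‖ ^ 2 := by
  unfold qd
  rw [ContinuousLinearMap.add_apply, ContinuousLinearMap.add_apply, ipB_apply,
    real_inner_self_eq_norm_sq]; ring

variable {c R R' M : ℝ} {U : ℕ → EuclideanSpace ℝ (Fin n) → ℝ} {w : EuclideanSpace ℝ (Fin n) → ℝ}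
  {x0 : EuclideanSpace ℝ (Fin n)} {p : EuclideanSpace ℝ (Fin n) →L[ℝ] ℝ}

lemma visc (hn : n = 3 ∨ n = 4) (hc : 0 < c) (hU : ∀ k, Sol c R M (U k))
    (hR' : R' < R)
    (hconv : ∀ e > 0, ∃ N, ∀ k ≥ N, ∀ y ∈ Metric.closedBall (0 : EuclideanSpace ℝ (Fin n)) R',
      |U k y - w y| ≤ e) (hx0 : ‖x0‖ < R') (hB : ∀ v w, B v w = B w v)
    (hexp : ∀ δ > 0, ∃ r > 0, ∀ y ∈ Metric.ball x0 r, |w y - qd (w x0) p B x0 y| ≤ δ * ‖y - x0‖ ^ 2) :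
    0 ≤ tB B ∧ 2 * c ≤ tB B ^ 2 - fB B := by
  have key : ∀ δ > 0, 0 < tB (B + ipB n (2 * δ)) ∧
      2 * c ≤ tB (B + ipB n (2 * δ)) ^ 2 - fB (B + ipB n (2 * δ)) := by
    intro δ hδ
    obtain ⟨r1, hr1, H⟩ := hexp (δ / 4) (by positivity)
    obtain ⟨r, hr, hrr1, hrR⟩ : ∃ r > 0, r < r1 ∧ ‖x0‖ + r < R' := by
      refine ⟨min (r1 / 2) ((R' - ‖x0‖) / 2), ?_, ?_, ?_⟩
      · have : 0 < R' - ‖x0‖ := by linarith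
        positivity
      · exact lt_of_le_of_lt (min_le_left _ _) (by linarith)
      · have := min_le_right (r1 / 2) ((R' - ‖x0‖) / 2); linarith
    obtain ⟨N, hN⟩ := hconv (δ * r ^ 2 / 8) (by positivity)
    have hsub : ∀ z ∈ Metric.closedBall x0 r, z ∈ Metric.closedBall (0 : EuclideanSpace ℝ (Fin n)) R' := by
      intro z hz
      rw [mem_closedBall_iff_norm] at hz
      rw [mem_closedBall_zero_iff]
      have := norm_add_le (z - x0) x0
      rw [sub_add_cancel] at this; linarith
    have hu := (hU N).smooth
    set B' := B + ipB n (2 * δ) with hB'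
    have hx0r : x0 ∈ Metric.ball x0 r := Metric.mem_ball_self hr
    obtain ⟨z, hz, _, hloc⟩ := exists_loc_max (P := fun z => U N z + (-1) * qd (w x0) p B' x0 z)
      (x0 := x0) (r := r) (y := x0) (by
        have h1 := hu.continuous
        have h2 := (qd_smooth (k := w x0) (l := p) (B := B') (x0 := x0)).continuous
        fun_prop) hx0r (by
        intro z hz
        rw [hB', qd_add, qd_add]
        have hzc : z ∈ Metric.closedBall x0 r := Metric.sphere_subset_closedBall hz
        have h1 := hN N le_rfl z (hsub z hzc)
        have h2 := hN N le_rfl x0 (hsub x0 (Metric.ball_subset_closedBall hx0r))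
        rw [mem_sphere_iff_norm] at hz
        have h3 := H z (by rw [mem_ball_iff_norm]; linarith)
        rw [hz] at h3 ⊢
        have h4 : qd (w x0) p B x0 x0 = w x0 := by simp [qd]
        rw [h4, sub_self, norm_zero]
        rw [abs_le] at h1 h2 h3
        have : 0 < δ * r ^ 2 := by positivity
        linarith)
    have hzR : z ∈ Metric.ball (0 : EuclideanSpace ℝ (Fin n)) R :=
      Metric.closedBall_subset_ball hR' (hsub z (Metric.ball_subset_closedBall hz))
    refine mono (hU N) hc hn hzR (add_symm hB _) fun v => ?_
    have := (max_jets hloc v ((J.of_smooth hu z v).add ((J.of_smooth qd_smooth z v).smul (-1)))).2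
    rw [qd_dd2 (add_symm hB _)] at this
    linarith
  have hlim1 : Tendsto (fun δ : ℝ => tB B + n * (2 * δ)) (𝓝[>] 0) (𝓝 (tB B + n * (2 * 0))) :=
    (Continuous.tendsto (by fun_prop) 0).mono_left nhdsWithin_le_nhds
  have hlim2 : Tendsto (fun δ : ℝ => (tB B + n * (2 * δ)) ^ 2
      - (fB B + 2 * (2 * δ) * tB B + n * (2 * δ) ^ 2)) (𝓝[>] 0)
      (𝓝 ((tB B + n * (2 * 0)) ^ 2 - (fB B + 2 * (2 * 0) * tB B + n * (2 * 0) ^ 2))) :=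
    (Continuous.tendsto (by fun_prop) 0).mono_left nhdsWithin_le_nhds
  constructor
  · have := ge_of_tendsto hlim1 (b := 0) (by
      filter_upwards [self_mem_nhdsWithin] with δ hδ
      rw [← tB_add]; exact (key δ hδ).1.le)
    simpa using this
  · have := ge_of_tendsto hlim2 (b := 2 * c) (by
      filter_upwards [self_mem_nhdsWithin] with δ hδ
      rw [← tB_add, ← fB_add]; exact (key δ hδ).2)
    simpa using this

lemma local_bd (hn : n = 3 ∨ n = 4) (hc : 0 < c) (hU : ∀ k, Sol c R M (U k))
    (hR' : R' < R)
    (hconv : ∀ e > 0, ∃ N, ∀ k ≥ N, ∀ y ∈ Metric.closedBall (0 : EuclideanSpace ℝ (Fin n)) R',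
      |U k y - w y| ≤ e) (hx0 : ‖x0‖ < R') (hB : ∀ v w, B v w = B w v)
    (hexp : ∀ δ > 0, ∃ r > 0, ∀ y ∈ Metric.ball x0 r, |w y - qd (w x0) p B x0 y| ≤ δ * ‖y - x0‖ ^ 2) :
    ∃ C, ∃ r > 0, ∃ N, ∀ k ≥ N, ∀ y ∈ Metric.ball x0 r, lap (U k) y ≤ C := by
  obtain ⟨hT, hF⟩ := visc hn hc hU hR' hconv hx0 hB hexp
  have hn4 : (n:ℝ) ≤ 4 := by exact_mod_cast (by omega : n ≤ 4)
  have hn1 : (1:ℝ) ≤ n := by exact_mod_cast (by omega : 1 ≤ n)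
  have hF0 : 0 ≤ fB B := sum_nonneg fun i _ => sum_nonneg fun j _ => sq_nonneg _
  have hT0 : 0 < tB B := by
    rcases hT.eq_or_lt with h | h
    · rw [← h] at hF; linarith
    · exact h
  obtain ⟨δ, hδ, hd1, hd2⟩ : ∃ δ > 0, 8 * δ ≤ tB B ∧ 12 * δ * tB B ≤ 2 * c := by
    refine ⟨min (tB B / 8) (c / (6 * tB B)), by positivity, ?_, ?_⟩
    · have := min_le_left (tB B / 8) (c / (6 * tB B)); linarith
    · have := min_le_right (tB B / 8) (c / (6 * tB B))
      rw [le_div_iff₀ (by positivity)] at this; linarith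
  set B' := B + ipB n (2 * (-δ)) with hB'
  have hB's : ∀ v w, B' v w = B' w v := add_symm hB _
  have hl1 : 0 ≤ tB B' := by
    rw [hB', tB_add]
    have := mul_le_mul_of_nonneg_right hn4 hδ.le
    linarith
  have hl2 : fB B' ≤ tB B' ^ 2 := by
    rw [hB', tB_add, fB_add]
    have h1 : (n:ℝ) * δ * tB B ≤ 4 * δ * tB B := by gcongr
    have h2 : (n:ℝ) * δ ^ 2 ≤ n * (n * δ ^ 2) := le_mul_of_one_le_left (by positivity) hn1
    nlinarith
  obtain ⟨r1, hr1, H⟩ := hexp (δ / 8) (by positivity)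
  obtain ⟨r, hr, hrr1, hrR⟩ : ∃ r > 0, r < r1 ∧ ‖x0‖ + r < R' := by
    refine ⟨min (r1 / 2) ((R' - ‖x0‖) / 2), ?_, ?_, ?_⟩
    · have : 0 < R' - ‖x0‖ := by linarith
      positivity
    · exact lt_of_le_of_lt (min_le_left _ _) (by linarith)
    · have := min_le_right (r1 / 2) ((R' - ‖x0‖) / 2); linarith
  have hsub : ∀ z ∈ Metric.closedBall x0 r, z ∈ Metric.closedBall (0 : EuclideanSpace ℝ (Fin n)) R' := by
    intro z hz
    rw [mem_closedBall_iff_norm] at hz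
    rw [mem_closedBall_zero_iff]
    have := norm_add_le (z - x0) x0
    rw [sub_add_cancel] at this; linarith
  obtain ⟨N, hN⟩ := hconv (δ * r ^ 2 / 8) (by positivity)
  obtain ⟨C, hC⟩ := pogorelov (M := M) (G := ‖p‖ + ‖B'‖ * r) (H := δ * r ^ 2)
    (e0 := δ * r ^ 2 / 8) hn hc (by positivity)
  refine ⟨C, r / 4, by positivity, N, fun k hk y hy => ?_⟩
  have hq : ∀ z, qd (w x0 + δ * r ^ 2 / 2) p B' x0 z =
      qd (w x0) p B x0 z - δ * ‖z - x0‖ ^ 2 + δ * r ^ 2 / 2 := fun z => by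
    rw [hB', qd_add]; unfold qd; ring
  have hdr : 0 < δ * r ^ 2 := by positivity
  have hclose : ∀ z ∈ Metric.closedBall x0 r, |U k z - qd (w x0) p B x0 z| ≤ δ * r ^ 2 / 4 := by
    intro z hz
    have h1 := hN k hk z (hsub z hz)
    rw [mem_closedBall_iff_norm] at hz
    have h3 := H z (by rw [mem_ball_iff_norm]; linarith)
    have h4 : δ / 8 * ‖z - x0‖ ^ 2 ≤ δ / 8 * r ^ 2 := by gcongr
    rw [abs_le] at h1 h3 ⊢
    constructor <;> linarith
  refine hC R (U k) (hU k) (qd (w x0 + δ * r ^ 2 / 2) p B' x0) qd_smooth x0 r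
    (fun z hz => Metric.closedBall_subset_ball hR' (hsub z hz)) ?_ ?_ y
    (Metric.ball_subset_ball (by linarith) hy) ?_
  · intro z hz
    have hzc := Metric.ball_subset_closedBall hz
    refine ⟨by rw [lap_qd hB's]; exact hl1, by rw [frob_qd hB's, lap_qd hB's]; exact hl2, ?_, ?_⟩
    · rw [(qd_deriv hB's z).fderiv]
      rw [mem_ball_iff_norm] at hz
      refine (norm_add_le _ _).trans ?_
      gcongr
      exact (B'.le_opNorm _).trans (by gcongr)
    · rw [hq]
      have h1 := (abs_le.1 (hclose z hzc)).1
      have h2 : 0 ≤ δ * ‖z - x0‖ ^ 2 := by positivity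
      linarith
  · intro z hz
    have hzc := Metric.sphere_subset_closedBall hz
    rw [hq]
    have h1 := (abs_le.1 (hclose z hzc)).1
    rw [mem_sphere_iff_norm] at hz
    rw [hz]; linarith
  · rw [hq]
    have h1 := (abs_le.1 (hclose y (Metric.ball_subset_closedBall
      (Metric.ball_subset_ball (by linarith) hy)))).2
    rw [mem_ball_iff_norm] at hy
    have h2 : ‖y - x0‖ ^ 2 ≤ (r / 4) ^ 2 := pow_le_pow_left₀ (norm_nonneg _) hy.le 2
    have h3 := mul_le_mul_of_nonneg_left h2 hδ.le
    linarith

end visc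
end SY
namespace SY
open scoped ContDiff
open Finset Filter Topology MeasureTheory

section compactness
variable {n : ℕ}

lemma subseq {c R M R' : ℝ} {U : ℕ → EuclideanSpace ℝ (Fin n) → ℝ} (hU : ∀ k, Sol c R M (U k))
    (hR' : R' < R) (hM : 0 ≤ M) :
    ∃ ph : ℕ → ℕ, StrictMono ph ∧ ∃ w : EuclideanSpace ℝ (Fin n) → ℝ, ∀ e > 0, ∃ N, ∀ k ≥ N,
      ∀ y ∈ Metric.closedBall (0 : EuclideanSpace ℝ (Fin n)) R', |U (ph k) y - w y| ≤ e := by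
  have hsub : Metric.closedBall (0 : EuclideanSpace ℝ (Fin n)) R' ⊆ Metric.ball 0 R :=
    Metric.closedBall_subset_ball hR'
  have hlip : ∀ k, ∀ x ∈ Metric.closedBall (0 : EuclideanSpace ℝ (Fin n)) R',
      ∀ y ∈ Metric.closedBall (0 : EuclideanSpace ℝ (Fin n)) R',
      |U k x - U k y| ≤ M * dist x y := by
    intro k x hx y hy
    have h := (convex_ball (0 : EuclideanSpace ℝ (Fin n)) R).norm_image_sub_le_of_norm_fderiv_le
      (f := U k) (C := M) (𝕜 := ℝ)
      (fun z _ => ((hU k).smooth.differentiable (by simp)) z)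
      (fun z hz => (hU k).bd1 z hz) (hsub hy) (hsub hx)
    rw [dist_eq_norm]; exact h
  haveI : CompactSpace (Metric.closedBall (0 : EuclideanSpace ℝ (Fin n)) R') :=
    isCompact_iff_compactSpace.mp (isCompact_closedBall _ _)
  let F : ℕ → BoundedContinuousFunction (Metric.closedBall (0 : EuclideanSpace ℝ (Fin n)) R') ℝ :=
    fun k => BoundedContinuousFunction.mkOfCompact
      ⟨fun x => U k x, (hU k).smooth.continuous.comp continuous_subtype_val⟩
  have hF : ∀ k x, F k x = U k x := fun k x => rfl
  have hcomp : IsCompact (closure (Set.range F)) := by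
    apply BoundedContinuousFunction.arzela_ascoli (Metric.closedBall (0:ℝ) M) (isCompact_closedBall _ _)
    · rintro f x ⟨k, rfl⟩
      rw [hF, mem_closedBall_zero_iff]
      exact (hU k).bd0 _ (hsub x.2)
    · apply Metric.equicontinuous_of_continuity_modulus (fun t => M * t)
      · have : Continuous fun t : ℝ => M * t := by fun_prop
        simpa using this.tendsto 0
      · rintro x y ⟨f, k, rfl⟩
        exact hlip k x x.2 y y.2
  obtain ⟨g, -, ph, hph, hg⟩ := hcomp.tendsto_subseq (x := F)
    (fun k => subset_closure (Set.mem_range_self k))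
  classical
  refine ⟨ph, hph, fun y => if h : y ∈ Metric.closedBall (0 : EuclideanSpace ℝ (Fin n)) R'
    then g ⟨y, h⟩ else 0, ?_⟩
  intro e he
  obtain ⟨N, hN⟩ := Metric.tendsto_atTop.mp hg e he
  refine ⟨N, fun k hk y hy => ?_⟩
  simp only [hy, dif_pos]
  have h1 := (BoundedContinuousFunction.dist_coe_le_dist (f := F (ph k)) (g := g) ⟨y, hy⟩).trans
    (hN k hk).le
  exact h1

lemma limsup_meas {A : ℕ → Set (EuclideanSpace ℝ (Fin n))} {m : ENNReal} {ep : ℝ}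
    (hA : ∀ k, IsClosed (A k)) (hb : ∀ k, A k ⊆ Metric.closedBall 0 ep)
    (hm : ∀ k, m ≤ volume (A k)) :
    MeasurableSet (⋂ N, ⋃ k, A (N + k)) ∧ m ≤ volume (⋂ N, ⋃ k, A (N + k)) := by
  have hms : ∀ N, MeasurableSet (⋃ k, A (N + k)) := fun N =>
    MeasurableSet.iUnion fun k => (hA _).measurableSet
  refine ⟨MeasurableSet.iInter hms, ?_⟩
  have hanti : Antitone fun N => ⋃ k, A (N + k) := by
    intro N N' h x hx
    simp only [Set.mem_iUnion] at hx ⊢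
    obtain ⟨k, hk⟩ := hx
    refine ⟨N' - N + k, ?_⟩
    rwa [show N + (N' - N + k) = N' + k by omega]
  have ht := tendsto_measure_iInter_atTop (μ := volume) (fun N => (hms N).nullMeasurableSet) hanti
    ⟨0, (lt_of_le_of_lt (measure_mono (Set.iUnion_subset fun k => hb _))
      (isCompact_closedBall _ _).measure_lt_top).ne⟩
  refine ge_of_tendsto' ht fun N => (hm (N + 0)).trans (measure_mono ?_)
  exact Set.subset_iUnion (fun k => A (N + k)) 0

lemma limit_p {R' M C r0 : ℝ} {U : ℕ → EuclideanSpace ℝ (Fin n) → ℝ}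
    {w : EuclideanSpace ℝ (Fin n) → ℝ} {x : EuclideanSpace ℝ (Fin n)}
    (hconv : ∀ e > 0, ∃ N, ∀ k ≥ N,
      ∀ y ∈ Metric.closedBall (0 : EuclideanSpace ℝ (Fin n)) R', |U k y - w y| ≤ e)
    (hx : ∀ y ∈ Metric.ball x r0, y ∈ Metric.closedBall (0 : EuclideanSpace ℝ (Fin n)) R')
    (hr0 : 0 < r0)
    (hfr : ∀ N, ∃ k ≥ N, ‖fderiv ℝ (U k) x‖ ≤ M ∧ ∀ y ∈ Metric.ball x r0,
      |U k y - U k x - fderiv ℝ (U k) x (y - x)| ≤ C * ‖y - x‖ ^ 2) :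
    ∃ p : EuclideanSpace ℝ (Fin n) →L[ℝ] ℝ, ∀ y ∈ Metric.ball x r0,
      |w y - w x - p (y - x)| ≤ C * ‖y - x‖ ^ 2 := by
  choose k hk hkM hkE using hfr
  obtain ⟨p, -, ps, hps, hp⟩ := (isCompact_closedBall (0 : EuclideanSpace ℝ (Fin n) →L[ℝ] ℝ) M).tendsto_subseq
    (x := fun N => fderiv ℝ (U (k N)) x) (fun N => by rw [mem_closedBall_zero_iff]; exact hkM N)
  refine ⟨p, fun y hy => ?_⟩
  have hkt : Tendsto (fun N => k (ps N)) atTop atTop :=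
    tendsto_atTop_mono (fun N => hk (ps N)) hps.tendsto_atTop
  have hpt : ∀ z ∈ Metric.closedBall (0 : EuclideanSpace ℝ (Fin n)) R',
      Tendsto (fun N => U (k (ps N)) z) atTop (𝓝 (w z)) := by
    intro z hz
    have : Tendsto (fun j => U j z) atTop (𝓝 (w z)) := by
      rw [Metric.tendsto_atTop]
      intro e he
      obtain ⟨N, hN⟩ := hconv (e / 2) (by linarith)
      refine ⟨N, fun j hj => ?_⟩
      rw [Real.dist_eq]; linarith [hN j hj z hz]
    exact this.comp hkt
  have hl : Tendsto (fun N => fderiv ℝ (U (k (ps N))) x (y - x)) atTop (𝓝 (p (y - x))) := by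
    have : Continuous fun q : EuclideanSpace ℝ (Fin n) →L[ℝ] ℝ => q (y - x) := by fun_prop
    exact (this.tendsto p).comp hp
  refine le_of_tendsto' (((hpt y (hx y hy)).sub (hpt x (hx x (Metric.mem_ball_self hr0)))).sub hl).abs ?_
  intro N
  exact hkE (ps N) y hy

lemma lap_bound (hn : n = 3 ∨ n = 4) {c M R : ℝ} (hc : 0 < c) (hM : 1 ≤ M) (hR : 0 < R) (hR1 : R ≤ 1) :
    ∃ C, ∀ u : EuclideanSpace ℝ (Fin n) → ℝ, Sol c R M u → lap u 0 ≤ C := by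
  by_contra hcon
  push Not at hcon
  choose U0 hU0 hbig using fun k : ℕ => hcon (k : ℝ)
  have hR' : 3 * R / 4 < R := by linarith
  obtain ⟨ph, hph, w, hconv⟩ := subseq hU0 hR' (by linarith)
  obtain ⟨U, hUd⟩ : ∃ U : ℕ → EuclideanSpace ℝ (Fin n) → ℝ, ∀ k, U k = U0 (ph k) := ⟨_, fun _ => rfl⟩
  have hU : ∀ k, Sol c R M (U k) := fun k => by rw [hUd]; exact hU0 _
  have hbg : ∀ k : ℕ, (k : ℝ) < lap (U k) 0 := fun k => by
    rw [hUd]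
    refine lt_of_le_of_lt ?_ (hbig (ph k))
    exact_mod_cast hph.le_apply
  simp only [← hUd] at hconv
  obtain ⟨K, hKd⟩ : ∃ K, K = 2 * M / (R / 32 / 2) ^ 2 := ⟨_, rfl⟩
  have hK : 0 < K := by rw [hKd]; positivity
  have hKe : 2 * M ≤ K * (R / 32 / 2) ^ 2 := by
    rw [hKd, div_mul_cancel₀]; positivity
  obtain ⟨C, hC, hg⟩ := grad_est (n := n) hn (c := c) (M := M) (R0 := R / 2) (K := K) hc (by linarith)
    hK.le (by linarith) (by linarith)
  obtain ⟨hAm, hAv⟩ := limsup_meas (A := fun k => contact (U k) K (3 * R / 4) (R / 32)) (ep := R / 32)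
    (fun k => contact_closed (hU k).smooth) (fun k x hx => hx.1)
    (fun k => contact_meas (hU k) hK hR' (by linarith) (by linarith) hKe)
  set A := ⋂ N, ⋃ k, contact (U (N + k)) K (3 * R / 4) (R / 32) with hAd
  have hA : A ⊆ Metric.closedBall 0 (R / 32) := by
    intro x hx
    obtain ⟨k, hk⟩ := Set.mem_iUnion.mp (Set.mem_iInter.mp hx 0)
    exact hk.1
  have hpx : ∀ x : EuclideanSpace ℝ (Fin n), ∃ p : EuclideanSpace ℝ (Fin n) →L[ℝ] ℝ, x ∈ A →
      ∀ y ∈ Metric.ball x (R / 2 / 2), |w y - w x - p (y - x)| ≤ C * ‖y - x‖ ^ 2 := by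
    intro x
    by_cases hxA : x ∈ A
    swap
    · exact ⟨0, fun h => absurd h hxA⟩
    have hxn := mem_closedBall_zero_iff.mp (hA hxA)
    have hin : Metric.closedBall x (R / 2) ⊆ Metric.closedBall 0 (3 * R / 4) := by
      intro y hy
      rw [mem_closedBall_iff_norm] at hy
      rw [mem_closedBall_zero_iff]
      have := norm_add_le (y - x) x
      rw [sub_add_cancel] at this
      linarith
    obtain ⟨p, hp⟩ := limit_p (x := x) (M := M) (C := C) (r0 := R / 2 / 2) hconv
      (fun y hy => hin (Metric.ball_subset_closedBall (Metric.ball_subset_ball (by linarith) hy)))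
      (by linarith) (by
        intro N
        obtain ⟨k, hk⟩ := Set.mem_iUnion.mp (Set.mem_iInter.mp hxA N)
        refine ⟨N + k, by omega, (hU _).bd1 _ (by rw [mem_ball_zero_iff]; linarith), ?_⟩
        exact hg R _ (hU _) x (hin.trans (Metric.closedBall_subset_ball hR'))
          (fun z hz => hk.2 z (hin hz)))
    exact ⟨p, fun _ => hp⟩
  choose p hp using hpx
  have hvol : 0 < volume A :=
    lt_of_lt_of_le (Metric.measure_ball_pos _ _ (by linarith)) hAv
  obtain ⟨x0, hx0, B, hB, hexp⟩ := alex hC hA (by linarith) (by linarith : 0 < R / 2 / 2) hAm hvol hp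
  have hxn := mem_closedBall_zero_iff.mp (hA hx0)
  obtain ⟨C1, r, hr, N, hloc⟩ := local_bd hn hc hU hR' hconv (by linarith) hB hexp
  obtain ⟨C2, hC2⟩ := doubling (n := n) hn (c := c) (M := M) (r := min r (R / 2)) (R := R / 2) (S0 := C1)
    hc hM (lt_min hr (by linarith)) (min_le_right _ _) (by linarith)
  obtain ⟨k, hk⟩ := exists_nat_ge C2
  have h1 := hC2 R (U (max N k)) (hU _) x0 (by
      intro y hy
      rw [mem_closedBall_iff_norm] at hy
      rw [mem_ball_zero_iff]
      have := norm_add_le (y - x0) x0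
      rw [sub_add_cancel] at this
      linarith)
    (fun y hy => hloc _ (le_max_left _ _) y (Metric.ball_subset_ball (min_le_left _ _) hy)) 0
    (by rw [mem_closedBall_iff_norm, zero_sub, norm_neg]; linarith)
  have h2 := hbg (max N k)
  have h3 : (k : ℝ) ≤ (max N k : ℕ) := by exact_mod_cast le_max_right _ _
  linarith

end compactness
end SY
namespace SY
open scoped ContDiff
open Finset Filter Topology

section final
variable {n : ℕ}

lemma sigma_one (lam : Fin n → ℝ) : sigma n 1 lam = ∑ i, lam i := by
  unfold sigma
  rw [Finset.powersetCard_one, Finset.sum_map]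
  simp

lemma sigma_two (hn : n = 3 ∨ n = 4) (lam : Fin n → ℝ) :
    2 * sigma n 2 lam = (∑ i, lam i) ^ 2 - ∑ i, lam i ^ 2 := by
  unfold sigma
  rcases hn with rfl | rfl
  · rw [show (Finset.univ : Finset (Fin 3)).powersetCard 2 = {{0,1},{0,2},{1,2}} by decide]
    rw [Finset.sum_insert (by decide), Finset.sum_insert (by decide), Finset.sum_singleton,
      Finset.prod_pair (by decide), Finset.prod_pair (by decide), Finset.prod_pair (by decide)]
    simp only [Fin.sum_univ_three]
    ring
  · rw [show (Finset.univ : Finset (Fin 4)).powersetCard 2 =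
      {{0,1},{0,2},{0,3},{1,2},{1,3},{2,3}} by decide]
    rw [Finset.sum_insert (by decide), Finset.sum_insert (by decide), Finset.sum_insert (by decide),
      Finset.sum_insert (by decide), Finset.sum_insert (by decide), Finset.sum_singleton,
      Finset.prod_pair (by decide), Finset.prod_pair (by decide), Finset.prod_pair (by decide),
      Finset.prod_pair (by decide), Finset.prod_pair (by decide), Finset.prod_pair (by decide)]
    simp only [Fin.sum_univ_four]
    ring

lemma sum_sq_eig {H : Matrix (Fin n) (Fin n) ℝ} (h : H.IsHermitian) :
    ∑ i, ∑ j, H i j ^ 2 = ∑ i, h.eigenvalues i ^ 2 := by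
  have h1 : ∑ i, ∑ j, H i j ^ 2 = (H * H).trace := by
    simp only [Matrix.trace, Matrix.diag, Matrix.mul_apply]
    refine Finset.sum_congr rfl fun i _ => Finset.sum_congr rfl fun j _ => ?_
    have := h.apply i j
    simp only [star_trivial] at this
    rw [this]; ring
  have h2 := h.spectral_theorem
  rw [h1]
  conv_lhs => rw [h2, ← map_mul]
  rw [Unitary.conjStarAlgAut_apply, Matrix.trace_mul_cycle, Unitary.coe_star_mul_self, one_mul,
    Matrix.diagonal_mul_diagonal, Matrix.trace_diagonal]
  simp [sq]

lemma sum_eig {H : Matrix (Fin n) (Fin n) ℝ} (h : H.IsHermitian) :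
    ∑ i, H i i = ∑ i, h.eigenvalues i := by
  have := h.trace_eq_sum_eigenvalues
  simpa [Matrix.trace] using this

lemma reduce (hn : n = 3 ∨ n = 4) {M : ℝ} (hM : 0 < M) (u : EuclideanSpace ℝ (Fin n) → ℝ)
    (hu : ContDiffOn ℝ (⊤ : ℕ∞) u (Metric.ball (0 : EuclideanSpace ℝ (Fin n)) 1))
    (hsym : ∀ x ∈ Metric.ball (0 : EuclideanSpace ℝ (Fin n)) 1, (hess u x).IsHermitian)
    (heq : ∀ x (hx : x ∈ Metric.ball (0 : EuclideanSpace ℝ (Fin n)) 1),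
      InGamma n 2 ((hsym x hx).eigenvalues) ∧
      sigma n 2 ((hsym x hx).eigenvalues) / sigma n 1 ((hsym x hx).eigenvalues) = 1)
    (hb : ∀ x ∈ Metric.ball (0 : EuclideanSpace ℝ (Fin n)) 1,
      ∀ y ∈ Metric.ball (0 : EuclideanSpace ℝ (Fin n)) 1, |u x| + ‖fderiv ℝ u y‖ ≤ M) :
    ∃ v : EuclideanSpace ℝ (Fin n) → ℝ, Sol (n / (n - 1) / 2) (1 / 2) (M + 1) v ∧
      ∀ i j, hess u 0 i j = dd (EuclideanSpace.basisFun (Fin n) ℝ i)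
        (dd (EuclideanSpace.basisFun (Fin n) ℝ j) v) 0 + 1 / (n - 1) * (if i = j then 1 else 0) := by
  have hn3 : (3:ℝ) ≤ n := by exact_mod_cast (by omega : 3 ≤ n)
  obtain ⟨t, ht⟩ : ∃ t : ℝ, t = 1 / ((n:ℝ) - 1) := ⟨_, rfl⟩
  have ht1 : t * (n - 1) = 1 := by rw [ht]; field_simp; exact div_self (by linarith)
  have ht0 : 0 < t := by rw [ht]; exact one_div_pos.mpr (by linarith)
  have hth : t ≤ 1 / 2 := by nlinarith
  let f : ContDiffBump (0 : EuclideanSpace ℝ (Fin n)) := ⟨1 / 2, 3 / 4, by norm_num, by norm_num⟩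
  obtain ⟨W, hW⟩ : ∃ W : EuclideanSpace ℝ (Fin n) → ℝ, ∀ x, W x = f x * u x := ⟨_, fun _ => rfl⟩
  have hWs : ContDiff ℝ ∞ W := by
    have : W = fun x => f x * u x := funext hW
    rw [this, contDiff_iff_contDiffAt]
    intro x
    by_cases hx : x ∈ Metric.ball (0 : EuclideanSpace ℝ (Fin n)) 1
    · exact f.contDiff.contDiffAt.mul (hu.contDiffAt (Metric.isOpen_ball.mem_nhds hx))
    · have hx2 : x ∈ (Metric.closedBall (0 : EuclideanSpace ℝ (Fin n)) (3 / 4))ᶜ := by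
        simp only [Metric.mem_ball, not_lt] at hx
        simp only [Set.mem_compl_iff, Metric.mem_closedBall, not_le]; linarith
      have he : (fun x => f x * u x) =ᶠ[𝓝 x] fun _ => 0 := by
        filter_upwards [Metric.isClosed_closedBall.isOpen_compl.mem_nhds hx2] with y hy
        simp only [Set.mem_compl_iff, Metric.mem_closedBall, not_le] at hy
        rw [f.zero_of_le_dist (by exact hy.le), zero_mul]
      exact contDiffAt_const.congr_of_eventuallyEq he
  have hWu : ∀ x ∈ Metric.ball (0 : EuclideanSpace ℝ (Fin n)) (1 / 2), W =ᶠ[𝓝 x] u := by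
    intro x hx
    filter_upwards [Metric.isOpen_ball.mem_nhds hx] with y hy
    rw [hW, f.one_of_mem_closedBall (Metric.ball_subset_closedBall hy), one_mul]
  have hsub : Metric.ball (0 : EuclideanSpace ℝ (Fin n)) (1 / 2) ⊆ Metric.ball 0 1 :=
    Metric.ball_subset_ball (by norm_num)
  have hH : ∀ x ∈ Metric.ball (0 : EuclideanSpace ℝ (Fin n)) (1 / 2), ∀ i j,
      dd (EuclideanSpace.basisFun (Fin n) ℝ i) (dd (EuclideanSpace.basisFun (Fin n) ℝ j) W) x
        = hess u x i j := by
    intro x hx i j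
    have h1 : dd (EuclideanSpace.basisFun (Fin n) ℝ j) W =ᶠ[𝓝 x]
        fun y => fderiv ℝ u y (EuclideanSpace.single j 1) := by
      filter_upwards [Metric.isOpen_ball.mem_nhds hx] with y hy
      rw [dd, (hWu y hy).fderiv_eq, EuclideanSpace.basisFun_apply]
    rw [dd, h1.fderiv_eq, EuclideanSpace.basisFun_apply]
    rfl
  set Q : EuclideanSpace ℝ (Fin n) → ℝ := qd 0 0 (ipB n (2 * (t / 2))) 0 with hQ
  have hQs : ContDiff ℝ ∞ Q := qd_smooth
  have hv2 : ∀ x ∈ Metric.ball (0 : EuclideanSpace ℝ (Fin n)) (1 / 2), ∀ i j,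
      dd (EuclideanSpace.basisFun (Fin n) ℝ i) (dd (EuclideanSpace.basisFun (Fin n) ℝ j)
        (fun x => W x - Q x)) x = hess u x i j - t * (if i = j then 1 else 0) := by
    intro x hx i j
    rw [dd_sub hWs hQs, dd_sub (dd_smooth hWs) (dd_smooth hQs), hQ, qd_dd2 (ipB_symm _)]
    beta_reduce
    rw [hH x hx,
      ipB_apply, orthonormal_iff_ite.mp (EuclideanSpace.basisFun (Fin n) ℝ).orthonormal i j]
    ring
  have hz : (0 : EuclideanSpace ℝ (Fin n)) ∈ Metric.ball (0 : EuclideanSpace ℝ (Fin n)) (1 / 2) :=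
    Metric.mem_ball_self (by norm_num)
  have key : ∀ x ∈ Metric.ball (0 : EuclideanSpace ℝ (Fin n)) (1 / 2), ∃ s q : ℝ,
      lap (fun x => W x - Q x) x = s - n * t ∧ frob (fun x => W x - Q x) x = q - 2 * t * s + n * t ^ 2 ∧
      0 < s ∧ s ^ 2 - q = 2 * s ∧ s ^ 2 ≤ n * q := by
    intro x hx
    have hx1 := hsub hx
    obtain ⟨hg, he⟩ := heq x hx1
    set lam := (hsym x hx1).eigenvalues with hlam
    have h1 := hg 1 le_rfl (by norm_num)
    rw [div_eq_one_iff_eq h1.ne'] at he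
    have h2 := sigma_two hn lam
    rw [he] at h2
    rw [sigma_one] at h1 h2
    refine ⟨∑ i, lam i, ∑ i, lam i ^ 2, ?_, ?_, h1, h2.symm, ?_⟩
    · unfold lap
      simp only [hv2 x hx]
      rw [Finset.sum_sub_distrib, sum_eig (hsym x hx1), ← hlam]
      simp
    · unfold frob
      simp only [hv2 x hx]
      have e : ∀ i j, (hess u x i j - t * (if i = j then 1 else 0)) ^ 2 =
          hess u x i j ^ 2 - (if i = j then 2 * t * hess u x i j - t ^ 2 else 0) := by
        intro i j; split_ifs <;> ring
      simp only [e, Finset.sum_sub_distrib, Finset.sum_ite_eq, Finset.mem_univ, if_true]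
      rw [sum_sq_eig (hsym x hx1), ← Finset.mul_sum, sum_eig (hsym x hx1)]
      simp
      ring
    · have := sq_sum_le_card_mul_sum_sq (s := (Finset.univ : Finset (Fin n))) (f := lam)
      simpa using this
  refine ⟨fun x => W x - Q x, ⟨hWs.sub hQs, ?_, ?_, ?_, ?_⟩, ?_⟩
  · intro x hx
    obtain ⟨s, q, hl, -, hs, h1, h2⟩ := key x hx
    rw [hl]
    have h3 : 2 * n ≤ (n - 1) * s := by nlinarith
    have h4 : t * (2 * n) ≤ t * ((n - 1) * s) := by gcongr
    have h5 : t * ((n - 1) * s) = s := by rw [← mul_assoc, ht1, one_mul]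
    nlinarith
  · intro x hx
    obtain ⟨s, q, hl, hf, hs, h1, h2⟩ := key x hx
    rw [hl, hf, show 2 * ((n:ℝ) / (n - 1) / 2) = n * t by rw [ht]; ring]
    have h6 : t * n = 1 + t := by linarith
    have : (s - n * t) ^ 2 - (q - 2 * t * s + n * t ^ 2) =
      (s ^ 2 - q) - 2 * s * (t * (n - 1)) + n * t * (t * (n - 1)) := by ring
    rw [this, h1, ht1]; ring
  · intro x hx
    have h1 := hb x (hsub hx) x (hsub hx)
    have hxn := mem_ball_zero_iff.mp hx
    have h0 := norm_nonneg x
    have h2 := norm_nonneg (fderiv ℝ u x)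
    have hQx : Q x = t / 2 * ‖x‖ ^ 2 := by rw [hQ, qd_ip]; simp
    have hQ1 : 0 ≤ Q x := by rw [hQx]; positivity
    have hQ2 : Q x ≤ 1 := by rw [hQx]; nlinarith
    rw [(hWu x hx).eq_of_nhds]
    have := abs_sub (u x) (Q x)
    rw [abs_of_nonneg hQ1] at this
    linarith
  · intro x hx
    have h1 := hb x (hsub hx) x (hsub hx)
    have hxn := mem_ball_zero_iff.mp hx
    have h2 := abs_nonneg (u x)
    have e : fderiv ℝ (fun x => W x - Q x) x = fderiv ℝ u x - ipB n (2 * (t / 2)) x := by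
      rw [fderiv_fun_sub (hWs.differentiable (by simp) x) (hQs.differentiable (by simp) x),
        (hWu x hx).fderiv_eq, hQ, (qd_deriv (ipB_symm _) x).fderiv]
      simp
    rw [e]
    have h3 : ‖ipB n (2 * (t / 2)) x‖ ≤ 1 := by
      have : ipB n (2 * (t / 2)) x = t • innerSL ℝ x := by
        ext y; rw [show 2 * (t / 2) = t by ring]; rfl
      rw [this, norm_smul, innerSL_apply_norm, Real.norm_eq_abs, abs_of_pos ht0]
      nlinarith [norm_nonneg x]
    have := norm_sub_le (fderiv ℝ u x) (ipB n (2 * (t / 2)) x)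
    linarith
  · intro i j
    rw [hv2 0 hz, ht]; ring

lemma main (hn : n = 3 ∨ n = 4) (M : ℝ) (hM : 0 < M) : ∃ C : ℝ, 0 < C ∧
      ∀ u : EuclideanSpace ℝ (Fin n) → ℝ,
        ContDiffOn ℝ (⊤ : ℕ∞) u (Metric.ball (0 : EuclideanSpace ℝ (Fin n)) 1) →
        ∀ hsym : ∀ x ∈ Metric.ball (0 : EuclideanSpace ℝ (Fin n)) 1, (hess u x).IsHermitian,
        (∀ x (hx : x ∈ Metric.ball (0 : EuclideanSpace ℝ (Fin n)) 1),
          InGamma n 2 ((hsym x hx).eigenvalues) ∧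
          sigma n 2 ((hsym x hx).eigenvalues) / sigma n 1 ((hsym x hx).eigenvalues) = 1) →
        (∀ x ∈ Metric.ball (0 : EuclideanSpace ℝ (Fin n)) 1,
          ∀ y ∈ Metric.ball (0 : EuclideanSpace ℝ (Fin n)) 1,
            |u x| + ‖fderiv ℝ u y‖ ≤ M) →
        ∀ i j, |hess u 0 i j| ≤ C := by
  have hn3 : (3:ℝ) ≤ n := by exact_mod_cast (by omega : 3 ≤ n)
  have hc : 0 < (n:ℝ) / (n - 1) / 2 := div_pos (div_pos (by linarith) (by linarith)) (by norm_num)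
  obtain ⟨C, hC⟩ := lap_bound hn hc (by linarith : 1 ≤ M + 1) (by norm_num : (0:ℝ) < 1 / 2) (by norm_num)
  refine ⟨|C| + 1, by positivity, ?_⟩
  intro u hu hsym heq hb i j
  obtain ⟨v, S, hv⟩ := reduce hn hM u hu hsym heq hb
  have hz : (0 : EuclideanSpace ℝ (Fin n)) ∈ Metric.ball (0 : EuclideanSpace ℝ (Fin n)) (1 / 2) :=
    Metric.mem_ball_self (by norm_num)
  have h1 := hC v S
  have h2 := S.pos 0 hz
  have h3 := S.eq 0 hz
  have h4 : (dd (EuclideanSpace.basisFun (Fin n) ℝ i)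
      (dd (EuclideanSpace.basisFun (Fin n) ℝ j) v) 0) ^ 2 ≤ frob v 0 := by
    unfold frob
    refine le_trans ?_ (Finset.single_le_sum (fun i _ => Finset.sum_nonneg fun j _ => sq_nonneg _)
      (Finset.mem_univ i))
    exact Finset.single_le_sum (f := fun j => (dd (EuclideanSpace.basisFun (Fin n) ℝ i)
      (dd (EuclideanSpace.basisFun (Fin n) ℝ j) v) 0) ^ 2) (fun j _ => sq_nonneg _) (Finset.mem_univ j)
  have h5 := abs_le_of_sq_le_sq (by linarith : (dd (EuclideanSpace.basisFun (Fin n) ℝ i)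
      (dd (EuclideanSpace.basisFun (Fin n) ℝ j) v) 0) ^ 2 ≤ lap v 0 ^ 2) h2.le
  have h6 : |1 / ((n:ℝ) - 1) * (if i = j then 1 else 0)| ≤ 1 := by
    have h7 : 1 / ((n:ℝ) - 1) ≤ 1 := by rw [div_le_one (by linarith)]; linarith
    have h8 : 0 ≤ 1 / ((n:ℝ) - 1) := one_div_nonneg.mpr (by linarith)
    split_ifs
    · rw [mul_one, abs_of_nonneg h8]; exact h7
    · simp
  rw [hv]
  have h9 := abs_add_le (dd (EuclideanSpace.basisFun (Fin n) ℝ i)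
      (dd (EuclideanSpace.basisFun (Fin n) ℝ j) v) 0) (1 / ((n:ℝ) - 1) * (if i = j then 1 else 0))
  have h10 := le_abs_self C
  linarith

end final
end SY
/-- Interior `C²` estimate for `σ₂/σ₁ = 1` in dimensions `3` and `4`. -/
theorem stmt_10 (n : ℕ) (hn : n = 3 ∨ n = 4) :
    ∀ M : ℝ, 0 < M → ∃ C : ℝ, 0 < C ∧
      ∀ u : EuclideanSpace ℝ (Fin n) → ℝ,
        ContDiffOn ℝ (⊤ : ℕ∞) u (Metric.ball (0 : EuclideanSpace ℝ (Fin n)) 1) →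
        ∀ hsym : ∀ x ∈ Metric.ball (0 : EuclideanSpace ℝ (Fin n)) 1, (hess u x).IsHermitian,
        (∀ x (hx : x ∈ Metric.ball (0 : EuclideanSpace ℝ (Fin n)) 1),
          InGamma n 2 ((hsym x hx).eigenvalues) ∧
          sigma n 2 ((hsym x hx).eigenvalues) / sigma n 1 ((hsym x hx).eigenvalues) = 1) →
        (∀ x ∈ Metric.ball (0 : EuclideanSpace ℝ (Fin n)) 1,
          ∀ y ∈ Metric.ball (0 : EuclideanSpace ℝ (Fin n)) 1,
            |u x| + ‖fderiv ℝ u y‖ ≤ M) →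
        ∀ i j, |hess u 0 i j| ≤ C := by
  exact fun M hM => SY.main hn M hM
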